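/- arXiv:2509.23351 — 2 statements merged into one kernel-verified Lean document; each statement's English description precedes it below -/
import Mathlib

section
/- There is an absolute constant c > 0 with the following property. Let (Ω,𝓕,μ) be a probability space, let 𝓕_{i,j} be the canonical two-parameter product filtration on Ω^ℕ × Ω^ℕ, and let (f_{i,j})_{i,j≥0} be integrable functions such that f_{i,j} is 𝓕_{i,j}-measurable and f_{i,j} = 0 for all but finitely many (i,j). Then there exist functions α_{i,j}, β_{i,j}, γ_{i,j}, δ_{i,j}, each 𝓕_{i,j}-measurable, with f_{i,j} = α_{i,j} + β_{i,j} + γ_{i,j} + δ_{i,j} for all (i,j) and E[(Σ_{i,j}|f_{i,j}|²)^{1/2}] ≥ c · ( Σ_{i,j} E|α_{i,j}| + E[(Σ_{i,j} E_{i−1,j−1}|β_{i,j}|²)^{1/2}] + Σ_i E[(Σ_j E_{∞,j−1}|γ_{i,j}|²)^{1/2}] + Σ_j E[(Σ_i E_{i−1,∞}|δ_{i,j}|²)^{1/2}] ). -/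
open MeasureTheory

noncomputable section

/-- The canonical one-parameter product filtration on `Ω^ℕ`:
`𝓕 i = σ(x ↦ (x_0, …, x_i))`. -/
def canonF (Ω : Type) [MeasurableSpace Ω] (i : ℕ) : MeasurableSpace (ℕ → Ω) :=
  MeasurableSpace.comap (fun x (k : Fin (i + 1)) => x k) inferInstance

/-- The canonical two-parameter product filtration on `Ω^ℕ × Ω^ℕ`:
`𝓕_{i,j} = 𝓕_i ⊗ 𝓕_j`. -/
def canonF2 (Ω : Type) [MeasurableSpace Ω] (i j : ℕ) :
    MeasurableSpace ((ℕ → Ω) × (ℕ → Ω)) :=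
  (canonF Ω i).prod (canonF Ω j)

/-- `𝓕_{∞,j} = ⋁_i 𝓕_{i,j}`. -/
def canonF2InfR (Ω : Type) [MeasurableSpace Ω] (j : ℕ) :
    MeasurableSpace ((ℕ → Ω) × (ℕ → Ω)) :=
  ⨆ i, canonF2 Ω i j

/-- `𝓕_{i,∞} = ⋁_j 𝓕_{i,j}`. -/
def canonF2InfL (Ω : Type) [MeasurableSpace Ω] (i : ℕ) :
    MeasurableSpace ((ℕ → Ω) × (ℕ → Ω)) :=
  ⨆ j, canonF2 Ω i j

section Kernel
open scoped ENNReal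

theorem four_mul_sqrt_add_sqrt_le {a r : ℝ≥0∞} (h : a < r) :
    4 * a ^ (1 / 2 : ℝ) + r ^ (1 / 2 : ℝ) ≤ 4 * (a + r) ^ (1 / 2 : ℝ) := by
  rcases eq_or_ne r ⊤ with rfl | hr
  · simp
  lift r to NNReal using hr
  lift a to NNReal using h.ne_top
  norm_cast at h
  rw [← ENNReal.coe_add, ← ENNReal.coe_rpow_of_nonneg _ (by norm_num),
    ← ENNReal.coe_rpow_of_nonneg _ (by norm_num), ← ENNReal.coe_rpow_of_nonneg _ (by norm_num)]
  norm_cast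
  rw [← NNReal.sqrt_eq_rpow, ← NNReal.sqrt_eq_rpow, ← NNReal.sqrt_eq_rpow, ← NNReal.coe_le_coe]
  push_cast
  have hlt : (a : ℝ) ≤ r := by exact_mod_cast h.le
  have h1 := Real.sq_sqrt a.2
  have h2 := Real.sq_sqrt r.2
  have h3 := Real.sq_sqrt (add_nonneg a.2 r.2)
  have h4 := Real.sqrt_le_sqrt hlt
  simp only [NNReal.val_eq_coe] at h1 h2 h3
  have := Real.sqrt_nonneg (a : ℝ)
  refine abs_le_of_sq_le_sq' ?_ (by positivity) |>.2
  nlinarith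

theorem three_mul_sqrt_add_div_sqrt_le {a r : ℝ≥0∞} (h : r ≤ a) (h0 : a ≠ 0) (ht : a ≠ ⊤) :
    3 * a ^ (1 / 2 : ℝ) + r / a ^ (1 / 2 : ℝ) ≤ 3 * (a + r) ^ (1 / 2 : ℝ) := by
  lift a to NNReal using ht
  lift r to NNReal using ne_top_of_le_ne_top ENNReal.coe_ne_top h
  norm_cast at h h0
  rw [← ENNReal.coe_add, ← ENNReal.coe_rpow_of_nonneg _ (by norm_num),
    ← ENNReal.coe_rpow_of_nonneg _ (by norm_num), ← ENNReal.coe_div (by simp [h0])]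
  norm_cast
  rw [← NNReal.sqrt_eq_rpow, ← NNReal.sqrt_eq_rpow, ← NNReal.coe_le_coe]
  push_cast
  have hlt : (r : ℝ) ≤ a := by exact_mod_cast h
  have ha : (0 : ℝ) < a := by exact_mod_cast pos_iff_ne_zero.2 h0
  have hr : (0 : ℝ) ≤ r := r.2
  obtain ⟨s, hs, hsa⟩ : ∃ s : ℝ, 0 < s ∧ (a : ℝ) = s ^ 2 :=
    ⟨√a, Real.sqrt_pos.2 ha, (Real.sq_sqrt ha.le).symm⟩
  obtain ⟨t, ht, htr⟩ : ∃ t : ℝ, 0 ≤ t ∧ (r : ℝ) = t * s := ⟨r / s, by positivity, by field_simp⟩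
  have h3 := Real.sq_sqrt (add_nonneg ha.le hr)
  rw [hsa, htr] at h3
  rw [hsa, htr] at hlt ⊢
  rw [Real.sqrt_sq hs.le, mul_div_assoc, div_self hs.ne', mul_one]
  have hts : t ≤ s := by nlinarith
  refine abs_le_of_sq_le_sq' ?_ (by positivity) |>.2
  nlinarith

/-- The sum of the square roots of the terms exceeding the preceding partial sum is controlled by
the square root of the total sum. -/
theorem sum_sqrt_large_le (r : ℕ → ℝ≥0∞) (N : ℕ) :
    ∑ n ∈ Finset.range N, (if ∑ k ∈ Finset.range n, r k < r n then r n ^ (1 / 2 : ℝ) else 0) ≤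
      4 * (∑ k ∈ Finset.range N, r k) ^ (1 / 2 : ℝ) := by
  induction N with
  | zero => simp
  | succ N ih =>
    rw [Finset.sum_range_succ, Finset.sum_range_succ _ N]
    refine (add_le_add_left ih _).trans ?_
    split_ifs with h
    · exact four_mul_sqrt_add_sqrt_le h
    · rw [add_zero]
      gcongr
      exact le_self_add

/-- The normalised sum of the terms not exceeding the preceding partial sum is controlled by
the square root of the total sum. -/
theorem sum_div_sqrt_small_le (r : ℕ → ℝ≥0∞) (N : ℕ) :
    ∑ n ∈ Finset.range N, (if r n ≤ ∑ k ∈ Finset.range n, r k ∧ ∑ k ∈ Finset.range n, r k ≠ 0 ∧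
        ∑ k ∈ Finset.range n, r k ≠ ⊤ then
          r n / (∑ k ∈ Finset.range n, r k) ^ (1 / 2 : ℝ) else 0) ≤
      3 * (∑ k ∈ Finset.range N, r k) ^ (1 / 2 : ℝ) := by
  induction N with
  | zero => simp
  | succ N ih =>
    rw [Finset.sum_range_succ, Finset.sum_range_succ _ N]
    refine (add_le_add_left ih _).trans ?_
    split_ifs with h
    · exact three_mul_sqrt_add_div_sqrt_le h.1 h.2.1 h.2.2
    · rw [add_zero]
      gcongr
      exact le_self_add

variable {X : Type*} {m : MeasurableSpace X} [m0 : MeasurableSpace X]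

/-- A pointwise-defined family of probability measures representing the conditional expectation
with respect to `P` given `m` on nonnegative functions. -/
structure IsCondKernel (m : MeasurableSpace X) [m0 : MeasurableSpace X] (P : Measure X)
    (κ : X → Measure X) : Prop where
  le : m ≤ m0
  prob : ∀ z, IsProbabilityMeasure (κ z)
  meas : ∀ φ : X → ℝ≥0∞, Measurable φ → Measurable[m] fun z => ∫⁻ w, φ w ∂κ z
  pull : ∀ φ ψ : X → ℝ≥0∞, Measurable[m] φ → Measurable ψ → ∀ z,
    ∫⁻ w, φ w * ψ w ∂κ z = φ z * ∫⁻ w, ψ w ∂κ z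
  lintegral : ∀ φ : X → ℝ≥0∞, Measurable φ → ∫⁻ z, ∫⁻ w, φ w ∂κ z ∂P = ∫⁻ z, φ z ∂P

namespace IsCondKernel

variable {P : Measure X} {κ : X → Measure X}

theorem measurable_lintegral (h : IsCondKernel m P κ) {φ : X → ℝ≥0∞} (hφ : Measurable φ) :
    Measurable fun z => ∫⁻ w, φ w ∂κ z := (h.meas φ hφ).mono h.le le_rfl

theorem lintegral_mul (h : IsCondKernel m P κ) {φ ψ : X → ℝ≥0∞} (hφ : Measurable[m] φ)
    (hψ : Measurable ψ) :
    ∫⁻ z, φ z * ∫⁻ w, ψ w ∂κ z ∂P = ∫⁻ z, φ z * ψ z ∂P := by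
  rw [← h.lintegral (fun z => φ z * ψ z) ((hφ.mono h.le le_rfl).mul hψ)]
  exact lintegral_congr fun z => (h.pull φ ψ hφ hψ z).symm

theorem ae_ae (h : IsCondKernel m P κ) {p : X → Prop} (hp : ∀ᵐ w ∂P, p w) :
    ∀ᵐ z ∂P, ∀ᵐ w ∂κ z, p w := by
  have h0 : P (toMeasurable P {w | ¬ p w}) = 0 := by rw [measure_toMeasurable]; exact hp
  have hm : MeasurableSet (toMeasurable P {w | ¬ p w}) := measurableSet_toMeasurable _ _
  have h1 := h.lintegral _ (measurable_one.indicator hm)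
  simp only [lintegral_indicator_one hm, h0] at h1
  rw [lintegral_eq_zero_iff] at h1
  · filter_upwards [h1] with z hz
    exact measure_mono_null (subset_toMeasurable _ _) hz
  · simpa only [lintegral_indicator_one hm] using
      h.measurable_lintegral (measurable_one.indicator hm)

theorem sq_lintegral_le (h : IsCondKernel m P κ) {φ : X → ℝ≥0∞} (hφ : Measurable φ) (z : X) :
    (∫⁻ w, φ w ∂κ z) ^ 2 ≤ ∫⁻ w, φ w ^ 2 ∂κ z := by
  have := h.prob z
  have h1 := ENNReal.lintegral_mul_norm_pow_le (μ := κ z) (f := fun w => φ w ^ 2)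
    (g := fun _ => 1) (p := 1 / 2) (q := 1 / 2) (hφ.pow_const 2).aemeasurable
    aemeasurable_const (by norm_num) (by norm_num) (by norm_num)
  have h2 : ∀ x : ℝ≥0∞, (x ^ 2) ^ (1 / 2 : ℝ) = x := fun x => by
    rw [← ENNReal.rpow_natCast, ← ENNReal.rpow_mul]; norm_num
  have h3 : ∀ x : ℝ≥0∞, (x ^ (1 / 2 : ℝ)) ^ 2 = x := fun x => by
    rw [← ENNReal.rpow_natCast, ← ENNReal.rpow_mul]; norm_num
  simp only [h2, ENNReal.one_rpow, mul_one, lintegral_const, measure_univ] at h1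
  calc _ ≤ ((∫⁻ w, φ w ^ 2 ∂κ z) ^ (1 / 2 : ℝ)) ^ 2 := by gcongr
    _ = _ := h3 _

end IsCondKernel

theorem sq_sup_le_two_mul_sum (Y : ℕ → ℝ≥0∞) (M : ℕ) :
    ((Finset.range M).sup Y) ^ 2 ≤
      2 * ∑ n ∈ Finset.range M, Y n * ((Finset.range (n + 1)).sup Y - (Finset.range n).sup Y) := by
  induction M with
  | zero => simp
  | succ M ih =>
    rw [Finset.sum_range_succ, mul_add]
    refine le_trans ?_ (add_le_add_left ih _)
    rw [Finset.range_add_one, Finset.sup_insert]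
    set s := (Finset.range M).sup Y
    rcases le_total (Y M) s with h | h
    · rw [max_eq_right h]
      exact le_self_add
    · rw [max_eq_left h]
      obtain ⟨d, hd⟩ := exists_add_of_le h
      by_cases hs : s = ⊤
      · simp [hs]
      · rw [hd, ENNReal.add_sub_cancel_left hs]
        calc (s + d) ^ 2 ≤ (s + d) ^ 2 + d ^ 2 := le_self_add
          _ = _ := by ring

theorem sum_sup_sub (Y : ℕ → ℝ≥0∞) (M : ℕ) :
    ∑ n ∈ Finset.range M, ((Finset.range (n + 1)).sup Y - (Finset.range n).sup Y) =
      (Finset.range M).sup Y := by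
  induction M with
  | zero => simp
  | succ M ih =>
    rw [Finset.sum_range_succ, ih]
    exact add_tsub_cancel_of_le (Finset.sup_mono (Finset.range_subset_range.2 M.le_succ))

theorem measurable_range_sup {α : Type*} {m : MeasurableSpace α} {Y : ℕ → α → ℝ≥0∞} {M : ℕ}
    (hY : ∀ n < M, Measurable[m] (Y n)) :
    Measurable[m] fun z => (Finset.range M).sup fun n => Y n z := by
  induction M with
  | zero => simp
  | succ M ih =>
    simp only [Finset.range_add_one, Finset.sup_insert]
    exact (hY M M.lt_succ_self).sup (ih fun n hn => hY n (hn.trans M.lt_succ_self))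

theorem lintegral_sqrt_mul_sqrt_le (P : Measure X) {f g : X → ℝ≥0∞} (hf : Measurable f)
    (hg : Measurable g) :
    ∫⁻ z, (f z) ^ (1 / 2 : ℝ) * (g z) ^ (1 / 2 : ℝ) ∂P ≤
      (∫⁻ z, f z ∂P) ^ (1 / 2 : ℝ) * (∫⁻ z, g z ∂P) ^ (1 / 2 : ℝ) :=
  ENNReal.lintegral_mul_norm_pow_le hf.aemeasurable hg.aemeasurable
    (by norm_num) (by norm_num) (by norm_num)

theorem sq_sqrt (x : ℝ≥0∞) : (x ^ (1 / 2 : ℝ)) ^ 2 = x := by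
  rw [← ENNReal.rpow_natCast, ← ENNReal.rpow_mul]; norm_num

theorem sqrt_sq (x : ℝ≥0∞) : (x ^ 2) ^ (1 / 2 : ℝ) = x := by
  rw [← ENNReal.rpow_natCast, ← ENNReal.rpow_mul]; norm_num

/-- Doob's maximal inequality in `L²`. -/
theorem lintegral_sq_sup_le {P : Measure X} {ℬ : ℕ → MeasurableSpace X} {κ : ℕ → X → Measure X}
    (hκ : ∀ n, IsCondKernel (ℬ n) P (κ n)) (hℬ : Monotone ℬ) {φ : X → ℝ≥0∞} (hφ : Measurable φ)
    (M : ℕ) :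
    ∫⁻ z, ((Finset.range M).sup fun n => ∫⁻ w, φ w ∂κ n z) ^ 2 ∂P ≤ 4 * ∫⁻ z, φ z ^ 2 ∂P := by
  by_cases hfin : ∫⁻ z, φ z ^ 2 ∂P = ⊤
  · simp [hfin]
  set Y : ℕ → X → ℝ≥0∞ := fun n z => ∫⁻ w, φ w ∂κ n z with hY
  have hYm : ∀ n, Measurable[ℬ n] (Y n) := fun n => (hκ n).meas φ hφ
  have hYm' : ∀ n, Measurable (Y n) := fun n => (hκ n).measurable_lintegral hφ
  set S : ℕ → X → ℝ≥0∞ := fun n z => (Finset.range n).sup fun k => Y k z with hS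
  have hSm' : ∀ n, Measurable (S n) := fun n => measurable_range_sup fun k _ => hYm' k
  have hd : ∀ n, Measurable[ℬ n] fun z => S (n + 1) z - S n z := fun n =>
    (measurable_range_sup fun k hk => (hYm k).mono (hℬ (Nat.lt_succ_iff.1 hk)) le_rfl).sub
      (measurable_range_sup fun k hk => (hYm k).mono (hℬ hk.le) le_rfl)
  have hd' : ∀ n, Measurable fun z => S (n + 1) z - S n z := fun n => (hSm' _).sub (hSm' _)
  have hYd : ∀ n, Measurable fun z => Y n z * (S (n + 1) z - S n z) :=
    fun n => (hYm' n).mul (hd' n)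
  have hφd : ∀ n, Measurable fun z => φ z * (S (n + 1) z - S n z) := fun n => hφ.mul (hd' n)
  have key : ∫⁻ z, S M z ^ 2 ∂P ≤ 2 * ∫⁻ z, φ z * S M z ∂P := by
    calc ∫⁻ z, S M z ^ 2 ∂P
        ≤ ∫⁻ z, 2 * ∑ n ∈ Finset.range M, Y n z * (S (n + 1) z - S n z) ∂P :=
          lintegral_mono fun z => sq_sup_le_two_mul_sum _ _
      _ = 2 * ∑ n ∈ Finset.range M, ∫⁻ z, Y n z * (S (n + 1) z - S n z) ∂P := by
          rw [lintegral_const_mul _ (Finset.measurable_sum _ fun n _ => hYd n),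
            lintegral_finsetSum _ fun n _ => hYd n]
      _ = 2 * ∑ n ∈ Finset.range M, ∫⁻ z, φ z * (S (n + 1) z - S n z) ∂P := by
          congr 1
          refine Finset.sum_congr rfl fun n _ => ?_
          simp only [mul_comm _ (S (n + 1) _ - S n _)]
          exact (hκ n).lintegral_mul (hd n) hφ
      _ = 2 * ∫⁻ z, φ z * S M z ∂P := by
          rw [← lintegral_finsetSum _ fun n _ => hφd n]
          simp only [← Finset.mul_sum, hS, sum_sup_sub]
  have hSfin : ∫⁻ z, S M z ^ 2 ∂P ≠ ⊤ := by
    refine ne_top_of_le_ne_top (b := ∑ n ∈ Finset.range M, ∫⁻ z, φ z ^ 2 ∂P)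
      (by simp [hfin, ENNReal.mul_eq_top]) ?_
    calc ∫⁻ z, S M z ^ 2 ∂P ≤ ∫⁻ z, ∑ n ∈ Finset.range M, ∫⁻ w, φ w ^ 2 ∂κ n z ∂P := by
          refine lintegral_mono fun z => ?_
          rcases (Finset.range M).eq_empty_or_nonempty with h | h
          · simp [hS, h]
          · obtain ⟨n, hn, he⟩ := Finset.exists_mem_eq_sup _ h fun k => Y k z
            simp only [hS, he]
            exact ((hκ n).sq_lintegral_le hφ z).trans
              (Finset.single_le_sum (f := fun n => ∫⁻ w, φ w ^ 2 ∂κ n z) (fun _ _ => zero_le) hn)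
      _ = _ := by
          rw [lintegral_finsetSum _ fun n _ => (hκ n).measurable_lintegral (hφ.pow_const 2)]
          exact Finset.sum_congr rfl fun n _ => (hκ n).lintegral _ (hφ.pow_const 2)
  have cs := lintegral_sqrt_mul_sqrt_le P (hφ.pow_const 2) ((hSm' M).pow_const 2)
  simp only [sqrt_sq] at cs
  have h1 := key.trans (mul_le_mul_right cs 2)
  set a := ∫⁻ z, S M z ^ 2 ∂P
  set b := ∫⁻ z, φ z ^ 2 ∂P
  by_cases ha : a = 0
  · rw [ha]; exact zero_le
  have h2 : a ^ (1 / 2 : ℝ) * a ^ (1 / 2 : ℝ) ≤ (2 * b ^ (1 / 2 : ℝ)) * a ^ (1 / 2 : ℝ) := by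
    rw [← sq, sq_sqrt, mul_assoc]; exact h1
  rw [ENNReal.mul_le_mul_iff_left (by simp [ha, hSfin]) (by simp [ha, hSfin])] at h2
  calc a = (a ^ (1 / 2 : ℝ)) ^ 2 := (sq_sqrt a).symm
    _ ≤ (2 * b ^ (1 / 2 : ℝ)) ^ 2 := by gcongr
    _ = 4 * b := by rw [mul_pow, sq_sqrt]; norm_num

theorem measure_pow_three_le (κ : Measure X) {s : Set X} (hs : MeasurableSet s) {W : X → ℝ≥0∞}
    (hW : Measurable W) (hW0 : ∀ z ∈ s, W z ≠ 0) (hWt : ∀ z ∈ s, W z ≠ ⊤) :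
    κ s ^ 3 ≤ (∫⁻ w, s.indicator (fun w => (W w ^ 2)⁻¹) w ∂κ) * (∫⁻ w, W w ∂κ) ^ 2 := by
  have hm : Measurable (s.indicator fun w => (W w ^ 2)⁻¹) := (hW.pow_const 2).inv.indicator hs
  have h := ENNReal.lintegral_mul_norm_pow_le (μ := κ) hm.aemeasurable hW.aemeasurable
    (p := 1 / 3) (q := 2 / 3) (by norm_num) (by norm_num) (by norm_num)
  have h1 : κ s ≤ ∫⁻ a, s.indicator (fun w => (W w ^ 2)⁻¹) a ^ (1 / 3 : ℝ) *
      W a ^ (2 / 3 : ℝ) ∂κ := by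
    rw [← lintegral_indicator_one hs]
    refine lintegral_mono fun a => ?_
    by_cases ha : a ∈ s
    · simp only [Set.indicator_of_mem ha, Pi.one_apply]
      rw [ENNReal.inv_rpow, ← ENNReal.rpow_natCast, ← ENNReal.rpow_mul]
      norm_num
      rw [ENNReal.inv_mul_cancel]
      · simp [hW0 a ha, hWt a ha]
      · simp [hW0 a ha, hWt a ha]
    · simp [ha]
  calc κ s ^ 3 ≤ ((∫⁻ w, s.indicator (fun w => (W w ^ 2)⁻¹) w ∂κ) ^ (1 / 3 : ℝ) *
        (∫⁻ w, W w ∂κ) ^ (2 / 3 : ℝ)) ^ 3 := by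
        gcongr
        exact h1.trans h
    _ = _ := by
        rw [mul_pow, ← ENNReal.rpow_natCast, ← ENNReal.rpow_mul, ← ENNReal.rpow_natCast,
          ← ENNReal.rpow_mul]
        norm_num

variable {P : Measure X} {ℬ : ℕ → MeasurableSpace X} {κB : ℕ → X → Measure X}

theorem sum_mul_measure_pow_three_le {M : ℕ} {b : ℕ → X → ℝ≥0∞} {s : Set X}
    (hs : MeasurableSet s) {W : X → ℝ≥0∞} (hW : Measurable W) (hW0 : ∀ z ∈ s, W z ≠ 0)
    (hWt : ∀ z ∈ s, W z ≠ ⊤) (z : X) :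
    ∑ k ∈ Finset.range M, b k z * κB k z s ^ 3 ≤
      ((Finset.range M).sup fun k => ∫⁻ w, W w ∂κB k z) ^ 2 * ∑ k ∈ Finset.range M,
        b k z * ∫⁻ w, s.indicator (fun w => (W w ^ 2)⁻¹) w ∂κB k z := by
  rw [Finset.mul_sum]
  refine Finset.sum_le_sum fun k hk => ?_
  rw [mul_left_comm]
  gcongr
  rw [mul_comm]
  refine (measure_pow_three_le _ hs hW hW0 hWt).trans ?_
  gcongr
  exact Finset.le_sup (f := fun k => ∫⁻ w, W w ∂κB k z) hk

theorem IsCondKernel.measurable_measure {κ : X → Measure X} (h : IsCondKernel m P κ) {s : Set X}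
    (hs : MeasurableSet s) : Measurable fun z => κ z s := by
  simpa only [lintegral_indicator_one hs] using h.measurable_lintegral (measurable_one.indicator hs)

theorem lintegral_sqrt_sum_mul_measure_pow_three_le
    (hB : ∀ k, IsCondKernel (ℬ k) P (κB k)) (hℬ : Monotone ℬ) {M : ℕ} {b : ℕ → X → ℝ≥0∞}
    (hb : ∀ k, Measurable[ℬ k] (b k)) {s : Set X}
    (hs : MeasurableSet s) {W : X → ℝ≥0∞} (hW : Measurable W) (hW0 : ∀ z ∈ s, W z ≠ 0)
    (hWt : ∀ z ∈ s, W z ≠ ⊤) :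
    ∫⁻ z, (∑ k ∈ Finset.range M, b k z * κB k z s ^ 3) ^ (1 / 2 : ℝ) ∂P ≤
      (4 * ∫⁻ z, W z ^ 2 ∂P) ^ (1 / 2 : ℝ) *
      (∫⁻ z, s.indicator (fun z => (∑ k ∈ Finset.range M, b k z) / W z ^ 2) z ∂P) ^
        (1 / 2 : ℝ) := by
  have hb' : ∀ k, Measurable (b k) := fun k => (hb k).mono (hB k).le le_rfl
  have hm : Measurable (s.indicator fun w => (W w ^ 2)⁻¹) := (hW.pow_const 2).inv.indicator hs
  have hmul : ∀ k, Measurable fun z =>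
      b k z * ∫⁻ w, s.indicator (fun w => (W w ^ 2)⁻¹) w ∂κB k z :=
    fun k => (hb' k).mul ((hB k).measurable_lintegral hm)
  have hmul' : ∀ k, Measurable fun z => b k z * s.indicator (fun w => (W w ^ 2)⁻¹) z :=
    fun k => (hb' k).mul hm
  have hsup : Measurable fun z => (Finset.range M).sup fun k => ∫⁻ w, W w ∂κB k z :=
    measurable_range_sup fun k _ => (hB k).measurable_lintegral hW
  calc _ ≤ ∫⁻ z, (((Finset.range M).sup fun k => ∫⁻ w, W w ∂κB k z) ^ 2) ^ (1 / 2 : ℝ) *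
          (∑ k ∈ Finset.range M,
            b k z * ∫⁻ w, s.indicator (fun w => (W w ^ 2)⁻¹) w ∂κB k z) ^ (1 / 2 : ℝ) ∂P := by
        refine lintegral_mono fun z => ?_
        dsimp only
        rw [← ENNReal.mul_rpow_of_nonneg _ _ (by norm_num)]
        gcongr
        exact sum_mul_measure_pow_three_le hs hW hW0 hWt z
    _ ≤ _ := lintegral_sqrt_mul_sqrt_le P (hsup.pow_const 2)
        (Finset.measurable_sum _ fun k _ => hmul k)
    _ ≤ _ := by
        refine mul_le_mul' (ENNReal.rpow_le_rpow ?_ (by norm_num))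
          (ENNReal.rpow_le_rpow ?_ (by norm_num))
        · exact lintegral_sq_sup_le hB hℬ hW M
        · rw [lintegral_finsetSum _ fun k _ => hmul k,
            Finset.sum_congr rfl fun k _ => (hB k).lintegral_mul (hb k) hm,
            ← lintegral_finsetSum _ fun k _ => hmul' k]
          refine lintegral_mono fun z => ?_
          by_cases hz : z ∈ s
          · simp [hz, Finset.sum_mul, div_eq_mul_inv]
          · simp [hz]

theorem lintegral_sqrt_sum_large_le
    (hB : ∀ k, IsCondKernel (ℬ k) P (κB k)) (hℬ : Monotone ℬ) {M : ℕ} {b : ℕ → X → ℝ≥0∞}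
    (hb : ∀ k, Measurable[ℬ k] (b k)) {s : Set X} (hs : MeasurableSet s)
    (h0 : ∀ z ∈ s, ∑ k ∈ Finset.range M, b k z ≠ 0)
    (ht : ∀ z ∈ s, ∑ k ∈ Finset.range M, b k z ≠ ⊤) :
    ∫⁻ z, (∑ k ∈ Finset.range M, b k z * κB k z s ^ 3) ^ (1 / 2 : ℝ) ∂P ≤
      2 * ∫⁻ z, s.indicator (fun z => (∑ k ∈ Finset.range M, b k z) ^ (1 / 2 : ℝ)) z ∂P := by
  set r : X → ℝ≥0∞ := fun z => ∑ k ∈ Finset.range M, b k z with hr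
  have hrm : Measurable r :=
    Finset.measurable_sum _ fun k _ => (hb k).mono (hB k).le le_rfl
  have hq : ∀ x : ℝ≥0∞, (x ^ (1 / 4 : ℝ)) ^ 2 = x ^ (1 / 2 : ℝ) := fun x => by
    rw [← ENNReal.rpow_natCast, ← ENNReal.rpow_mul]; norm_num
  have h := lintegral_sqrt_sum_mul_measure_pow_three_le (P := P) (M := M) hB hℬ hb hs
    (W := s.indicator fun z => r z ^ (1 / 4 : ℝ)) ((hrm.pow_const _).indicator hs)
    (fun z hz => by simp [hz, h0 z hz, ht z hz, hr])
    (fun z hz => by simp [hz, h0 z hz, ht z hz, hr])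
  refine h.trans (le_of_eq ?_)
  have e1 : ∀ z, (s.indicator (fun z => r z ^ (1 / 4 : ℝ)) z) ^ 2 =
      s.indicator (fun z => r z ^ (1 / 2 : ℝ)) z := fun z => by
    by_cases hz : z ∈ s
    · simp only [hz, Set.indicator_of_mem, hq]
    · simp [hz]
  have e2 : ∀ z, s.indicator (fun z => r z / (s.indicator (fun z => r z ^ (1 / 4 : ℝ)) z) ^ 2) z =
      s.indicator (fun z => r z ^ (1 / 2 : ℝ)) z := fun z => by
    by_cases hz : z ∈ s
    · simp only [hz, Set.indicator_of_mem, hq]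
      have hne : r z ^ (1 / 2 : ℝ) ≠ 0 := by simp [h0 z hz, hr]
      have hnt : r z ^ (1 / 2 : ℝ) ≠ ⊤ := by simp [ht z hz, hr]
      nth_rewrite 1 [← sq_sqrt (r z)]
      rw [sq, ENNReal.mul_div_cancel_right hne hnt]
    · simp [hz]
  rw [lintegral_congr e2, lintegral_congr e1, ENNReal.mul_rpow_of_nonneg _ _ (by norm_num),
    mul_assoc, ← sq, sq_sqrt]
  congr 1
  rw [show (4 : ℝ≥0∞) = 2 ^ 2 by norm_num, sqrt_sq]

variable {𝒜 : ℕ → MeasurableSpace X} {κA : ℕ → X → Measure X}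

theorem lintegral_sqrt_sum_small_le
    (hA : ∀ n, IsCondKernel (𝒜 n) P (κA n))
    (hB : ∀ k, IsCondKernel (ℬ k) P (κB k)) (hℬ : Monotone ℬ)
    (hAB : ∀ n k, ∀ φ : X → ℝ≥0∞, Measurable[𝒜 n] φ → Measurable[𝒜 n] fun z => ∫⁻ w, φ w ∂κB k z)
    {N M : ℕ} {b : ℕ → ℕ → X → ℝ≥0∞} (hb : ∀ n k, Measurable[ℬ k] (b n k))
    {s : ℕ → Set X} (hs : ∀ n, MeasurableSet (s n)) {W : ℕ → X → ℝ≥0∞} {V : X → ℝ≥0∞}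
    (hV : Measurable V) (hWV : ∀ n < N, ∀ z, W n z ≤ V z)
    (hW : ∀ n, Measurable[𝒜 n] (W n)) (hW0 : ∀ n, ∀ z ∈ s n, W n z ≠ 0)
    (hWt : ∀ n, ∀ z ∈ s n, W n z ≠ ⊤) :
    ∫⁻ z, (∑ n ∈ Finset.range N, ∑ k ∈ Finset.range M,
        ∫⁻ w, b n k w * κB k w (s n) ^ 3 ∂κA n z) ^ (1 / 2 : ℝ) ∂P ≤
      (4 * ∫⁻ z, V z ^ 2 ∂P) ^ (1 / 2 : ℝ) * (∫⁻ z, ∑ n ∈ Finset.range N, (s n).indicator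
        (fun z => (∑ k ∈ Finset.range M, b n k z) / W n z ^ 2) z ∂P) ^ (1 / 2 : ℝ) := by
  have hb' : ∀ n k, Measurable (b n k) := fun n k => (hb n k).mono (hB k).le le_rfl
  have hW' : ∀ n, Measurable (W n) := fun n => (hW n).mono (hA n).le le_rfl
  have hm : ∀ n, Measurable ((s n).indicator fun w => (W n w ^ 2)⁻¹) :=
    fun n => ((hW' n).pow_const 2).inv.indicator (hs n)
  have hmul : ∀ n k, Measurable fun z =>
      b n k z * ∫⁻ w, (s n).indicator (fun w => (W n w ^ 2)⁻¹) w ∂κB k z :=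
    fun n k => (hb' n k).mul ((hB k).measurable_lintegral (hm n))
  have hmul' : ∀ n k, Measurable fun z => b n k z * (s n).indicator (fun w => (W n w ^ 2)⁻¹) z :=
    fun n k => (hb' n k).mul (hm n)
  have hmul3 : ∀ n k, Measurable fun z => b n k z * κB k z (s n) ^ 3 :=
    fun n k => (hb' n k).mul (((hB k).measurable_measure (hs n)).pow_const 3)
  have hsupA : ∀ n, Measurable[𝒜 n] fun z => (Finset.range M).sup fun k => ∫⁻ w, W n w ∂κB k z :=
    fun n => measurable_range_sup fun k _ => hAB n k _ (hW n)
  have hsum : ∀ n, Measurable fun z => ∑ k ∈ Finset.range M,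
      b n k z * ∫⁻ w, (s n).indicator (fun w => (W n w ^ 2)⁻¹) w ∂κB k z :=
    fun n => Finset.measurable_sum _ fun k _ => hmul n k
  set Y : X → ℝ≥0∞ := fun z => (Finset.range M).sup fun k => ∫⁻ w, V w ∂κB k z with hY
  have hYm : Measurable Y := measurable_range_sup fun k _ => (hB k).measurable_lintegral hV
  set Q : ℕ → X → ℝ≥0∞ := fun n z => ∫⁻ w, ∑ k ∈ Finset.range M,
      b n k w * ∫⁻ w', (s n).indicator (fun w => (W n w ^ 2)⁻¹) w' ∂κB k w ∂κA n z with hQ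
  have hQm : ∀ n, Measurable (Q n) := fun n => (hA n).measurable_lintegral (hsum n)
  calc _ ≤ ∫⁻ z, (Y z ^ 2) ^ (1 / 2 : ℝ) * (∑ n ∈ Finset.range N, Q n z) ^ (1 / 2 : ℝ) ∂P := by
        refine lintegral_mono fun z => ?_
        dsimp only
        rw [← ENNReal.mul_rpow_of_nonneg _ _ (by norm_num), Finset.mul_sum]
        gcongr with n hn
        rw [← lintegral_finsetSum _ fun k _ => hmul3 n k]
        calc _ ≤ ∫⁻ w, ((Finset.range M).sup fun k => ∫⁻ w', W n w' ∂κB k w) ^ 2 *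
              ∑ k ∈ Finset.range M, b n k w *
                ∫⁻ w', (s n).indicator (fun w => (W n w ^ 2)⁻¹) w' ∂κB k w ∂κA n z :=
              lintegral_mono fun w => sum_mul_measure_pow_three_le (hs n) (hW' n) (hW0 n) (hWt n) w
          _ = ((Finset.range M).sup fun k => ∫⁻ w', W n w' ∂κB k z) ^ 2 * Q n z :=
              (hA n).pull (fun z => ((Finset.range M).sup fun k => ∫⁻ w', W n w' ∂κB k z) ^ 2) _
                ((hsupA n).pow_const 2) (hsum n) z
          _ ≤ _ := by
              gcongr
              exact Finset.sup_mono_fun fun k _ =>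
                lintegral_mono fun w => hWV n (Finset.mem_range.1 hn) w
    _ ≤ _ := lintegral_sqrt_mul_sqrt_le P (hYm.pow_const 2)
        (Finset.measurable_sum _ fun n _ => hQm n)
    _ ≤ _ := by
        refine mul_le_mul' (ENNReal.rpow_le_rpow ?_ (by norm_num))
          (ENNReal.rpow_le_rpow ?_ (by norm_num))
        · exact lintegral_sq_sup_le hB hℬ hV M
        · rw [lintegral_finsetSum _ fun n _ => hQm n, lintegral_finsetSum]
          · refine Finset.sum_le_sum fun n _ => ?_
            rw [(hA n).lintegral _ (hsum n), lintegral_finsetSum _ fun k _ => hmul n k,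
              Finset.sum_congr rfl fun k _ => (hB k).lintegral_mul (hb n k) (hm n),
              ← lintegral_finsetSum _ fun k _ => hmul' n k]
            refine lintegral_mono fun z => ?_
            by_cases hz : z ∈ s n
            · simp [hz, Finset.sum_mul, div_eq_mul_inv]
            · simp [hz]
          · exact fun n _ => ((Finset.measurable_sum _ fun k _ => hb' n k).div
              ((hW' n).pow_const 2)).indicator (hs n)

theorem one_le_eight_mul_pow_three {x : ℝ≥0∞} (h : 2⁻¹ ≤ x) : 1 ≤ 8 * x ^ 3 := by
  calc (1 : ℝ≥0∞) = 8 * 2⁻¹ ^ 3 := by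
        rw [← ENNReal.inv_pow, show (2 : ℝ≥0∞) ^ 3 = 8 by norm_num,
          ENNReal.mul_inv_cancel (by norm_num) (by norm_num)]
    _ ≤ _ := by gcongr

theorem sqrt_eight_mul_le (x : ℝ≥0∞) : (8 * x) ^ (1 / 2 : ℝ) ≤ 3 * x ^ (1 / 2 : ℝ) := by
  rw [ENNReal.mul_rpow_of_nonneg _ _ (by norm_num)]
  gcongr
  calc (8 : ℝ≥0∞) ^ (1 / 2 : ℝ) ≤ (3 ^ 2) ^ (1 / 2 : ℝ) := by gcongr; norm_num
    _ = 3 := sqrt_sq 3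

theorem IsCondKernel.ae_measure_eq_zero {κ : X → Measure X} (h : IsCondKernel m P κ) {s : Set X}
    (hs : P s = 0) : ∀ᵐ z ∂P, κ z s = 0 := by
  have : ∀ᵐ z ∂P, z ∉ s := measure_eq_zero_iff_ae_notMem.1 hs
  filter_upwards [h.ae_ae this] with z hz
  exact measure_eq_zero_iff_ae_notMem.2 hz

theorem IsCondKernel.mul_measure_eq_zero {κ : X → Measure X} (h : IsCondKernel m P κ) {s : Set X}
    (hs : MeasurableSet s) {φ : X → ℝ≥0∞} (hφ : Measurable[m] φ) (h0 : ∀ z ∈ s, φ z = 0) (z : X) :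
    φ z * κ z s = 0 := by
  rw [← lintegral_indicator_one hs, ← h.pull φ _ hφ (measurable_one.indicator hs)]
  refine (lintegral_congr fun w => ?_).trans lintegral_zero
  by_cases hw : w ∈ s
  · simp [h0 w hw]
  · simp [hw]

/-- Adapted splitting of a nonnegative double array: there are sets `I n k` such that the part of
the array on `I` is small in `ℓ¹(L¹(ℓ²))` and the part off `I` is small in the conditional norm. -/
theorem exists_adapted_split {𝒜p : ℕ → MeasurableSpace X} {𝒞 : ℕ → ℕ → MeasurableSpace X}
    (hA : ∀ n, IsCondKernel (𝒜p n) P (κA n))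
    (hB : ∀ k, IsCondKernel (ℬ k) P (κB k)) (hℬ : Monotone ℬ)
    (hAB : ∀ n k, ∀ φ : X → ℝ≥0∞, Measurable[𝒜p n] φ →
      Measurable[𝒜p n] fun z => ∫⁻ w, φ w ∂κB k z)
    (hAC : ∀ n k, ∀ φ : X → ℝ≥0∞, Measurable[𝒜 n] φ →
      Measurable[𝒞 n k] fun z => ∫⁻ w, φ w ∂κB k z)
    (h𝒜 : ∀ n, 𝒜 n ≤ m0) (hpA : ∀ n, 𝒜p n ≤ 𝒜 n) (hAp : ∀ l n, l < n → 𝒜 l ≤ 𝒜p n)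
    (hCA : ∀ n k, 𝒞 n k ≤ 𝒜 n) (hCB : ∀ n k, 𝒞 n k ≤ ℬ k)
    {b : ℕ → ℕ → X → ℝ≥0∞} (hb : ∀ n k, Measurable[𝒞 n k] (b n k)) (N M : ℕ)
    (hfin : ∫⁻ z, (∑ n ∈ Finset.range N, ∑ k ∈ Finset.range M, b n k z) ^ (1 / 2 : ℝ) ∂P ≠ ⊤) :
    ∃ I : ℕ → ℕ → Set X, (∀ n k, MeasurableSet[𝒞 n k] (I n k)) ∧
      ∑ n ∈ Finset.range N, ∫⁻ z, (∑ k ∈ Finset.range M,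
          (I n k).indicator (b n k) z) ^ (1 / 2 : ℝ) ∂P ≤
        24 * ∫⁻ z, (∑ n ∈ Finset.range N, ∑ k ∈ Finset.range M, b n k z) ^ (1 / 2 : ℝ) ∂P ∧
      ∫⁻ z, (∑ n ∈ Finset.range N, ∑ k ∈ Finset.range M,
          ∫⁻ w, (I n k)ᶜ.indicator (b n k) w ∂κA n z) ^ (1 / 2 : ℝ) ∂P ≤
        24 * ∫⁻ z, (∑ n ∈ Finset.range N, ∑ k ∈ Finset.range M, b n k z) ^ (1 / 2 : ℝ) ∂P := by
  set r : ℕ → X → ℝ≥0∞ := fun n z => ∑ k ∈ Finset.range M, b n k z with hr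
  set A : ℕ → X → ℝ≥0∞ := fun n z => ∑ l ∈ Finset.range n, r l z with hAdef
  have hbB : ∀ n k, Measurable[ℬ k] (b n k) := fun n k => (hb n k).mono (hCB n k) le_rfl
  have hb0 : ∀ n k, Measurable (b n k) := fun n k => (hbB n k).mono (hB k).le le_rfl
  have hrA : ∀ n, Measurable[𝒜 n] (r n) := fun n =>
    Finset.measurable_sum _ fun k _ => (hb n k).mono (hCA n k) le_rfl
  have hr0 : ∀ n, Measurable (r n) := fun n => (hrA n).mono (h𝒜 n) le_rfl
  have hAm : ∀ n, Measurable[𝒜p n] (A n) := fun n =>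
    Finset.measurable_sum _ fun l hl => (hrA l).mono (hAp l n (Finset.mem_range.1 hl)) le_rfl
  have hA0 : ∀ n, Measurable (A n) := fun n => (hAm n).mono (hA n).le le_rfl
  set G : ℕ → Set X := fun n => {z | A n z < r n z ∧ r n z ≠ ⊤} with hG
  set H : ℕ → Set X := fun n => {z | r n z ≤ A n z ∧ A n z ≠ 0 ∧ A n z ≠ ⊤} with hH
  have hGA : ∀ n, MeasurableSet[𝒜 n] (G n) := fun n =>
    (measurableSet_lt ((hAm n).mono (hpA n) le_rfl) (hrA n)).inter
      (hrA n (measurableSet_singleton ⊤).compl)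
  have hG0 : ∀ n, MeasurableSet (G n) := fun n => h𝒜 n _ (hGA n)
  have hH0 : ∀ n, MeasurableSet (H n) := fun n =>
    (measurableSet_le (hr0 n) (hA0 n)).inter ((hA0 n (measurableSet_singleton 0).compl).inter
      (hA0 n (measurableSet_singleton ⊤).compl))
  have hq : ∀ n k, Measurable[𝒞 n k] fun z => κB k z (G n) := fun n k => by
    have h1 : Measurable[𝒜 n] ((G n).indicator (1 : X → ℝ≥0∞)) :=
      Measurable.indicator (m := 𝒜 n) measurable_const (hGA n)
    simpa only [lintegral_indicator_one (hG0 n)] using hAC n k _ h1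
  refine ⟨fun n k => {z | 2⁻¹ ≤ κB k z (G n)}, fun n k => hq n k measurableSet_Ici, ?_, ?_⟩
  · calc _ ≤ ∑ n ∈ Finset.range N,
          6 * ∫⁻ z, (G n).indicator (fun z => r n z ^ (1 / 2 : ℝ)) z ∂P := by
          refine Finset.sum_le_sum fun n _ => ?_
          have hm : Measurable fun z =>
              (∑ k ∈ Finset.range M, b n k z * κB k z (G n) ^ 3) ^ (1 / 2 : ℝ) :=
            (Finset.measurable_sum _ fun k _ => (hb0 n k).mul
              (((hB k).measurable_measure (hG0 n)).pow_const 3)).pow_const _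
          calc _ ≤ ∫⁻ z, 3 * (∑ k ∈ Finset.range M,
                b n k z * κB k z (G n) ^ 3) ^ (1 / 2 : ℝ) ∂P := by
                refine lintegral_mono fun z => ?_
                refine le_trans ?_ (sqrt_eight_mul_le _)
                rw [Finset.mul_sum]
                gcongr with k
                refine Set.indicator_le' (fun z hz => ?_) (fun z hz => zero_le) z
                  (g := fun z => 8 * (b n k z * κB k z (G n) ^ 3))
                rw [mul_left_comm]
                exact le_mul_of_one_le_right' (one_le_eight_mul_pow_three hz)
            _ = 3 * ∫⁻ z, (∑ k ∈ Finset.range M,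
                b n k z * κB k z (G n) ^ 3) ^ (1 / 2 : ℝ) ∂P := lintegral_const_mul _ hm
            _ ≤ 3 * (2 * ∫⁻ z, (G n).indicator (fun z => r n z ^ (1 / 2 : ℝ)) z ∂P) := by
                gcongr
                exact lintegral_sqrt_sum_large_le hB hℬ (hbB n) (hG0 n)
                  (fun z hz => (pos_of_gt hz.1).ne') (fun z hz => hz.2)
            _ = _ := by rw [← mul_assoc]; norm_num
      _ = 6 * ∫⁻ z, ∑ n ∈ Finset.range N, (G n).indicator (fun z => r n z ^ (1 / 2 : ℝ)) z ∂P := by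
          rw [lintegral_finsetSum _ fun n _ => ((hr0 n).pow_const _).indicator (hG0 n),
            Finset.mul_sum]
      _ ≤ 6 * ∫⁻ z, 4 * A N z ^ (1 / 2 : ℝ) ∂P := by
          gcongr with z
          refine le_trans (Finset.sum_le_sum fun n _ => ?_) (sum_sqrt_large_le (fun n => r n z) N)
          by_cases hz : z ∈ G n
          · rw [Set.indicator_of_mem hz, if_pos hz.1]
          · simp [hz]
      _ = _ := by
          rw [lintegral_const_mul _ ((hA0 N).pow_const _), ← mul_assoc]
          norm_num
          rfl
  · have hT : ∀ᵐ z ∂P, A N z ≠ ⊤ := by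
      filter_upwards [ae_lt_top ((hA0 N).pow_const _) hfin] with z hz h
      simp [h] at hz
    have hT0 : P {z | A N z = ⊤} = 0 := by simpa [ae_iff] using hT
    have key : ∀ᵐ z ∂P, ∀ n ∈ Finset.range N, ∀ k ∈ Finset.range M,
        {z | 2⁻¹ ≤ κB k z (G n)}ᶜ.indicator (b n k) z ≤ 8 * (b n k z * κB k z (H n) ^ 3) := by
      have h1 : ∀ᵐ z ∂P, ∀ k, κB k z {z | A N z = ⊤} = 0 :=
        ae_all_iff.2 fun k => (hB k).ae_measure_eq_zero hT0
      filter_upwards [h1] with z hz n hn k hk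
      by_cases hzI : z ∈ {z | 2⁻¹ ≤ κB k z (G n)}
      · simp [hzI]
      rw [Set.indicator_of_mem hzI]
      by_cases hbz : b n k z = 0
      · simp [hbz]
      have h2 : κB k z {z | r n z = 0} = 0 := by
        have := (hB k).mul_measure_eq_zero (hr0 n (measurableSet_singleton 0)) (hbB n k)
          (fun z hz => by
            simp only [hr, Set.mem_preimage, Set.mem_singleton_iff, Finset.sum_eq_zero_iff] at hz
            exact hz k hk) z
        exact (mul_eq_zero.1 this).resolve_left hbz
      have hcover : (Set.univ : Set X) ⊆
          (G n ∪ H n) ∪ ({z | r n z = 0} ∪ {z | A N z = ⊤}) := by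
        intro w _
        by_cases hwT : A N w = ⊤
        · exact Or.inr (Or.inr hwT)
        have hs : A n w + r n w ≤ A N w := by
          simp only [hAdef]
          rw [← Finset.sum_range_succ (fun l => r l w)]
          exact Finset.sum_le_sum_of_subset (Finset.range_subset_range.2 (Finset.mem_range.1 hn))
        have hs1 : A n w ≠ ⊤ := ne_top_of_le_ne_top hwT (le_self_add.trans hs)
        have hs2 : r n w ≠ ⊤ := ne_top_of_le_ne_top hwT (le_add_self.trans hs)
        rcases lt_or_ge (A n w) (r n w) with h | h
        · exact Or.inl (Or.inl ⟨h, hs2⟩)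
        by_cases hr0 : r n w = 0
        · exact Or.inr (Or.inl hr0)
        · exact Or.inl (Or.inr ⟨h, fun h0 => hr0 (le_zero_iff.1 (h0 ▸ h)), hs1⟩)
      have h3 : (1 : ℝ≥0∞) ≤ κB k z (G n) + κB k z (H n) := by
        have := (hB k).prob z
        calc (1 : ℝ≥0∞) = κB k z Set.univ := measure_univ.symm
          _ ≤ _ := measure_mono hcover
          _ ≤ _ := measure_union_le _ _
          _ ≤ κB k z (G n ∪ H n) + 0 := by
              gcongr
              exact (measure_union_le _ _).trans (by rw [h2, hz k, add_zero])
          _ ≤ _ := by rw [add_zero]; exact measure_union_le _ _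
      have h4 : 2⁻¹ ≤ κB k z (H n) := by
        by_contra! h
        have h5 : κB k z (G n) < 2⁻¹ := not_le.1 hzI
        have := ENNReal.add_lt_add h5 h
        rw [ENNReal.inv_two_add_inv_two] at this
        exact absurd h3 (not_le.2 this)
      rw [mul_left_comm]
      exact le_mul_of_one_le_right' (one_le_eight_mul_pow_three h4)
    have hq4 : ∀ x : ℝ≥0∞, (x ^ (1 / 4 : ℝ)) ^ 2 = x ^ (1 / 2 : ℝ) := fun x => by
      rw [← ENNReal.rpow_natCast, ← ENNReal.rpow_mul]; norm_num
    have hm3 : ∀ n k, Measurable fun z => b n k z * κB k z (H n) ^ 3 := fun n k =>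
      (hb0 n k).mul (((hB k).measurable_measure (hH0 n)).pow_const 3)
    have hm : Measurable fun z => (∑ n ∈ Finset.range N, ∑ k ∈ Finset.range M,
        ∫⁻ w, b n k w * κB k w (H n) ^ 3 ∂κA n z) ^ (1 / 2 : ℝ) :=
      (Finset.measurable_sum _ fun n _ => Finset.measurable_sum _ fun k _ =>
        (hA n).measurable_lintegral (hm3 n k)).pow_const _
    have hsmall := lintegral_sqrt_sum_small_le (N := N) (M := M) hA hB hℬ hAB hbB hH0
      (W := fun n z => A n z ^ (1 / 4 : ℝ)) (V := fun z => A N z ^ (1 / 4 : ℝ))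
      ((hA0 N).pow_const _)
      (fun n hn z => ENNReal.rpow_le_rpow (Finset.sum_le_sum_of_subset
        (Finset.range_subset_range.2 hn.le)) (by norm_num))
      (fun n => (hAm n).pow_const _) (fun n z hz => by simp [hz.2.1, hz.2.2])
      (fun n z hz => by simp [hz.2.1, hz.2.2])
    calc _ ≤ ∫⁻ z, 3 * (∑ n ∈ Finset.range N, ∑ k ∈ Finset.range M,
          ∫⁻ w, b n k w * κB k w (H n) ^ 3 ∂κA n z) ^ (1 / 2 : ℝ) ∂P := by
          refine lintegral_mono_ae ?_
          have h1 : ∀ᵐ z ∂P, ∀ n, ∀ᵐ w ∂κA n z, ∀ n ∈ Finset.range N, ∀ k ∈ Finset.range M,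
              {z | 2⁻¹ ≤ κB k z (G n)}ᶜ.indicator (b n k) w ≤
                8 * (b n k w * κB k w (H n) ^ 3) :=
            ae_all_iff.2 fun n => (hA n).ae_ae key
          filter_upwards [h1] with z hz
          refine le_trans ?_ (sqrt_eight_mul_le _)
          simp only [Finset.mul_sum]
          gcongr with n hn k hk
          rw [← lintegral_const_mul _ (hm3 n k)]
          refine lintegral_mono_ae ?_
          filter_upwards [hz n] with w hw
          exact hw n hn k hk
      _ = 3 * _ := lintegral_const_mul _ hm
      _ ≤ 3 * ((4 * ∫⁻ z, A N z ^ (1 / 2 : ℝ) ∂P) ^ (1 / 2 : ℝ) *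
            (4 * ∫⁻ z, A N z ^ (1 / 2 : ℝ) ∂P) ^ (1 / 2 : ℝ)) := by
          gcongr
          refine hsmall.trans (mul_le_mul' (ENNReal.rpow_le_rpow ?_ (by norm_num))
            (ENNReal.rpow_le_rpow ?_ (by norm_num)))
          · simp only [hq4, le_refl]
          · rw [← lintegral_const_mul _ ((hA0 N).pow_const _)]
            refine lintegral_mono fun z => ?_
            calc _ ≤ 3 * A N z ^ (1 / 2 : ℝ) := by
                  refine le_trans (Finset.sum_le_sum fun n _ => ?_)
                    (sum_div_sqrt_small_le (fun n => r n z) N)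
                  by_cases hz : z ∈ H n
                  · rw [Set.indicator_of_mem hz, hq4]
                    exact (if_pos (show r n z ≤ A n z ∧ A n z ≠ 0 ∧ A n z ≠ ⊤ from hz)).ge
                  · simp [hz]
              _ ≤ _ := by gcongr; norm_num
      _ = 12 * ∫⁻ z, A N z ^ (1 / 2 : ℝ) ∂P := by
          rw [← sq, sq_sqrt, ← mul_assoc]; norm_num
      _ ≤ _ := by gcongr; norm_num

end Kernel

section Resample
open scoped ENNReal Classical
variable {Ω : Type*}

/-- Keep the coordinates of `z` in `s` and `t`, and take all others from `w`. -/
def resample (s t : Set ℕ) (z w : (ℕ → Ω) × (ℕ → Ω)) : (ℕ → Ω) × (ℕ → Ω) :=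
  (s.piecewise z.1 w.1, t.piecewise z.2 w.2)

theorem resample_univ_resample_univ (s t : Set ℕ) (z w w' : (ℕ → Ω) × (ℕ → Ω)) :
    resample s Set.univ (resample Set.univ t z w') w = resample s t z (w.1, w'.2) := by
  simp [resample]

variable [MeasurableSpace Ω]

/-- The σ-algebra on `Ω^ℕ × Ω^ℕ` generated by the coordinates in `s` of the first factor and the
coordinates in `t` of the second one. -/
@[reducible]
def cylSigma (Ω : Type*) [MeasurableSpace Ω] (s t : Set ℕ) : MeasurableSpace ((ℕ → Ω) × (ℕ → Ω)) :=
  (cylinderEvents (X := fun _ => Ω) s).prod (cylinderEvents (X := fun _ => Ω) t)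

/-- The conditional law given the coordinates in `s` and `t`. -/
def resampleMeasure (ν : Measure (ℕ → Ω)) (s t : Set ℕ) (z : (ℕ → Ω) × (ℕ → Ω)) :
    Measure ((ℕ → Ω) × (ℕ → Ω)) :=
  (ν.prod ν).map (resample s t z)

theorem cylSigma_mono {s t s' t' : Set ℕ} (hs : s ⊆ s') (ht : t ⊆ t') :
    cylSigma Ω s t ≤ cylSigma Ω s' t' :=
  sup_le_sup (MeasurableSpace.comap_mono (cylinderEvents_mono hs))
    (MeasurableSpace.comap_mono (cylinderEvents_mono ht))

theorem cylSigma_univ : cylSigma Ω Set.univ Set.univ = Prod.instMeasurableSpace := by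
  simp [cylSigma, Prod.instMeasurableSpace]

theorem cylSigma_le (s t : Set ℕ) : cylSigma Ω s t ≤ Prod.instMeasurableSpace :=
  cylSigma_univ (Ω := Ω) ▸ cylSigma_mono s.subset_univ t.subset_univ

theorem measurable_cylSigma_iff {α : Type*} {mα : MeasurableSpace α} {s t : Set ℕ}
    {g : α → (ℕ → Ω) × (ℕ → Ω)} :
    Measurable[mα, cylSigma Ω s t] g ↔
      (∀ i ∈ s, Measurable fun a => (g a).1 i) ∧ ∀ j ∈ t, Measurable fun a => (g a).2 j := by
  constructor
  · intro h
    exact ⟨measurable_cylinderEvents_iff.1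
        ((@measurable_fst _ _ (cylinderEvents (X := fun _ => Ω) s) (cylinderEvents t)).comp h),
      measurable_cylinderEvents_iff.1
        ((@measurable_snd _ _ (cylinderEvents (X := fun _ => Ω) s) (cylinderEvents t)).comp h)⟩
  · rintro ⟨h1, h2⟩
    exact @Measurable.prodMk _ _ _ _ (cylinderEvents s) (cylinderEvents t) _ _
      (measurable_cylinderEvents_iff.2 h1) (measurable_cylinderEvents_iff.2 h2)

theorem measurable_fst_apply {s t : Set ℕ} {i : ℕ} (hi : i ∈ s) :
    Measurable[cylSigma Ω s t] fun z : (ℕ → Ω) × (ℕ → Ω) => z.1 i :=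
  (measurable_cylSigma_iff.1 (@measurable_id _ (cylSigma Ω s t))).1 i hi

theorem measurable_snd_apply {s t : Set ℕ} {j : ℕ} (hj : j ∈ t) :
    Measurable[cylSigma Ω s t] fun z : (ℕ → Ω) × (ℕ → Ω) => z.2 j :=
  (measurable_cylSigma_iff.1 (@measurable_id _ (cylSigma Ω s t))).2 j hj

theorem measurable_resample_uncurry (s t s' t' : Set ℕ) :
    Measurable[(cylSigma Ω (s ∩ s') (t ∩ t')).prod Prod.instMeasurableSpace, cylSigma Ω s t]
      fun p : ((ℕ → Ω) × (ℕ → Ω)) × ((ℕ → Ω) × (ℕ → Ω)) => resample s' t' p.1 p.2 := by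
  refine measurable_cylSigma_iff.2 ⟨fun i hi => ?_, fun j hj => ?_⟩
  · by_cases h : i ∈ s'
    · simp only [resample, Set.piecewise_eq_of_mem _ _ _ h]
      exact (measurable_fst_apply (s := s ∩ s') (t := t ∩ t') ⟨hi, h⟩).comp
        (@measurable_fst _ _ (cylSigma Ω _ _) _)
    · simp only [resample, Set.piecewise_eq_of_notMem _ _ _ h]
      exact ((measurable_pi_apply i).comp measurable_fst).comp
        (@measurable_snd _ _ (cylSigma Ω _ _) _)
  · by_cases h : j ∈ t'
    · simp only [resample, Set.piecewise_eq_of_mem _ _ _ h]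
      exact (measurable_snd_apply (s := s ∩ s') (t := t ∩ t') ⟨hj, h⟩).comp
        (@measurable_fst _ _ (cylSigma Ω _ _) _)
    · simp only [resample, Set.piecewise_eq_of_notMem _ _ _ h]
      exact ((measurable_pi_apply j).comp measurable_snd).comp
        (@measurable_snd _ _ (cylSigma Ω _ _) _)

theorem measurable_resample (s t : Set ℕ) :
    Measurable fun p : ((ℕ → Ω) × (ℕ → Ω)) × ((ℕ → Ω) × (ℕ → Ω)) => resample s t p.1 p.2 := by
  have h := measurable_resample_uncurry (Ω := Ω) Set.univ Set.univ s t
  rw [cylSigma_univ] at h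
  exact h.mono (sup_le_sup (MeasurableSpace.comap_mono (cylSigma_le _ _)) le_rfl) le_rfl

theorem measurable_resample_right (s t : Set ℕ) (z : (ℕ → Ω) × (ℕ → Ω)) :
    Measurable (resample s t z) :=
  (measurable_resample s t).comp measurable_prodMk_left

theorem lintegral_resampleMeasure (ν : Measure (ℕ → Ω)) (s t : Set ℕ) (z : (ℕ → Ω) × (ℕ → Ω))
    {φ : (ℕ → Ω) × (ℕ → Ω) → ℝ≥0∞} (hφ : Measurable φ) :
    ∫⁻ w, φ w ∂resampleMeasure ν s t z = ∫⁻ w, φ (resample s t z w) ∂ν.prod ν :=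
  lintegral_map hφ (measurable_resample_right s t z)

theorem measurable_lintegral_resampleMeasure (ν : Measure (ℕ → Ω)) [IsProbabilityMeasure ν]
    {s t s' t' : Set ℕ} {φ : (ℕ → Ω) × (ℕ → Ω) → ℝ≥0∞} (hφ : Measurable[cylSigma Ω s t] φ) :
    Measurable[cylSigma Ω (s ∩ s') (t ∩ t')]
      fun z => ∫⁻ w, φ w ∂resampleMeasure ν s' t' z := by
  simp only [lintegral_resampleMeasure ν _ _ _ (hφ.mono (cylSigma_le s t) le_rfl)]
  exact @Measurable.lintegral_prod_right' _ _ (cylSigma Ω (s ∩ s') (t ∩ t')) _ (ν.prod ν) _ _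
    (hφ.comp (measurable_resample_uncurry s t s' t'))

theorem apply_resample {β : Type*} [MeasurableSpace β] [MeasurableSingletonClass β] {s t : Set ℕ}
    {φ : (ℕ → Ω) × (ℕ → Ω) → β} (hφ : Measurable[cylSigma Ω s t] φ) (z w : (ℕ → Ω) × (ℕ → Ω)) :
    φ (resample s t z w) = φ z := by
  have hle : cylSigma Ω s t ≤ MeasurableSpace.invariants (fun z => resample s t z w) := by
    have h : Measurable[MeasurableSpace.invariants (fun z => resample s t z w), cylSigma Ω s t]
        (id : (ℕ → Ω) × (ℕ → Ω) → _) := by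
      refine measurable_cylSigma_iff.2 ⟨fun i hi => ?_, fun j hj => ?_⟩
      · refine MeasurableSpace.measurable_invariants_dom.2
          ⟨(measurable_pi_apply i).comp measurable_fst, fun B _ => ?_⟩
        ext z
        simp [resample, Set.piecewise_eq_of_mem _ _ _ hi]
      · refine MeasurableSpace.measurable_invariants_dom.2
          ⟨(measurable_pi_apply j).comp measurable_snd, fun B _ => ?_⟩
        ext z
        simp [resample, Set.piecewise_eq_of_mem _ _ _ hj]
    exact fun A hA => h hA
  exact congrFun (MeasurableSpace.comp_eq_of_measurable_invariants (f := fun z => resample s t z w)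
    (hφ.mono hle le_rfl)) z

theorem lintegral_lintegral_resampleMeasure (ν : Measure (ℕ → Ω)) [IsProbabilityMeasure ν]
    (s t : Set ℕ) {φ : (ℕ → Ω) × (ℕ → Ω) → ℝ≥0∞} (hφ : Measurable φ) (z : (ℕ → Ω) × (ℕ → Ω)) :
    ∫⁻ z', ∫⁻ w, φ w ∂resampleMeasure ν s Set.univ z' ∂resampleMeasure ν Set.univ t z =
      ∫⁻ w, φ w ∂resampleMeasure ν s t z := by
  have hφ' : Measurable fun z' => ∫⁻ w, φ w ∂resampleMeasure ν s Set.univ z' :=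
    (measurable_lintegral_resampleMeasure ν (s := Set.univ) (t := Set.univ)
      (cylSigma_univ (Ω := Ω) ▸ hφ)).mono (cylSigma_le _ _) le_rfl
  rw [lintegral_resampleMeasure ν _ _ _ hφ', lintegral_resampleMeasure ν _ _ _ hφ]
  simp only [lintegral_resampleMeasure ν _ _ _ hφ, resample_univ_resample_univ]
  have hmp : MeasurePreserving (fun p : ((ℕ → Ω) × (ℕ → Ω)) × ((ℕ → Ω) × (ℕ → Ω)) =>
      (p.2.1, p.1.2)) ((ν.prod ν).prod (ν.prod ν)) (ν.prod ν) :=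
    Measure.measurePreserving_swap.comp (measurePreserving_snd.prod measurePreserving_fst)
  have hm := hφ.comp (measurable_resample_right s t z)
  exact (lintegral_prod _ (hm.comp hmp.measurable).aemeasurable).symm.trans
    (hmp.lintegral_comp hm)

theorem measurable_piecewise_prod (s : Set ℕ) :
    Measurable fun p : (ℕ → Ω) × (ℕ → Ω) => s.piecewise p.1 p.2 := by
  refine measurable_pi_lambda _ fun i => ?_
  by_cases h : i ∈ s
  · simp only [Set.piecewise_eq_of_mem _ _ _ h]
    fun_prop
  · simp only [Set.piecewise_eq_of_notMem _ _ _ h]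
    fun_prop

theorem lintegral_resample {ν : Measure (ℕ → Ω)} [IsProbabilityMeasure ν]
    (hν : ∀ s : Set ℕ, (ν.prod ν).map (fun p => s.piecewise p.1 p.2) = ν) (s t : Set ℕ)
    {φ : (ℕ → Ω) × (ℕ → Ω) → ℝ≥0∞} (hφ : Measurable φ) :
    ∫⁻ z, ∫⁻ w, φ (resample s t z w) ∂ν.prod ν ∂ν.prod ν = ∫⁻ z, φ z ∂ν.prod ν := by
  have h1 : ∀ (s : Set ℕ) (ψ : (ℕ → Ω) → ℝ≥0∞), Measurable ψ →
      ∫⁻ x, ∫⁻ y, ψ (s.piecewise x y) ∂ν ∂ν = ∫⁻ x, ψ x ∂ν := by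
    intro s ψ hψ
    conv_rhs => rw [← hν s, lintegral_map hψ (measurable_piecewise_prod s)]
    exact (lintegral_prod _ (hψ.comp (measurable_piecewise_prod s)).aemeasurable).symm
  have hm : Measurable fun p : ((ℕ → Ω) × (ℕ → Ω)) × ((ℕ → Ω) × (ℕ → Ω)) =>
      φ (resample s t p.1 p.2) := hφ.comp (measurable_resample s t)
  rw [lintegral_prod _ hm.lintegral_prod_right'.aemeasurable, lintegral_prod _ hφ.aemeasurable,
    ← h1 s _ hφ.lintegral_prod_right']
  refine lintegral_congr fun x => ?_
  have h2 : ∀ y, ∫⁻ w, φ (resample s t (x, y) w) ∂ν.prod ν =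
      ∫⁻ w, ∫⁻ w', φ (s.piecewise x w, t.piecewise y w') ∂ν ∂ν := fun y =>
    lintegral_prod _ (hφ.comp (measurable_resample_right s t (x, y))).aemeasurable
  simp only [h2]
  rw [lintegral_lintegral_swap]
  · refine lintegral_congr fun w => ?_
    exact h1 t _ (hφ.comp measurable_prodMk_left)
  · refine Measurable.aemeasurable ?_
    have h3 : Measurable fun p : ((ℕ → Ω) × (ℕ → Ω)) × (ℕ → Ω) =>
        φ (resample s t (x, p.1.1) (p.1.2, p.2)) :=
      hm.comp (((measurable_const (a := x)).prodMk (measurable_fst.comp measurable_fst)).prodMk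
        ((measurable_snd.comp measurable_fst).prodMk measurable_snd))
    exact h3.lintegral_prod_right'

theorem isCondKernel_resampleMeasure {ν : Measure (ℕ → Ω)} [IsProbabilityMeasure ν]
    (hν : ∀ s : Set ℕ, (ν.prod ν).map (fun p => s.piecewise p.1 p.2) = ν) (s t : Set ℕ) :
    IsCondKernel (cylSigma Ω s t) (ν.prod ν) (resampleMeasure ν s t) where
  le := cylSigma_le s t
  prob z := Measure.isProbabilityMeasure_map (measurable_resample_right s t z).aemeasurable
  meas φ hφ := by
    have := measurable_lintegral_resampleMeasure ν (s := Set.univ) (t := Set.univ) (s' := s)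
      (t' := t) (cylSigma_univ (Ω := Ω) ▸ hφ)
    rwa [Set.univ_inter, Set.univ_inter] at this
  pull φ ψ hφ hψ z := by
    have hφ' := hφ.mono (cylSigma_le s t) le_rfl
    rw [lintegral_resampleMeasure ν _ _ _ (φ := fun w => φ w * ψ w) (hφ'.mul hψ),
      lintegral_resampleMeasure ν _ _ _ hψ]
    simp only [apply_resample hφ]
    exact lintegral_const_mul _ (hψ.comp (measurable_resample_right s t z))
  lintegral φ hφ := by
    simp only [lintegral_resampleMeasure ν _ _ _ hφ]
    exact lintegral_resample hν s t hφ

theorem map_piecewise_infinitePi (μ : Measure Ω) [IsProbabilityMeasure μ] (s : Set ℕ) :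
    ((Measure.infinitePi fun _ : ℕ => μ).prod (Measure.infinitePi fun _ : ℕ => μ)).map
      (fun p => s.piecewise p.1 p.2) = Measure.infinitePi fun _ : ℕ => μ := by
  refine Measure.eq_infinitePi _ fun I A hA => ?_
  rw [Measure.map_apply (measurable_piecewise_prod s)
    (MeasurableSet.pi I.countable_toSet fun i _ => hA i)]
  have : (fun p : (ℕ → Ω) × (ℕ → Ω) => s.piecewise p.1 p.2) ⁻¹' (Set.pi I A) =
      (Set.pi (I.filter (· ∈ s)) A) ×ˢ (Set.pi (I.filter (· ∉ s)) A) := by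
    ext ⟨x, y⟩
    simp only [Set.mem_preimage, Set.mem_pi, Set.mem_prod, Finset.coe_filter, Set.mem_ofPred_eq,
      Finset.mem_coe]
    constructor
    · exact fun h => ⟨fun i hi => by simpa [hi.2] using h i hi.1,
        fun i hi => by simpa [hi.2] using h i hi.1⟩
    · rintro ⟨h1, h2⟩ i hi
      by_cases his : i ∈ s
      · simpa [his] using h1 i ⟨hi, his⟩
      · simpa [his] using h2 i ⟨hi, his⟩
  rw [this, Measure.prod_prod, Measure.infinitePi_pi _ fun i _ => hA i,
    Measure.infinitePi_pi _ fun i _ => hA i, Finset.prod_filter_mul_prod_filter_not]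

theorem eq_infinitePi_of_map_eq_pi {μ : Measure Ω} [IsProbabilityMeasure μ] {ν : Measure (ℕ → Ω)}
    (h : ∀ n : ℕ, ν.map (fun x (k : Fin n) => x k) = Measure.pi fun _ : Fin n => μ) :
    ν = Measure.infinitePi fun _ : ℕ => μ := by
  refine Measure.eq_infinitePi _ fun I A hA => ?_
  obtain ⟨n, hn⟩ := I.exists_nat_subset_range
  set B : ℕ → Set Ω := fun i => if i ∈ I then A i else Set.univ with hB
  have hBm : ∀ i, MeasurableSet (B i) := fun i => by
    simp only [hB]
    split_ifs
    exacts [hA i, MeasurableSet.univ]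
  have h1 : Set.pi I A = (fun x (k : Fin n) => x k) ⁻¹' (Set.pi Set.univ fun k : Fin n => B k) := by
    ext x
    simp only [Set.mem_pi, Finset.mem_coe, Set.mem_preimage, Set.mem_univ, true_implies, hB]
    constructor
    · intro hx k
      split_ifs with hk
      exacts [hx k hk, trivial]
    · intro hx i hi
      simpa [hi] using hx ⟨i, Finset.mem_range.1 (hn hi)⟩
  have hm : Measurable fun (x : ℕ → Ω) (k : Fin n) => x k :=
    measurable_pi_lambda _ fun k => measurable_pi_apply _
  rw [h1, ← Measure.map_apply hm (MeasurableSet.univ_pi fun k => hBm k), h,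
    Measure.pi_pi, Fin.prod_univ_eq_prod_range (fun i => μ (B i)) n,
    ← Finset.prod_subset hn fun i _ hi => by simp [hB, hi]]
  exact Finset.prod_congr rfl fun i hi => by simp [hB, hi]

end Resample

section CondKernel
open scoped ENNReal
variable {X : Type*} {m : MeasurableSpace X} [m0 : MeasurableSpace X] {P : Measure X}
  {κ : X → Measure X}

theorem IsCondKernel.lintegral_indicator (h : IsCondKernel m P κ) {s : Set X}
    (hs : MeasurableSet[m] s) {φ : X → ℝ≥0∞} (hφ : Measurable φ) (z : X) :
    ∫⁻ w, s.indicator φ w ∂κ z = s.indicator (fun z => ∫⁻ w, φ w ∂κ z) z := by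
  have h1 : Measurable[m] (s.indicator (1 : X → ℝ≥0∞)) :=
    Measurable.indicator (m := m) measurable_const hs
  have h2 : ∀ (ψ : X → ℝ≥0∞) w, s.indicator ψ w = s.indicator 1 w * ψ w := fun ψ w => by
    by_cases hw : w ∈ s <;> simp [hw]
  rw [h2, ← h.pull _ _ h1 hφ]
  simp only [← h2]

theorem IsCondKernel.ofReal_condExp_le [IsFiniteMeasure P] (h : IsCondKernel m P κ) {φ : X → ℝ}
    (hφ : Measurable φ) (h0 : ∀ z, 0 ≤ φ z) :
    ∀ᵐ z ∂P, ENNReal.ofReal (P[φ|m] z) ≤ ∫⁻ w, ENNReal.ofReal (φ w) ∂κ z := by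
  by_cases hfi : Integrable φ P
  swap
  · simp [condExp_of_not_integrable hfi]
  have hm : Measurable[m] fun z => ∫⁻ w, ENNReal.ofReal (φ w) ∂κ z := h.meas _ hφ.ennreal_ofReal
  have hm' := hm.mono h.le le_rfl
  have hfin : ∫⁻ z, ∫⁻ w, ENNReal.ofReal (φ w) ∂κ z ∂P ≠ ⊤ := by
    rw [h.lintegral _ hφ.ennreal_ofReal]
    exact hfi.lintegral_lt_top.ne
  have hae := ae_lt_top hm' hfin
  have hg : Integrable (fun z => (∫⁻ w, ENNReal.ofReal (φ w) ∂κ z).toReal) P :=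
    integrable_toReal_of_lintegral_ne_top hm'.aemeasurable hfin
  have key := ae_eq_condExp_of_forall_setIntegral_eq h.le hfi
    (fun s _ _ => hg.integrableOn) (fun s hs _ => ?_)
    (hm.ennreal_toReal.stronglyMeasurable.aestronglyMeasurable)
  · filter_upwards [key] with z hz
    rw [← hz]
    exact ENNReal.ofReal_toReal_le
  · rw [integral_toReal hm'.aemeasurable (ae_restrict_of_ae hae),
      integral_eq_lintegral_of_nonneg_ae (ae_of_all _ h0) hφ.aestronglyMeasurable,
      ← MeasureTheory.lintegral_indicator (h.le s hs),
      ← MeasureTheory.lintegral_indicator (h.le s hs),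
      ← h.lintegral _ (hφ.ennreal_ofReal.indicator (h.le s hs))]
    simp only [h.lintegral_indicator hs hφ.ennreal_ofReal]

end CondKernel

section Decomposition
open scoped ENNReal Classical
variable {Ω : Type*} [MeasurableSpace Ω]

theorem measurable_lintegral_resampleMeasure_of_subset (ν : Measure (ℕ → Ω))
    [IsProbabilityMeasure ν] {s t s' t' s'' t'' : Set ℕ} {φ : (ℕ → Ω) × (ℕ → Ω) → ℝ≥0∞}
    (hφ : Measurable[cylSigma Ω s t] φ) (hs : s ∩ s' ⊆ s'') (ht : t ∩ t' ⊆ t'') :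
    Measurable[cylSigma Ω s'' t''] fun z => ∫⁻ w, φ w ∂resampleMeasure ν s' t' z :=
  (measurable_lintegral_resampleMeasure ν hφ).mono (cylSigma_mono hs ht) le_rfl

/-- Adapted splitting along the filtration in the second coordinate. -/
theorem exists_adapted_split_snd {ν : Measure (ℕ → Ω)} [IsProbabilityMeasure ν]
    (hν : ∀ s : Set ℕ, (ν.prod ν).map (fun p => s.piecewise p.1 p.2) = ν) (s : ℕ → Set ℕ)
    (hs : Monotone s) {b : ℕ → ℕ → (ℕ → Ω) × (ℕ → Ω) → ℝ≥0∞}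
    (hb : ∀ i j, Measurable[cylSigma Ω (s i) (Set.Iic j)] (b j i)) (N M : ℕ)
    (hfin : ∫⁻ z, (∑ j ∈ Finset.range N, ∑ i ∈ Finset.range M, b j i z) ^ (1 / 2 : ℝ) ∂ν.prod ν ≠
      ⊤) :
    ∃ J : ℕ → ℕ → Set ((ℕ → Ω) × (ℕ → Ω)),
      (∀ j i, MeasurableSet[cylSigma Ω (s i) (Set.Iic j)] (J j i)) ∧
      ∑ j ∈ Finset.range N, ∫⁻ z, (∑ i ∈ Finset.range M,
          (J j i).indicator (b j i) z) ^ (1 / 2 : ℝ) ∂ν.prod ν ≤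
        24 * ∫⁻ z, (∑ j ∈ Finset.range N, ∑ i ∈ Finset.range M, b j i z) ^ (1 / 2 : ℝ) ∂ν.prod ν ∧
      ∫⁻ z, (∑ j ∈ Finset.range N, ∑ i ∈ Finset.range M, ∫⁻ w, (J j i)ᶜ.indicator (b j i) w
          ∂resampleMeasure ν Set.univ (Set.Iic (j - 1)) z) ^ (1 / 2 : ℝ) ∂ν.prod ν ≤
        24 * ∫⁻ z, (∑ j ∈ Finset.range N, ∑ i ∈ Finset.range M, b j i z) ^ (1 / 2 : ℝ) ∂ν.prod ν :=
  exists_adapted_split (𝒜 := fun j => cylSigma Ω Set.univ (Set.Iic j))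
    (𝒜p := fun j => cylSigma Ω Set.univ (Set.Iic (j - 1)))
    (ℬ := fun i => cylSigma Ω (s i) Set.univ) (𝒞 := fun j i => cylSigma Ω (s i) (Set.Iic j))
    (κA := fun j => resampleMeasure ν Set.univ (Set.Iic (j - 1)))
    (κB := fun i => resampleMeasure ν (s i) Set.univ)
    (fun _ => isCondKernel_resampleMeasure hν _ _) (fun _ => isCondKernel_resampleMeasure hν _ _)
    (fun _ _ h => cylSigma_mono (hs h) le_rfl)
    (fun _ _ _ hφ => measurable_lintegral_resampleMeasure_of_subset ν hφ (Set.subset_univ _)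
      Set.inter_subset_left)
    (fun _ _ _ hφ => measurable_lintegral_resampleMeasure_of_subset ν hφ Set.inter_subset_right
      Set.inter_subset_left)
    (fun _ => cylSigma_le _ _)
    (fun n => cylSigma_mono le_rfl (Set.Iic_subset_Iic.2 (Nat.sub_le n 1)))
    (fun _ _ h => cylSigma_mono le_rfl (Set.Iic_subset_Iic.2 (Nat.le_sub_one_of_lt h)))
    (fun _ _ => cylSigma_mono (Set.subset_univ _) le_rfl)
    (fun _ _ => cylSigma_mono le_rfl (Set.subset_univ _)) (fun n k => hb k n) N M hfin

/-- Adapted splitting along the filtration in the first coordinate. -/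
theorem exists_adapted_split_fst {ν : Measure (ℕ → Ω)} [IsProbabilityMeasure ν]
    (hν : ∀ s : Set ℕ, (ν.prod ν).map (fun p => s.piecewise p.1 p.2) = ν)
    {b : ℕ → ℕ → (ℕ → Ω) × (ℕ → Ω) → ℝ≥0∞}
    (hb : ∀ i j, Measurable[cylSigma Ω (Set.Iic i) (Set.Iic j)] (b i j)) (N M : ℕ)
    (hfin : ∫⁻ z, (∑ i ∈ Finset.range N, ∑ j ∈ Finset.range M, b i j z) ^ (1 / 2 : ℝ) ∂ν.prod ν ≠
      ⊤) :
    ∃ I : ℕ → ℕ → Set ((ℕ → Ω) × (ℕ → Ω)),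
      (∀ i j, MeasurableSet[cylSigma Ω (Set.Iic i) (Set.Iic j)] (I i j)) ∧
      ∑ i ∈ Finset.range N, ∫⁻ z, (∑ j ∈ Finset.range M,
          (I i j).indicator (b i j) z) ^ (1 / 2 : ℝ) ∂ν.prod ν ≤
        24 * ∫⁻ z, (∑ i ∈ Finset.range N, ∑ j ∈ Finset.range M, b i j z) ^ (1 / 2 : ℝ) ∂ν.prod ν ∧
      ∫⁻ z, (∑ i ∈ Finset.range N, ∑ j ∈ Finset.range M, ∫⁻ w, (I i j)ᶜ.indicator (b i j) w
          ∂resampleMeasure ν (Set.Iic (i - 1)) Set.univ z) ^ (1 / 2 : ℝ) ∂ν.prod ν ≤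
        24 * ∫⁻ z, (∑ i ∈ Finset.range N, ∑ j ∈ Finset.range M, b i j z) ^ (1 / 2 : ℝ) ∂ν.prod ν :=
  exists_adapted_split (𝒜 := fun i => cylSigma Ω (Set.Iic i) Set.univ)
    (𝒜p := fun i => cylSigma Ω (Set.Iic (i - 1)) Set.univ)
    (ℬ := fun j => cylSigma Ω Set.univ (Set.Iic j))
    (𝒞 := fun i j => cylSigma Ω (Set.Iic i) (Set.Iic j))
    (κA := fun i => resampleMeasure ν (Set.Iic (i - 1)) Set.univ)
    (κB := fun j => resampleMeasure ν Set.univ (Set.Iic j))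
    (fun _ => isCondKernel_resampleMeasure hν _ _) (fun _ => isCondKernel_resampleMeasure hν _ _)
    (fun _ _ h => cylSigma_mono le_rfl (Set.Iic_subset_Iic.2 h))
    (fun _ _ _ hφ => measurable_lintegral_resampleMeasure_of_subset ν hφ Set.inter_subset_left
      (Set.subset_univ _))
    (fun _ _ _ hφ => measurable_lintegral_resampleMeasure_of_subset ν hφ Set.inter_subset_left
      Set.inter_subset_right)
    (fun _ => cylSigma_le _ _)
    (fun n => cylSigma_mono (Set.Iic_subset_Iic.2 (Nat.sub_le n 1)) le_rfl)
    (fun _ _ h => cylSigma_mono (Set.Iic_subset_Iic.2 (Nat.le_sub_one_of_lt h)) le_rfl)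
    (fun _ _ => cylSigma_mono le_rfl (Set.subset_univ _))
    (fun _ _ => cylSigma_mono (Set.subset_univ _) le_rfl) hb N M hfin

theorem exists_four_part_split {ν : Measure (ℕ → Ω)} [IsProbabilityMeasure ν]
    (hν : ∀ s : Set ℕ, (ν.prod ν).map (fun p => s.piecewise p.1 p.2) = ν)
    {b : ℕ → ℕ → (ℕ → Ω) × (ℕ → Ω) → ℝ≥0∞}
    (hb : ∀ i j, Measurable[cylSigma Ω (Set.Iic i) (Set.Iic j)] (b i j)) (N : ℕ) {S : ℝ≥0∞}
    (hS : ∫⁻ z, (∑ i ∈ Finset.range N, ∑ j ∈ Finset.range N, b i j z) ^ (1 / 2 : ℝ) ∂ν.prod ν = S)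
    (hfin : S ≠ ⊤) :
    ∃ I J K : ℕ → ℕ → Set ((ℕ → Ω) × (ℕ → Ω)),
      (∀ i j, MeasurableSet[cylSigma Ω (Set.Iic i) (Set.Iic j)] (I i j)) ∧
      (∀ i j, MeasurableSet[cylSigma Ω (Set.Iic i) (Set.Iic j)] (J i j)) ∧
      (∀ i j, MeasurableSet[cylSigma Ω (Set.Iic i) (Set.Iic j)] (K i j)) ∧
      ∑ i ∈ Finset.range N, ∑ j ∈ Finset.range N,
        ∫⁻ z, (K i j).indicator ((I i j).indicator (b i j)) z ^ (1 / 2 : ℝ) ∂ν.prod ν ≤ 576 * S ∧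
      ∫⁻ z, (∑ i ∈ Finset.range N, ∑ j ∈ Finset.range N,
        ∫⁻ w, (J i j)ᶜ.indicator ((I i j)ᶜ.indicator (b i j)) w
          ∂resampleMeasure ν (Set.Iic (i - 1)) (Set.Iic (j - 1)) z) ^ (1 / 2 : ℝ) ∂ν.prod ν ≤
        576 * S ∧
      ∑ i ∈ Finset.range N, ∫⁻ z, (∑ j ∈ Finset.range N,
        ∫⁻ w, (K i j)ᶜ.indicator ((I i j).indicator (b i j)) w
          ∂resampleMeasure ν Set.univ (Set.Iic (j - 1)) z) ^ (1 / 2 : ℝ) ∂ν.prod ν ≤ 576 * S ∧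
      ∑ j ∈ Finset.range N, ∫⁻ z, (∑ i ∈ Finset.range N,
        ∫⁻ w, (J i j).indicator ((I i j)ᶜ.indicator (b i j)) w
          ∂resampleMeasure ν (Set.Iic (i - 1)) Set.univ z) ^ (1 / 2 : ℝ) ∂ν.prod ν ≤ 576 * S := by
  obtain ⟨I, hI, hI1, hI2⟩ := exists_adapted_split_fst hν hb N N (hS ▸ hfin)
  rw [hS] at hI1 hI2
  have h24 : ∀ x ≤ 24 * S, 24 * x ≤ 576 * S := fun x hx => by
    calc 24 * x ≤ 24 * (24 * S) := by gcongr
      _ = 576 * S := by rw [← mul_assoc]; norm_num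
  have hS24 : 24 * S ≠ ⊤ := ENNReal.mul_ne_top (by norm_num) hfin
  have hg : ∀ i j, Measurable[cylSigma Ω (Set.Iic i) (Set.Iic j)] ((I i j).indicator (b i j)) :=
    fun i j => Measurable.indicator (m := cylSigma Ω _ _) (hb i j) (hI i j)
  have hh : ∀ i j, Measurable[cylSigma Ω (Set.Iic i) (Set.Iic j)] ((I i j)ᶜ.indicator (b i j)) :=
    fun i j => Measurable.indicator (m := cylSigma Ω _ _) (hb i j) (hI i j).compl
  have hh0 : ∀ i j, Measurable ((I i j)ᶜ.indicator (b i j)) := fun i j =>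
    (hh i j).mono (cylSigma_le _ _) le_rfl
  have hsum : ∀ F : ℕ → ℕ → ℝ≥0∞, ∑ j ∈ Finset.range N, ∑ i ∈ Finset.range N, F i j =
      ∑ i ∈ Finset.range N, ∑ j ∈ Finset.range N, F i j := fun F => Finset.sum_comm
  obtain ⟨J, hJ, hJ1, hJ2⟩ := exists_adapted_split_snd hν (fun i => Set.Iic (i - 1))
    (fun _ _ h => Set.Iic_subset_Iic.2 (Nat.sub_le_sub_right h 1))
    (b := fun j i z => ∫⁻ w, (I i j)ᶜ.indicator (b i j) w
      ∂resampleMeasure ν (Set.Iic (i - 1)) Set.univ z)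
    (fun i j => measurable_lintegral_resampleMeasure_of_subset ν (hh i j) Set.inter_subset_right
      Set.inter_subset_left) N N (by
        simp only [hsum fun i j => ∫⁻ w, (I i j)ᶜ.indicator (b i j) w
          ∂resampleMeasure ν (Set.Iic (i - 1)) Set.univ _]
        exact ne_top_of_le_ne_top hS24 hI2)
  have hle : ∀ i j, cylSigma Ω (Set.Iic (i - 1)) (Set.Iic j) ≤
      cylSigma Ω (Set.Iic i) (Set.Iic j) := fun i j =>
    cylSigma_mono (Set.Iic_subset_Iic.2 (Nat.sub_le i 1)) le_rfl
  have hJ' : ∀ i j, MeasurableSet[cylSigma Ω (Set.Iic (i - 1)) Set.univ] (J j i) := fun i j =>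
    cylSigma_mono le_rfl (Set.subset_univ _) _ (hJ j i)
  have hK : ∀ i, ∃ K : ℕ → Set ((ℕ → Ω) × (ℕ → Ω)),
      (∀ j, MeasurableSet[cylSigma Ω (Set.Iic i) (Set.Iic j)] (K j)) ∧ (i ∈ Finset.range N →
      ∑ j ∈ Finset.range N,
        ∫⁻ z, (K j).indicator ((I i j).indicator (b i j)) z ^ (1 / 2 : ℝ) ∂ν.prod ν ≤
        24 * ∫⁻ z, (∑ j ∈ Finset.range N, (I i j).indicator (b i j) z) ^ (1 / 2 : ℝ) ∂ν.prod ν ∧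
      ∫⁻ z, (∑ j ∈ Finset.range N, ∫⁻ w, (K j)ᶜ.indicator ((I i j).indicator (b i j)) w
          ∂resampleMeasure ν Set.univ (Set.Iic (j - 1)) z) ^ (1 / 2 : ℝ) ∂ν.prod ν ≤
        24 * ∫⁻ z, (∑ j ∈ Finset.range N, (I i j).indicator (b i j) z) ^ (1 / 2 : ℝ)
          ∂ν.prod ν) := by
    intro i
    by_cases hi : i ∈ Finset.range N
    · obtain ⟨K, hK, hK1, hK2⟩ := exists_adapted_split_snd hν (fun _ => Set.Iic i)
        monotone_const (b := fun j _ => (I i j).indicator (b i j)) (fun _ j => hg i j) N 1 (by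
          simp only [Finset.sum_range_one]
          exact ne_top_of_le_ne_top hS24 ((Finset.single_le_sum
            (f := fun i => ∫⁻ z, (∑ j ∈ Finset.range N,
              (I i j).indicator (b i j) z) ^ (1 / 2 : ℝ) ∂ν.prod ν)
            (fun _ _ => zero_le) hi).trans hI1))
      simp only [Finset.sum_range_one] at hK1 hK2
      exact ⟨fun j => K j 0, fun j => hK j 0, fun _ => ⟨hK1, hK2⟩⟩
    · exact ⟨fun _ => Set.univ, fun _ => MeasurableSet.univ, fun h => absurd h hi⟩
  choose K hK hK' using hK
  refine ⟨I, fun i j => J j i, K, hI, fun i j => hle i j _ (hJ j i), hK, ?_, ?_, ?_, ?_⟩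
  · refine (Finset.sum_le_sum fun i hi => (hK' i hi).1).trans ?_
    rw [← Finset.mul_sum]
    exact h24 _ hI1
  · simp only [hsum fun i j => ∫⁻ w, (I i j)ᶜ.indicator (b i j) w
          ∂resampleMeasure ν (Set.Iic (i - 1)) Set.univ _] at hJ2
    refine le_trans (le_of_eq ?_) (hJ2.trans (h24 _ hI2))
    refine lintegral_congr fun z => ?_
    rw [← hsum]
    congr 1
    refine Finset.sum_congr rfl fun j _ => Finset.sum_congr rfl fun i _ => ?_
    rw [← lintegral_lintegral_resampleMeasure ν _ _
      ((hh0 i j).indicator (cylSigma_le _ _ _ (hJ j i)).compl)]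
    simp only [(isCondKernel_resampleMeasure hν _ _).lintegral_indicator (hJ' i j).compl (hh0 i j)]
  · refine (Finset.sum_le_sum fun i hi => (hK' i hi).2).trans ?_
    rw [← Finset.mul_sum]
    exact h24 _ hI1
  · simp only [hsum fun i j => ∫⁻ w, (I i j)ᶜ.indicator (b i j) w
          ∂resampleMeasure ν (Set.Iic (i - 1)) Set.univ _] at hJ1
    refine le_trans (le_of_eq ?_) (hJ1.trans (h24 _ hI2))
    simp only [(isCondKernel_resampleMeasure hν _ _).lintegral_indicator (hJ' _ _) (hh0 _ _)]

end Decomposition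

section Integrals
open scoped ENNReal
variable {X : Type*}

theorem ofReal_sq_indicator (s : Set X) (g : X → ℝ) :
    (fun z => ENNReal.ofReal (s.indicator g z ^ 2)) =
      s.indicator fun z => ENNReal.ofReal (g z ^ 2) := by
  ext z
  by_cases hz : z ∈ s <;> simp [hz]

variable [MeasurableSpace X] {P : Measure X}

theorem ofReal_sqrt_eq_rpow (x : ℝ) :
    ENNReal.ofReal (Real.sqrt x) = ENNReal.ofReal x ^ (1 / 2 : ℝ) := by
  rcases le_total 0 x with h | h
  · rw [Real.sqrt_eq_rpow, ENNReal.ofReal_rpow_of_nonneg h (by norm_num)]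
  · rw [Real.sqrt_eq_zero_of_nonpos h, ENNReal.ofReal_of_nonpos h]
    simp

theorem ofReal_integral_le {g : X → ℝ} (hg : ∀ z, 0 ≤ g z) :
    ENNReal.ofReal (∫ z, g z ∂P) ≤ ∫⁻ z, ENNReal.ofReal (g z) ∂P := by
  rw [← Real.enorm_of_nonneg (integral_nonneg hg)]
  refine (enorm_integral_le_lintegral_enorm g).trans (lintegral_mono fun z => ?_)
  rw [Real.enorm_of_nonneg (hg z)]

theorem ofReal_tsum_le {ι : Type*} (s : Finset ι) {F : ι → ℝ} {G : ι → ℝ≥0∞}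
    (h0 : ∀ i ∉ s, F i = 0) (h : ∀ i ∈ s, ENNReal.ofReal (F i) ≤ G i) :
    ENNReal.ofReal (∑' i, F i) ≤ ∑ i ∈ s, G i := by
  rw [tsum_eq_sum h0]
  exact (Finset.le_sum_of_subadditive _ ENNReal.ofReal_zero.le (fun _ _ => ENNReal.ofReal_add_le) _
    _).trans (Finset.sum_le_sum h)

theorem ofReal_integral_sqrt_tsum_le {ι : Type*} (s : Finset ι) {F : ι → X → ℝ}
    {G : ι → X → ℝ≥0∞} (h0 : ∀ i ∉ s, F i = 0)
    (h : ∀ i ∈ s, ∀ᵐ z ∂P, ENNReal.ofReal (F i z) ≤ G i z) :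
    ENNReal.ofReal (∫ z, Real.sqrt (∑' i, F i z) ∂P) ≤
      ∫⁻ z, (∑ i ∈ s, G i z) ^ (1 / 2 : ℝ) ∂P := by
  refine (ofReal_integral_le fun z => Real.sqrt_nonneg _).trans (lintegral_mono_ae ?_)
  filter_upwards [(ae_ball_iff s.countable_toSet).2 h] with z hz
  rw [ofReal_sqrt_eq_rpow]
  exact ENNReal.rpow_le_rpow (ofReal_tsum_le s (fun i hi => congrFun (h0 i hi) z) hz)
    (by norm_num)

theorem ofReal_sq_rpow (x : ℝ) : ENNReal.ofReal (x ^ 2) ^ (1 / 2 : ℝ) = ‖x‖ₑ := by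
  rw [← ofReal_sqrt_eq_rpow, Real.sqrt_sq_eq_abs, ← Real.norm_eq_abs, ofReal_norm]

theorem lintegral_sqrt_sum_sq_ne_top {ι : Type*} (s : Finset ι) {g : ι → X → ℝ}
    (hg : ∀ i, Integrable (g i) P) :
    ∫⁻ z, (∑ i ∈ s, ENNReal.ofReal (g i z ^ 2)) ^ (1 / 2 : ℝ) ∂P ≠ ⊤ := by
  refine ne_top_of_le_ne_top (b := ∑ i ∈ s, ∫⁻ z, ‖g i z‖ₑ ∂P)
    (ENNReal.sum_ne_top.2 fun i _ => (hg i).hasFiniteIntegral.ne) ?_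
  rw [← lintegral_finsetSum' _ fun i _ => (hg i).aestronglyMeasurable.enorm]
  refine lintegral_mono fun z => ?_
  simp only [← ofReal_sq_rpow]
  exact Finset.le_sum_of_subadditive (fun x : ℝ≥0∞ => x ^ (1 / 2 : ℝ)) (by simp)
    (fun x y => ENNReal.rpow_add_le_add_rpow x y (by norm_num) (by norm_num)) _ _

end Integrals

theorem canonF_eq (Ω : Type) [MeasurableSpace Ω] (i : ℕ) :
    canonF Ω i = cylinderEvents (X := fun _ => Ω) (Set.Iic i) := by
  refine le_antisymm ?_ ?_
  · refine Measurable.comap_le ?_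
    exact @measurable_pi_lambda _ _ _ (cylinderEvents (Set.Iic i)) _ _ fun k =>
      measurable_cylinderEvents_iff.1 (@measurable_id _ (cylinderEvents (X := fun _ => Ω)
        (Set.Iic i))) (Nat.lt_succ_iff.1 k.2)
  · refine iSup₂_le fun k hk => ?_
    refine Measurable.comap_le ?_
    exact (measurable_pi_apply (⟨k, Nat.lt_succ_iff.2 hk⟩ : Fin (i + 1))).comp
      (comap_measurable fun (x : ℕ → Ω) (k : Fin (i + 1)) => x k)

theorem canonF2_eq (Ω : Type) [MeasurableSpace Ω] (i j : ℕ) :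
    canonF2 Ω i j = cylSigma Ω (Set.Iic i) (Set.Iic j) := by
  rw [canonF2, canonF_eq, canonF_eq]

theorem canonF2InfR_eq (Ω : Type) [MeasurableSpace Ω] (j : ℕ) :
    canonF2InfR Ω j = cylSigma Ω Set.univ (Set.Iic j) := by
  simp only [canonF2InfR, canonF2_eq]
  refine le_antisymm (iSup_le fun i => cylSigma_mono (Set.subset_univ _) le_rfl) ?_
  have h : Measurable[⨆ i, cylSigma Ω (Set.Iic i) (Set.Iic j), cylSigma Ω Set.univ (Set.Iic j)]
      (id : (ℕ → Ω) × (ℕ → Ω) → _) := by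
    refine measurable_cylSigma_iff.2 ⟨fun k _ => ?_, fun k hk => ?_⟩
    · exact (measurable_fst_apply (s := Set.Iic k) (Set.mem_Iic.2 le_rfl)).mono
        (le_iSup (fun i => cylSigma Ω (Set.Iic i) (Set.Iic j)) k) le_rfl
    · exact (measurable_snd_apply hk).mono
        (le_iSup (fun i => cylSigma Ω (Set.Iic i) (Set.Iic j)) 0) le_rfl
  exact fun A hA => h hA

theorem canonF2InfL_eq (Ω : Type) [MeasurableSpace Ω] (i : ℕ) :
    canonF2InfL Ω i = cylSigma Ω (Set.Iic i) Set.univ := by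
  simp only [canonF2InfL, canonF2_eq]
  refine le_antisymm (iSup_le fun i => cylSigma_mono le_rfl (Set.subset_univ _)) ?_
  have h : Measurable[⨆ j, cylSigma Ω (Set.Iic i) (Set.Iic j), cylSigma Ω (Set.Iic i) Set.univ]
      (id : (ℕ → Ω) × (ℕ → Ω) → _) := by
    refine measurable_cylSigma_iff.2 ⟨fun k hk => ?_, fun k _ => ?_⟩
    · exact (measurable_fst_apply hk).mono
        (le_iSup (fun j => cylSigma Ω (Set.Iic i) (Set.Iic j)) 0) le_rfl
    · exact (measurable_snd_apply (t := Set.Iic k) (Set.mem_Iic.2 le_rfl)).mono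
        (le_iSup (fun j => cylSigma Ω (Set.Iic i) (Set.Iic j)) k) le_rfl
  exact fun A hA => h hA

/-- two-parameter Davis–Garsia decomposition, lower bound:
any finitely supported adapted family can be decomposed into four adapted summands
whose four norms are dominated by the `L¹`-norm of the square function. -/
theorem statement1 :
    ∃ c : ℝ, 0 < c ∧
      ∀ (Ω : Type) [MeasurableSpace Ω] (μ : Measure Ω), IsProbabilityMeasure μ →
        ∀ (ν : Measure (ℕ → Ω)), IsProbabilityMeasure ν →
          (∀ n : ℕ, ν.map (fun x (k : Fin n) => x k) = Measure.pi fun _ : Fin n => μ) →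
          ∀ f : ℕ × ℕ → (ℕ → Ω) × (ℕ → Ω) → ℝ,
            (∀ i j : ℕ, Measurable[canonF2 Ω i j] (f (i, j))) →
            (∀ p : ℕ × ℕ, Integrable (f p) (ν.prod ν)) →
            (Function.support f).Finite →
            ∃ α β γ δ : ℕ × ℕ → (ℕ → Ω) × (ℕ → Ω) → ℝ,
              (∀ i j : ℕ,
                Measurable[canonF2 Ω i j] (α (i, j)) ∧ Measurable[canonF2 Ω i j] (β (i, j)) ∧
                Measurable[canonF2 Ω i j] (γ (i, j)) ∧ Measurable[canonF2 Ω i j] (δ (i, j))) ∧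
              (∀ p : ℕ × ℕ, Integrable (α p) (ν.prod ν) ∧ Integrable (β p) (ν.prod ν) ∧
                Integrable (γ p) (ν.prod ν) ∧ Integrable (δ p) (ν.prod ν)) ∧
              (∀ p : ℕ × ℕ, f p = α p + β p + γ p + δ p) ∧
              ∫ z, Real.sqrt (∑' p : ℕ × ℕ, (f p z) ^ 2) ∂(ν.prod ν) ≥
                c * ((∑' p : ℕ × ℕ, ∫ z, |α p z| ∂(ν.prod ν))
                  + (∫ z, Real.sqrt (∑' p : ℕ × ℕ,
                      ((ν.prod ν)[fun w => (β p w) ^ 2|canonF2 Ω (p.1 - 1) (p.2 - 1)]) z)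
                      ∂(ν.prod ν))
                  + (∑' i : ℕ, ∫ z, Real.sqrt (∑' j : ℕ,
                      ((ν.prod ν)[fun w => (γ (i, j) w) ^ 2|canonF2InfR Ω (j - 1)]) z)
                      ∂(ν.prod ν))
                  + (∑' j : ℕ, ∫ z, Real.sqrt (∑' i : ℕ,
                      ((ν.prod ν)[fun w => (δ (i, j) w) ^ 2|canonF2InfL Ω (i - 1)]) z)
                      ∂(ν.prod ν))) := by
  classical
  refine ⟨1 / 2304, by norm_num, fun Ω _ μ hμ ν hν1 hmarg f hf hfi hsupp => ?_⟩
  have hν : ∀ s : Set ℕ, (ν.prod ν).map (fun p => s.piecewise p.1 p.2) = ν := fun s => by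
    rw [eq_infinitePi_of_map_eq_pi hmarg]
    exact map_piecewise_infinitePi μ s
  rw [show canonF2 Ω = fun i j => cylSigma Ω (Set.Iic i) (Set.Iic j) from
    funext₂ (canonF2_eq Ω)] at hf ⊢
  rw [funext (canonF2InfR_eq Ω), funext (canonF2InfL_eq Ω)]
  beta_reduce at hf ⊢
  obtain ⟨N, hN⟩ : ∃ N : ℕ, ∀ i j, i ∉ Finset.range N ∨ j ∉ Finset.range N → f (i, j) = 0 := by
    obtain ⟨⟨a, b⟩, hab⟩ := hsupp.bddAbove
    refine ⟨max a b + 1, fun i j hij => ?_⟩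
    by_contra h
    have := hab (Function.mem_support.2 h)
    simp only [Prod.mk_le_mk] at this
    simp only [Finset.mem_range] at hij
    omega
  have hN' : ∀ p ∉ Finset.range N ×ˢ Finset.range N, f p = 0 := fun p hp =>
    hN p.1 p.2 (by rwa [Finset.mem_product, not_and_or] at hp)
  set b : ℕ → ℕ → (ℕ → Ω) × (ℕ → Ω) → ENNReal :=
    fun i j z => ENNReal.ofReal (f (i, j) z ^ 2) with hb
  have hbm : ∀ i j, Measurable[cylSigma Ω (Set.Iic i) (Set.Iic j)] (b i j) := fun i j =>
    ((hf i j).pow_const 2).ennreal_ofReal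
  set S := ∫⁻ z, (∑ i ∈ Finset.range N, ∑ j ∈ Finset.range N, b i j z) ^ (1 / 2 : ℝ) ∂ν.prod ν
    with hS
  have hfin : S ≠ ⊤ := by
    simp only [hS, hb, ← Finset.sum_product']
    exact lintegral_sqrt_sum_sq_ne_top _ hfi
  obtain ⟨I, J, K, hI, hJ, hK, h1, h2, h3, h4⟩ := exists_four_part_split hν hbm N hS.symm hfin
  have hf0 : ∀ i j, Measurable (f (i, j)) := fun i j => (hf i j).mono (cylSigma_le _ _) le_rfl
  have hle : ∀ i j, cylSigma Ω (Set.Iic i) (Set.Iic j) ≤ Prod.instMeasurableSpace := fun i j =>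
    cylSigma_le _ _
  have hind : ∀ A B : ℕ → ℕ → Set ((ℕ → Ω) × (ℕ → Ω)),
      (∀ i j, MeasurableSet[cylSigma Ω (Set.Iic i) (Set.Iic j)] (A i j)) →
      (∀ i j, MeasurableSet[cylSigma Ω (Set.Iic i) (Set.Iic j)] (B i j)) → ∀ i j,
      Measurable[cylSigma Ω (Set.Iic i) (Set.Iic j)]
        ((A i j).indicator ((B i j).indicator (f (i, j)))) := fun A B hA hB i j =>
    Measurable.indicator (m := cylSigma Ω _ _)
      (Measurable.indicator (m := cylSigma Ω _ _) (hf i j) (hB i j)) (hA i j)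
  have hindi : ∀ A B : ℕ → ℕ → Set ((ℕ → Ω) × (ℕ → Ω)),
      (∀ i j, MeasurableSet[cylSigma Ω (Set.Iic i) (Set.Iic j)] (A i j)) →
      (∀ i j, MeasurableSet[cylSigma Ω (Set.Iic i) (Set.Iic j)] (B i j)) → ∀ p : ℕ × ℕ,
      Integrable ((A p.1 p.2).indicator ((B p.1 p.2).indicator (f p))) (ν.prod ν) :=
    fun A B hA hB p => ((hfi p).indicator (hle _ _ _ (hB _ _))).indicator (hle _ _ _ (hA _ _))
  have hI' := fun i j => (hI i j).compl
  have hJ' := fun i j => (hJ i j).compl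
  have hK' := fun i j => (hK i j).compl
  have hcond : ∀ (A B : ℕ → ℕ → Set ((ℕ → Ω) × (ℕ → Ω))) (s t : Set ℕ),
      (∀ i j, MeasurableSet[cylSigma Ω (Set.Iic i) (Set.Iic j)] (A i j)) →
      (∀ i j, MeasurableSet[cylSigma Ω (Set.Iic i) (Set.Iic j)] (B i j)) → ∀ i j,
      ∀ᵐ z ∂ν.prod ν, ENNReal.ofReal (((ν.prod ν)[fun w =>
        ((A i j).indicator ((B i j).indicator (f (i, j))) w) ^ 2|cylSigma Ω s t]) z) ≤
        ∫⁻ w, (A i j).indicator ((B i j).indicator (b i j)) w ∂resampleMeasure ν s t z := by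
    intro A B s t hA hB i j
    have := (isCondKernel_resampleMeasure hν s t).ofReal_condExp_le
      (((hind A B hA hB i j).mono (hle i j) le_rfl).pow_const 2) fun z => sq_nonneg _
    simpa only [ofReal_sq_indicator] using this
  have hzero : ∀ (A B : ℕ → ℕ → Set ((ℕ → Ω) × (ℕ → Ω))) (m : MeasurableSpace _) (i j : ℕ),
      f (i, j) = 0 → (ν.prod ν)[fun w =>
        ((A i j).indicator ((B i j).indicator (f (i, j))) w) ^ 2|m] = 0 := by
    intro A B m i j h
    simp only [h, Set.indicator_zero', Pi.zero_apply, ne_eq, OfNat.ofNat_ne_zero,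
      not_false_eq_true, zero_pow]
    exact condExp_zero
  have hSr : ∫ z, Real.sqrt (∑' p : ℕ × ℕ, (f p z) ^ 2) ∂(ν.prod ν) = S.toReal := by
    have h : ∀ z, ∑' p : ℕ × ℕ, (f p z) ^ 2 = ∑ p ∈ Finset.range N ×ˢ Finset.range N, f p z ^ 2 :=
      fun z => tsum_eq_sum fun p hp => by simp [hN' p hp]
    simp only [h]
    rw [integral_eq_lintegral_of_nonneg_ae (ae_of_all _ fun z => Real.sqrt_nonneg _)
      (Finset.measurable_sum _ fun p _ => (hf0 p.1 p.2).pow_const 2).sqrt.aestronglyMeasurable]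
    congr 1
    refine lintegral_congr fun z => ?_
    rw [ofReal_sqrt_eq_rpow, ENNReal.ofReal_sum_of_nonneg fun _ _ => sq_nonneg _,
      Finset.sum_product]
  have hfinal : ∀ x : ℝ, ENNReal.ofReal x ≤ 576 * S → x ≤ 576 * S.toReal := fun x hx => by
    have := (ENNReal.ofReal_le_iff_le_toReal (ENNReal.mul_ne_top (by norm_num) hfin)).1 hx
    simpa using this
  refine ⟨fun p => (K p.1 p.2).indicator ((I p.1 p.2).indicator (f p)),
    fun p => (J p.1 p.2)ᶜ.indicator ((I p.1 p.2)ᶜ.indicator (f p)),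
    fun p => (K p.1 p.2)ᶜ.indicator ((I p.1 p.2).indicator (f p)),
    fun p => (J p.1 p.2).indicator ((I p.1 p.2)ᶜ.indicator (f p)),
    fun i j => ⟨hind _ _ hK hI i j, hind _ _ hJ' hI' i j, hind _ _ hK' hI i j,
      hind _ _ hJ hI' i j⟩,
    fun p => ⟨hindi _ _ hK hI p, hindi _ _ hJ' hI' p, hindi _ _ hK' hI p, hindi _ _ hJ hI' p⟩,
    fun p => ?_, ?_⟩
  · have e1 := Set.indicator_self_add_compl (I p.1 p.2) (f p)
    have e2 := Set.indicator_self_add_compl (K p.1 p.2) ((I p.1 p.2).indicator (f p))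
    have e3 := Set.indicator_self_add_compl (J p.1 p.2) ((I p.1 p.2)ᶜ.indicator (f p))
    conv_lhs => rw [← e1, ← e2, ← e3]
    abel
  · have a1 := hfinal (∑' p : ℕ × ℕ, ∫ z, |(K p.1 p.2).indicator
        ((I p.1 p.2).indicator (f p)) z| ∂(ν.prod ν)) (by
      rw [← Finset.sum_product'] at h1
      refine (ofReal_tsum_le _ (fun p hp => by simp [hN' p hp]) fun p _ => ?_).trans h1
      refine (ofReal_integral_le fun z => abs_nonneg _).trans (lintegral_mono fun z => ?_)
      rw [← Real.sqrt_sq_eq_abs, ofReal_sqrt_eq_rpow]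
      refine le_of_eq (congrArg (· ^ (1 / 2 : ℝ)) ?_)
      have := congrFun (ofReal_sq_indicator (K p.1 p.2) ((I p.1 p.2).indicator (f p))) z
      rwa [ofReal_sq_indicator] at this)
    have a2 := hfinal _ ((ofReal_integral_sqrt_tsum_le (Finset.range N ×ˢ Finset.range N)
      (fun p hp => hzero (fun i j => (J i j)ᶜ) (fun i j => (I i j)ᶜ)
        (cylSigma Ω (Set.Iic (p.1 - 1)) (Set.Iic (p.2 - 1))) p.1 p.2 (hN' p hp))
      (fun p _ => hcond _ _ _ _ hJ' hI' p.1 p.2)).trans (by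
        simpa only [Finset.sum_product] using h2))
    have a3 := hfinal (∑' i : ℕ, ∫ z, Real.sqrt (∑' j : ℕ, ((ν.prod ν)[fun w =>
        ((K i j)ᶜ.indicator ((I i j).indicator (f (i, j))) w) ^ 2|
          cylSigma Ω Set.univ (Set.Iic (j - 1))]) z) ∂(ν.prod ν)) (by
      refine (ofReal_tsum_le _ (fun i hi => ?_) fun i _ => ?_).trans h3
      · simp [hzero (fun i j => (K i j)ᶜ) I _ i _ (hN i _ (Or.inl hi))]
      · exact ofReal_integral_sqrt_tsum_le _
          (fun j hj => hzero (fun i j => (K i j)ᶜ) I _ i j (hN i j (Or.inr hj)))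
          (fun j _ => hcond _ _ _ _ hK' hI i j))
    have a4 := hfinal (∑' j : ℕ, ∫ z, Real.sqrt (∑' i : ℕ, ((ν.prod ν)[fun w =>
        ((J i j).indicator ((I i j)ᶜ.indicator (f (i, j))) w) ^ 2|
          cylSigma Ω (Set.Iic (i - 1)) Set.univ]) z) ∂(ν.prod ν)) (by
      refine (ofReal_tsum_le _ (fun j hj => ?_) fun j _ => ?_).trans h4
      · simp [hzero J (fun i j => (I i j)ᶜ) _ _ j (hN _ j (Or.inr hj))]
      · exact ofReal_integral_sqrt_tsum_le _
          (fun i hi => hzero J (fun i j => (I i j)ᶜ) _ i j (hN i j (Or.inl hi)))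
          (fun i _ => hcond _ _ _ _ hJ hI' i j))
    rw [hSr]
    linarith

end
end

section
/- There is an absolute constant c > 0 with the following property. Let (Ω,𝓕,μ) be a probability space, let 𝓕_{i,j} be the canonical two-parameter product filtration on Ω^ℕ × Ω^ℕ, and let (f_{i,j})_{i,j≥0} be a martingale difference sequence (i.e. f_{i,j} is 𝓕_{i,j}-measurable and Δ_{i,j} f_{i,j} = f_{i,j}) with f_{i,j} = 0 for all but finitely many (i,j). Then there exist functions α_{i,j}, β_{i,j}, γ_{i,j}, δ_{i,j}, each also a martingale difference at (i,j) (Δ_{i,j}α_{i,j} = α_{i,j}, and similarly for β, γ, δ), with f_{i,j} = α_{i,j} + β_{i,j} + γ_{i,j} + δ_{i,j} and E[(Σ_{i,j}|f_{i,j}|²)^{1/2}] ≥ c · ( Σ_{i,j} E|α_{i,j}| + E[(Σ_{i,j} E_{i−1,j−1}|β_{i,j}|²)^{1/2}] + Σ_i E[(Σ_j E_{∞,j−1}|γ_{i,j}|²)^{1/2}] + Σ_j E[(Σ_i E_{i−1,∞}|δ_{i,j}|²)^{1/2}] ). -/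
open MeasureTheory

noncomputable section

/-- `E_{i,j}` for integer indices, with the convention that it vanishes if `i < 0` or
`j < 0` (used only to express the difference operators `Δ_{i,j}` uniformly). -/
def E2 {Ω : Type} [MeasurableSpace Ω] (ν₂ : Measure ((ℕ → Ω) × (ℕ → Ω))) (i j : ℤ)
    (f : (ℕ → Ω) × (ℕ → Ω) → ℝ) : (ℕ → Ω) × (ℕ → Ω) → ℝ :=
  if 0 ≤ i ∧ 0 ≤ j then ν₂[f|canonF2 Ω i.toNat j.toNat] else 0

/-- The two-parameter martingale difference operators `Δ_{i,j}`:
`Δ_{i,j} = E_{i,j} + E_{i-1,j-1} - E_{i-1,j} - E_{i,j-1}` for `i, j ≥ 1`,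
`Δ_{i,0} = E_{i,0} - E_{i-1,0}`, `Δ_{0,j} = E_{0,j} - E_{0,j-1}`, `Δ_{0,0} = E_{0,0}`. -/
def mdiff2 {Ω : Type} [MeasurableSpace Ω] (ν₂ : Measure ((ℕ → Ω) × (ℕ → Ω))) (i j : ℕ)
    (f : (ℕ → Ω) × (ℕ → Ω) → ℝ) : (ℕ → Ω) × (ℕ → Ω) → ℝ :=
  E2 ν₂ i j f + E2 ν₂ (i - 1) (j - 1) f - E2 ν₂ (i - 1) j f - E2 ν₂ i (j - 1) f

section CondExp

variable {X : Type*} {mX : MeasurableSpace X} {P : Measure X} {m : MeasurableSpace X}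

theorem sq_le_mul_of_forall_rat {x A B : ℝ} (hA : 0 ≤ A) (hB : 0 ≤ B) (hx : 0 ≤ x)
    (h : ∀ q : ℚ, 0 < q → 2 * x ≤ q * A + (q : ℝ)⁻¹ * B) : x ^ 2 ≤ A * B := by
  have hr : ∀ t : ℝ, 0 < t → 2 * x * t ≤ t ^ 2 * A + B := by
    intro t ht
    have hcl : t ∈ closure (Set.Ioi 0 ∩ Set.range ((↑) : ℚ → ℝ)) :=
      Rat.denseRange_cast.open_subset_closure_inter isOpen_Ioi ht
    have hc : IsClosed {t : ℝ | 2 * x * t ≤ t ^ 2 * A + B} :=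
      isClosed_le (by fun_prop) (by fun_prop)
    refine (hc.closure_subset_iff.2 ?_) hcl
    rintro _ ⟨hq, q, rfl⟩
    have hq' : (0 : ℝ) < q := hq
    have := h q (by exact_mod_cast hq')
    have h2 := mul_le_mul_of_nonneg_right this hq'.le
    have h3 : (q : ℝ)⁻¹ * q = 1 := inv_mul_cancel₀ hq'.ne'
    simp only [Set.mem_ofPred_eq]
    calc 2 * x * q ≤ (q * A + (q : ℝ)⁻¹ * B) * q := h2
      _ = (q : ℝ) ^ 2 * A + ((q : ℝ)⁻¹ * q) * B := by ring
      _ = _ := by rw [h3]; ring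
  rcases hA.eq_or_lt with rfl | hA
  · by_contra hcon
    have hx' : 0 < x := by
      rcases hx.eq_or_lt with rfl | h'
      · simp at hcon
      · exact h'
    have := hr ((B + 1) / x) (by positivity)
    rw [mul_assoc, mul_div_cancel₀ _ hx'.ne'] at this
    linarith
  · rcases hx.eq_or_lt with rfl | hx
    · simp only [ne_eq, OfNat.ofNat_ne_zero, not_false_eq_true, zero_pow]; positivity
    · have := hr (x / A) (by positivity)
      field_simp at this
      nlinarith

theorem condExp_sq_le_mul_condExp {g V H : X → ℝ} (hg : Integrable g P)
    (hV : Integrable V P) (hH : Integrable H P) (hV0 : ∀ᵐ x ∂P, 0 ≤ V x)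
    (hH0 : ∀ᵐ x ∂P, 0 ≤ H x) (h : ∀ᵐ x ∂P, g x ^ 2 ≤ V x * H x) :
    ∀ᵐ x ∂P, (P[g|m] x) ^ 2 ≤ P[V|m] x * P[H|m] x := by
  have key : ∀ q : ℚ, ∀ᵐ x ∂P, 0 < q →
      2 * P[(|g|)|m] x ≤ q * P[V|m] x + (q : ℝ)⁻¹ * P[H|m] x := by
    intro q
    by_cases hq : 0 < q
    swap
    · exact .of_forall fun x hx => absurd hx hq
    have hq' : (0 : ℝ) < q := by exact_mod_cast hq
    have mono := condExp_mono (m := m) (μ := P) (f := (2 : ℝ) • |g|)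
      (g := (q : ℝ) • V + (q : ℝ)⁻¹ • H) (hg.abs.smul (2 : ℝ))
      ((hV.smul (q : ℝ)).add (hH.smul (q : ℝ)⁻¹)) (by
        filter_upwards [hV0, hH0, h] with x h1 h2 h3
        simp only [Pi.smul_apply, Pi.add_apply, Pi.abs_apply, smul_eq_mul]
        refine abs_le_of_sq_le_sq' (a := 2 * |g x|) ?_ (by positivity) |>.2
        have e : (q : ℝ) * (q : ℝ)⁻¹ = 1 := mul_inv_cancel₀ hq'.ne'
        have : (2 * |g x|) ^ 2 = 4 * g x ^ 2 := by rw [mul_pow, sq_abs]; norm_num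
        rw [this]
        have e2 : V x * H x = (q * V x) * ((q : ℝ)⁻¹ * H x) := by
          rw [mul_mul_mul_comm, e, one_mul]
        nlinarith [sq_nonneg (q * V x - (q : ℝ)⁻¹ * H x)])
    filter_upwards [mono, condExp_smul (μ := P) (2 : ℝ) |g| m,
      condExp_add (hV.smul (q : ℝ)) (hH.smul (q : ℝ)⁻¹) m,
      condExp_smul (μ := P) (q : ℝ) V m, condExp_smul (μ := P) (q : ℝ)⁻¹ H m]
      with x h1 h2 h3 h4 h5 _
    rw [h2, h3, Pi.add_apply, h4, h5] at h1
    simpa using h1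
  filter_upwards [ae_all_iff.2 key, condExp_nonneg (m := m) hV0, condExp_nonneg (m := m) hH0,
    abs_condExp_ae_le_condExp_abs (m := m) (μ := P) g] with x h1 h2 h3 h4
  have h5 : 0 ≤ P[(|g|)|m] x := (abs_nonneg _).trans h4
  refine le_trans ?_ (sq_le_mul_of_forall_rat h2 h3 h5 h1)
  rw [← sq_abs]
  exact pow_le_pow_left₀ (abs_nonneg _) h4 2

theorem condExp_sq_le_weight_mul_condExp {g V H : X → ℝ}
    (hVm : AEStronglyMeasurable[m] V P) (hV0 : ∀ᵐ x ∂P, 0 ≤ V x)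
    (hH : Integrable H P) (hH0 : ∀ᵐ x ∂P, 0 ≤ H x) (h : ∀ᵐ x ∂P, g x ^ 2 ≤ V x * H x) :
    ∀ᵐ x ∂P, P[fun y => g y ^ 2|m] x ≤ V x * P[H|m] x := by
  by_cases hm : m ≤ mX
  swap
  · simp [condExp_of_not_le hm]
  by_cases hg : Integrable (fun y => g y ^ 2) P
  swap
  · rw [condExp_of_not_integrable hg]
    filter_upwards [hV0, condExp_nonneg (m := m) hH0] with x h1 h2
    exact mul_nonneg h1 h2
  have hVm' := hVm.mono hm
  have e : (fun y => g y ^ 2) =ᵐ[P] V * fun y => g y ^ 2 / V y := by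
    filter_upwards [h] with x hx
    by_cases hv : V x = 0
    · simp only [Pi.mul_apply, hv, zero_mul] at hx ⊢
      exact le_antisymm hx (sq_nonneg _)
    · simp only [Pi.mul_apply]; field_simp
  have hle : ∀ᵐ x ∂P, g x ^ 2 / V x ≤ H x := by
    filter_upwards [h, hV0, hH0] with x hx h1 h2
    exact div_le_of_le_mul₀ h1 h2 (by linarith)
  have hI : Integrable (fun y => g y ^ 2 / V y) P := by
    refine hH.mono (hg.1.div₀ hVm') ?_
    filter_upwards [hle, hV0] with x hx h1
    rw [Real.norm_of_nonneg (by positivity)]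
    exact hx.trans (le_abs_self _)
  filter_upwards [condExp_congr_ae (m := m) e,
    condExp_mul_of_aestronglyMeasurable_left hVm (hg.congr e) hI,
    condExp_mono (m := m) hI hH hle, hV0] with x h1 h2 h3 h4
  rw [h1, h2]
  exact mul_le_mul_of_nonneg_left h3 h4

variable [IsProbabilityMeasure P]

theorem condExp_sq_le_condExp_sq (hm : m ≤ mX) {g : X → ℝ} (hg : MemLp g 2 P) :
    ∀ᵐ x ∂P, (P[g|m] x) ^ 2 ≤ P[fun y => g y ^ 2|m] x :=
  (even_two.convexOn_pow (𝕜 := ℝ)).map_condExp_le_univ hm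
    (continuous_pow 2).lowerSemicontinuous (hg.integrable one_le_two) hg.integrable_sq

theorem integral_condExp_sq_le (hm : m ≤ mX) {g : X → ℝ} (hg : MemLp g 2 P) :
    ∫ x, (P[g|m] x) ^ 2 ∂P ≤ ∫ x, g x ^ 2 ∂P := by
  rw [← integral_condExp hm (f := fun x => g x ^ 2)]
  exact integral_mono_ae (hg.condExp one_le_two).integrable_sq integrable_condExp
    (condExp_sq_le_condExp_sq hm hg)

theorem integral_mul_condExp (hm : m ≤ mX) {h g : X → ℝ} (hh : StronglyMeasurable[m] h)
    (hhL : MemLp h 2 P) (hg : MemLp g 2 P) :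
    ∫ x, h x * P[g|m] x ∂P = ∫ x, h x * g x ∂P := by
  have h1 := condExp_mul_of_stronglyMeasurable_left (μ := P) hh (hhL.integrable_mul hg)
    (hg.integrable one_le_two)
  rw [← integral_condExp hm (f := fun x => h x * g x)]
  exact integral_congr_ae h1.symm

theorem integral_sq_condExp_sub_condExp {m₁ m₂ : MeasurableSpace X} (h₁₂ : m₁ ≤ m₂)
    (hm : m₂ ≤ mX) {g : X → ℝ} (hg : MemLp g 2 P) :
    ∫ x, (P[g|m₂] x - P[g|m₁] x) ^ 2 ∂P
      = ∫ x, (P[g|m₂] x) ^ 2 ∂P - ∫ x, (P[g|m₁] x) ^ 2 ∂P := by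
  have L1 : MemLp (P[g|m₁]) 2 P := hg.condExp one_le_two
  have L2 : MemLp (P[g|m₂]) 2 P := hg.condExp one_le_two
  have key : ∫ x, P[g|m₁] x * P[g|m₂] x ∂P = ∫ x, (P[g|m₁] x) ^ 2 ∂P := by
    rw [integral_mul_condExp hm (stronglyMeasurable_condExp.mono h₁₂) L1 hg,
      ← integral_mul_condExp (h₁₂.trans hm) stronglyMeasurable_condExp L1 hg]
    simp_rw [sq]
  have e : ∀ x, (P[g|m₂] x - P[g|m₁] x) ^ 2
      = (P[g|m₂] x) ^ 2 - 2 * (P[g|m₁] x * P[g|m₂] x) + (P[g|m₁] x) ^ 2 := fun x => by ring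
  simp_rw [e]
  have I : Integrable (fun x => 2 * (P[g|m₁] x * P[g|m₂] x)) P :=
    (L1.integrable_mul L2).const_mul 2
  have I' : Integrable (fun x => (P[g|m₂] x) ^ 2 - 2 * (P[g|m₁] x * P[g|m₂] x)) P :=
    L2.integrable_sq.sub I
  rw [integral_add I' L1.integrable_sq, integral_sub L2.integrable_sq I,
    integral_const_mul, key]
  ring

theorem sum_integral_sq_condExp_sub_le {𝓕 : ℕ → MeasurableSpace X} (hmono : Monotone 𝓕)
    (hle : ∀ i, 𝓕 i ≤ mX) {g : X → ℝ} (hg : MemLp g 2 P) (n : ℕ) :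
    ∑ i ∈ Finset.range n, ∫ x, (P[g|𝓕 i] x - P[g|𝓕 (i - 1)] x) ^ 2 ∂P ≤ ∫ x, g x ^ 2 ∂P := by
  refine le_trans ?_ (integral_condExp_sq_le (hle (n - 1)) hg)
  induction n with
  | zero => simpa using integral_nonneg fun x => sq_nonneg _
  | succ n ih =>
    rw [Finset.sum_range_succ, integral_sq_condExp_sub_condExp (hmono (Nat.sub_le n 1)) (hle n) hg]
    simp only [Nat.add_sub_cancel]
    linarith

/-- The Doob maximal inequality in `L²` along a finite stretch of a filtration. -/
theorem exists_maximal_condExp {𝓕 : ℕ → MeasurableSpace X} (hmono : Monotone 𝓕)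
    (hle : ∀ i, 𝓕 i ≤ mX) {g : X → ℝ} (hg : MemLp g 2 P) (n : ℕ) :
    ∃ M : X → ℝ, MemLp M 2 P ∧ (∀ j ≤ n, ∀ᵐ x ∂P, |P[g|𝓕 j] x| ≤ M x) ∧
      ∫ x, M x ^ 2 ∂P ≤ 4 * ∫ x, g x ^ 2 ∂P := by
  have hg' : MemLp |g| 2 P := hg.abs
  set a : ℕ → X → ℝ := fun j => P[(|g|)|𝓕 j] with ha
  have aL : ∀ j, MemLp (a j) 2 P := fun j => hg'.condExp one_le_two
  have aM : ∀ j, StronglyMeasurable[𝓕 j] (a j) := fun j => stronglyMeasurable_condExp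
  set M : ℕ → X → ℝ := fun n => partialSups a n with hM
  have Ms : ∀ n, M (n + 1) = M n ⊔ a (n + 1) := fun n => partialSups_succ a n
  have M0 : M 0 = a 0 := partialSups_zero a
  have MM : ∀ n, StronglyMeasurable[𝓕 n] (M n) := by
    intro n
    induction n with
    | zero => rw [M0]; exact aM 0
    | succ n ih =>
      rw [Ms]
      have ih' : StronglyMeasurable[𝓕 (n + 1)] (M n) := ih.mono (hmono n.le_succ)
      exact @StronglyMeasurable.sup X ℝ _ _ (𝓕 (n + 1)) _ _ _ ih' (aM (n + 1))
  have ML : ∀ n, MemLp (M n) 2 P := by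
    intro n
    induction n with
    | zero => rw [M0]; exact aL 0
    | succ n ih => rw [Ms]; exact ih.sup (aL _)
  have step : ∀ n, (1 / 2) * ∫ x, M n x ^ 2 ∂P ≤ ∫ x, M n x * a n x ∂P := by
    intro n
    induction n with
    | zero =>
      rw [M0]
      have : 0 ≤ ∫ x, a 0 x ^ 2 ∂P := integral_nonneg fun x => sq_nonneg _
      simp_rw [← sq]
      linarith
    | succ n ih =>
      have h1 : ∫ x, M n x * a n x ∂P = ∫ x, M n x * a (n + 1) x ∂P := by
        rw [← integral_mul_condExp (hle n) (MM n) (ML n) (aL (n + 1))]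
        refine integral_congr_ae ?_
        filter_upwards [condExp_condExp_of_le (μ := P) (f := |g|) (hmono n.le_succ) (hle (n + 1))]
          with x hx
        rw [ha]
        simp only
        rw [hx]
      have I1 := (ML (n + 1)).integrable_sq
      have I2 := (ML n).integrable_sq
      have I3 : Integrable (fun x => M (n + 1) x * a (n + 1) x) P :=
        (ML (n + 1)).integrable_mul (aL (n + 1))
      have I4 : Integrable (fun x => M n x * a (n + 1) x) P := (ML n).integrable_mul (aL (n + 1))
      have I5 : Integrable (fun x => (1 / 2) * M n x ^ 2 + M (n + 1) x * a (n + 1) x) P :=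
        (I2.const_mul _).add I3
      have h2 : ∫ x, (1 / 2) * M (n + 1) x ^ 2 ∂P ≤
          ∫ x, ((1 / 2) * M n x ^ 2 + M (n + 1) x * a (n + 1) x - M n x * a (n + 1) x) ∂P := by
        refine integral_mono (I1.const_mul _) (I5.sub I4) fun x => ?_
        simp only [Ms, Pi.sup_apply]
        rcases le_total (M n x) (a (n + 1) x) with h | h
        · rw [sup_eq_right.2 h]
          nlinarith [sq_nonneg (a (n + 1) x - M n x)]
        · rw [sup_eq_left.2 h]
          linarith
      have e : ∫ x, ((1 / 2) * M n x ^ 2 + M (n + 1) x * a (n + 1) x - M n x * a (n + 1) x) ∂P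
          = (1 / 2) * ∫ x, M n x ^ 2 ∂P + ∫ x, M (n + 1) x * a (n + 1) x ∂P
            - ∫ x, M n x * a (n + 1) x ∂P := by
        rw [integral_sub I5 I4, integral_add (I2.const_mul _) I3,
          integral_const_mul]
      rw [e, integral_const_mul] at h2
      linarith
  refine ⟨M n, ML n, fun j hj => ?_, ?_⟩
  · filter_upwards [abs_condExp_ae_le_condExp_abs (m := 𝓕 j) (μ := P) g] with x hx
    exact hx.trans (le_partialSups_of_le a hj x)
  · have h1 : ∫ x, M n x * a n x ∂P ≤ ∫ x, ((1 / 4) * M n x ^ 2 + a n x ^ 2) ∂P := by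
      refine integral_mono ((ML n).integrable_mul (aL n))
        (((ML n).integrable_sq.const_mul _).add (aL n).integrable_sq) fun x => ?_
      simp only
      nlinarith [sq_nonneg (M n x / 2 - a n x)]
    rw [integral_add ((ML n).integrable_sq.const_mul _) (aL n).integrable_sq,
      integral_const_mul] at h1
    have h2 := integral_condExp_sq_le (hle n) hg'
    have h3 : ∫ x, |g| x ^ 2 ∂P = ∫ x, g x ^ 2 ∂P := by simp
    have h4 := step n
    simp only [ha] at *
    linarith

theorem integral_sqrt_sum_condExp_sq_le {ι : Type*} (s : Finset ι) {𝓜 : ι → MeasurableSpace X}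
    (hle : ∀ k, 𝓜 k ≤ mX) {g V H : ι → X → ℝ} {B : X → ℝ}
    (hVm : ∀ k, AEStronglyMeasurable[𝓜 k] (V k) P) (hV0 : ∀ k, ∀ᵐ x ∂P, 0 ≤ V k x)
    (hVB : ∀ k ∈ s, ∀ᵐ x ∂P, V k x ≤ B x) (hB : Integrable B P) (hB0 : ∀ᵐ x ∂P, 0 ≤ B x)
    (hH : ∀ k, Integrable (H k) P) (hH0 : ∀ k, ∀ᵐ x ∂P, 0 ≤ H k x)
    (h : ∀ k ∈ s, ∀ᵐ x ∂P, g k x ^ 2 ≤ V k x * H k x) :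
    ∫ x, √(∑ k ∈ s, P[fun y => g k y ^ 2|𝓜 k] x) ∂P
      ≤ (1 / 2) * (∫ x, B x ∂P + ∑ k ∈ s, ∫ x, H k x ∂P) := by
  have pt : ∀ k ∈ s, ∀ᵐ x ∂P, P[fun y => g k y ^ 2|𝓜 k] x ≤ B x * P[H k|𝓜 k] x ∧
      0 ≤ P[H k|𝓜 k] x := by
    intro k hk
    filter_upwards [condExp_sq_le_weight_mul_condExp (hVm k) (hV0 k) (hH k) (hH0 k) (h k hk),
      hVB k hk, condExp_nonneg (m := 𝓜 k) (hH0 k)] with x h1 h2 h3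
    exact ⟨h1.trans (mul_le_mul_of_nonneg_right h2 h3), h3⟩
  have pt' := (Finset.eventually_all s).2 pt
  have I : Integrable (fun x => ∑ k ∈ s, P[H k|𝓜 k] x) P :=
    integrable_finsetSum _ fun k _ => integrable_condExp
  calc ∫ x, √(∑ k ∈ s, P[fun y => g k y ^ 2|𝓜 k] x) ∂P
      ≤ ∫ x, (1 / 2) * (B x + ∑ k ∈ s, P[H k|𝓜 k] x) ∂P := by
        refine integral_mono_of_nonneg (.of_forall fun x => Real.sqrt_nonneg _)
          ((hB.add I).const_mul _) ?_
        filter_upwards [pt', hB0] with x hx hb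
        have hK : 0 ≤ ∑ k ∈ s, P[H k|𝓜 k] x := Finset.sum_nonneg fun k hk => (hx k hk).2
        have : ∑ k ∈ s, P[fun y => g k y ^ 2|𝓜 k] x ≤ B x * ∑ k ∈ s, P[H k|𝓜 k] x := by
          rw [Finset.mul_sum]
          exact Finset.sum_le_sum fun k hk => (hx k hk).1
        refine Real.sqrt_le_iff.2 ⟨by positivity, this.trans ?_⟩
        nlinarith [sq_nonneg (B x - ∑ k ∈ s, P[H k|𝓜 k] x)]
    _ = _ := by
        rw [integral_const_mul, integral_add hB I,
          integral_finsetSum _ fun k _ => integrable_condExp]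
        simp_rw [integral_condExp (hle _)]

end CondExp

section CommutingFiltration

variable {X : Type*} {mX : MeasurableSpace X} {P : Measure X} {𝓖 : ℕ → ℕ → MeasurableSpace X}

/-- A two-parameter family of sub-σ-algebras, increasing in each index, whose conditional
expectations commute: `E_{k,l} E_{i,j} = E_{min i k, min j l}`. -/
structure IsCommutingFiltration (P : Measure X) (𝓖 : ℕ → ℕ → MeasurableSpace X) : Prop where
  le : ∀ i j, 𝓖 i j ≤ mX
  mono : ∀ {i j k l}, i ≤ k → j ≤ l → 𝓖 i j ≤ 𝓖 k l
  comm : ∀ (i j k l : ℕ) (f : X → ℝ),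
    P[P[f|𝓖 i j]|𝓖 k l] =ᵐ[P] P[f|𝓖 (min i k) (min j l)]

namespace IsCommutingFiltration

theorem swap (h : IsCommutingFiltration P 𝓖) : IsCommutingFiltration P fun i j => 𝓖 j i where
  le i j := h.le j i
  mono hi hj := h.mono hj hi
  comm i j k l f := h.comm j i l k f

theorem comm_of_le (h : IsCommutingFiltration P 𝓖) {i j k l : ℕ} (hki : k ≤ i) (hjl : j ≤ l)
    (f : X → ℝ) : P[P[f|𝓖 i j]|𝓖 k l] =ᵐ[P] P[f|𝓖 k j] := by
  simpa only [min_eq_right hki, min_eq_left hjl] using h.comm i j k l f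

theorem comm_of_le' (h : IsCommutingFiltration P 𝓖) {i j k l : ℕ} (hik : i ≤ k) (hlj : l ≤ j)
    (f : X → ℝ) : P[P[f|𝓖 i j]|𝓖 k l] =ᵐ[P] P[f|𝓖 i l] :=
  h.swap.comm_of_le hlj hik f

theorem condExp_sub_condExp (h : IsCommutingFiltration P 𝓖) {i k j N : ℕ} (hi : i ≤ N)
    (hk : k ≤ N) (hj : j ≤ N) (s : X → ℝ) :
    P[P[s|𝓖 i N] - P[s|𝓖 k N]|𝓖 N j] =ᵐ[P] P[s|𝓖 i j] - P[s|𝓖 k j] :=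
  (condExp_sub integrable_condExp integrable_condExp _).trans
    ((h.comm_of_le' hi hj s).sub (h.comm_of_le' hk hj s))

theorem memLp_sub {s : X → ℝ} (hs : MemLp s 2 P) (i j k l : ℕ) :
    MemLp (P[s|𝓖 i j] - P[s|𝓖 k l]) 2 P :=
  (hs.condExp one_le_two).sub (hs.condExp one_le_two)

variable [IsProbabilityMeasure P]

theorem exists_maximal (h : IsCommutingFiltration P 𝓖) {s : X → ℝ} (hs : MemLp s 2 P) (N : ℕ) :
    ∃ A : X → ℝ, MemLp A 2 P ∧ (∀ i ≤ N, ∀ j ≤ N, ∀ᵐ x ∂P, |P[s|𝓖 i j] x| ≤ A x) ∧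
      ∫ x, A x ^ 2 ∂P ≤ 16 * ∫ x, s x ^ 2 ∂P := by
  obtain ⟨M, hM, hMs, hMi⟩ := exists_maximal_condExp (𝓕 := fun j => 𝓖 N j)
    (fun _ _ hj => h.mono le_rfl hj) (fun j => h.le N j) hs N
  obtain ⟨A, hA, hAM, hAi⟩ := exists_maximal_condExp (𝓕 := fun i => 𝓖 i N)
    (fun _ _ hi => h.mono hi le_rfl) (fun i => h.le i N) hM N
  refine ⟨A, hA, fun i hi j hj => ?_, by linarith⟩
  filter_upwards [h.comm_of_le hi hj s, abs_condExp_ae_le_condExp_abs (m := 𝓖 i N) (μ := P)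
    (P[s|𝓖 N j]), condExp_mono (m := 𝓖 i N) (μ := P) integrable_condExp.abs
      (hM.integrable one_le_two) (hMs j hj), hAM i hi] with x h1 h2 h3 h4
  rw [← h1]
  exact h2.trans (h3.trans ((le_abs_self _).trans h4))

theorem sum_integral_sq_sub_le (h : IsCommutingFiltration P 𝓖) {s : X → ℝ} (hs : MemLp s 2 P)
    (N : ℕ) :
    ∑ i ∈ Finset.range N, ∫ x, ((P[s|𝓖 i N] - P[s|𝓖 (i - 1) N]) x) ^ 2 ∂P
      ≤ ∫ x, s x ^ 2 ∂P :=
  sum_integral_sq_condExp_sub_le (𝓕 := fun i => 𝓖 i N) (fun _ _ hi => h.mono hi le_rfl)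
    (fun i => h.le i N) hs N

theorem sum_integral_sq_mixed_le (h : IsCommutingFiltration P 𝓖) {s : X → ℝ}
    (hs : MemLp s 2 P) (N : ℕ) :
    ∑ i ∈ Finset.range N, ∑ j ∈ Finset.range N,
      ∫ x, ((P[s|𝓖 i j] - P[s|𝓖 (i - 1) j]) x
        - (P[s|𝓖 i (j - 1)] - P[s|𝓖 (i - 1) (j - 1)]) x) ^ 2 ∂P ≤ ∫ x, s x ^ 2 ∂P := by
  refine (Finset.sum_le_sum fun i hi => ?_).trans (h.sum_integral_sq_sub_le hs N)
  have hi' := (Finset.mem_range.1 hi).le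
  refine le_trans (Finset.sum_le_sum fun j hj => ?_)
    (sum_integral_sq_condExp_sub_le (𝓕 := fun j => 𝓖 N j) (fun _ _ hj => h.mono le_rfl hj)
      (fun j => h.le N j) (memLp_sub hs i N (i - 1) N) N)
  have hj' := (Finset.mem_range.1 hj).le
  refine (integral_congr_ae ?_).le
  filter_upwards [h.condExp_sub_condExp hi' ((Nat.sub_le i 1).trans hi') hj' s,
    h.condExp_sub_condExp hi' ((Nat.sub_le i 1).trans hi') ((Nat.sub_le j 1).trans hj') s]
    with x h1 h2
  rw [h1, h2]

theorem exists_maximal_sub (h : IsCommutingFiltration P 𝓖) {s : X → ℝ} (hs : MemLp s 2 P)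
    (N : ℕ) :
    ∃ M : ℕ → X → ℝ, (∀ i, MemLp (M i) 2 P) ∧
      (∀ i ≤ N, ∀ j ≤ N, ∀ᵐ x ∂P, |(P[s|𝓖 i j] - P[s|𝓖 (i - 1) j]) x| ≤ M i x) ∧
      ∑ i ∈ Finset.range N, ∫ x, M i x ^ 2 ∂P ≤ 4 * ∫ x, s x ^ 2 ∂P := by
  choose M hM hMs hMi using fun i => exists_maximal_condExp (𝓕 := fun j => 𝓖 N j)
    (fun _ _ hj => h.mono le_rfl hj) (fun j => h.le N j) (memLp_sub (𝓖 := 𝓖) hs i N (i - 1) N) N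
  refine ⟨M, hM, fun i hi j hj => ?_, ?_⟩
  · filter_upwards [hMs i j hj, h.condExp_sub_condExp hi ((Nat.sub_le i 1).trans hi) hj s]
      with x h1 h2
    rwa [← h2]
  · refine (Finset.sum_le_sum fun i _ => hMi i).trans ?_
    rw [← Finset.mul_sum]
    exact mul_le_mul_of_nonneg_left (h.sum_integral_sq_sub_le hs N) (by norm_num)

end IsCommutingFiltration

end CommutingFiltration

section ProdCondExp

variable {Y Z : Type*} {m₁ a₁ b₁ c₁ : MeasurableSpace Y} {m₂ a₂ b₂ c₂ : MeasurableSpace Z}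
  {mY : MeasurableSpace Y} {mZ : MeasurableSpace Z}
  {ν₁ : Measure Y} {ν₂ : Measure Z} [IsProbabilityMeasure ν₁] [IsProbabilityMeasure ν₂]

theorem prod_mono (h₁ : a₁ ≤ b₁) (h₂ : a₂ ≤ b₂) : a₁.prod a₂ ≤ b₁.prod b₂ :=
  sup_le_sup (MeasurableSpace.comap_mono h₁) (MeasurableSpace.comap_mono h₂)

theorem ae_eq_condExp_prod_of_forall_rectangle (h₁ : m₁ ≤ mY) (h₂ : m₂ ≤ mZ) {f g : Y × Z → ℝ}
    (hf : Integrable f (ν₁.prod ν₂)) (hg : Integrable g (ν₁.prod ν₂))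
    (hgm : AEStronglyMeasurable[m₁.prod m₂] g (ν₁.prod ν₂))
    (h : ∀ U V, MeasurableSet[m₁] U → MeasurableSet[m₂] V →
      ∫ z in U ×ˢ V, g z ∂(ν₁.prod ν₂) = ∫ z in U ×ˢ V, f z ∂(ν₁.prod ν₂)) :
    g =ᵐ[ν₁.prod ν₂] (ν₁.prod ν₂)[f|m₁.prod m₂] := by
  have hle : m₁.prod m₂ ≤ mY.prod mZ := prod_mono h₁ h₂
  refine ae_eq_condExp_of_forall_setIntegral_eq hle hf (fun _ _ _ => hg.integrableOn)
    (fun s hs _ => ?_) hgm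
  have hgen : m₁.prod m₂ = MeasurableSpace.generateFrom
      (Set.image2 (· ×ˢ ·) {s | MeasurableSet[m₁] s} {t | MeasurableSet[m₂] t}) :=
    (@generateFrom_prod Y Z m₁ m₂).symm
  induction s, hs using MeasurableSpace.induction_on_inter hgen (@isPiSystem_prod Y Z m₁ m₂) with
  | empty => simp
  | basic t ht =>
    obtain ⟨U, hU, V, hV, rfl⟩ := ht
    exact h U V hU hV
  | compl t ht ih =>
    have huniv := h Set.univ Set.univ MeasurableSet.univ MeasurableSet.univ
    simp only [Set.univ_prod_univ, setIntegral_univ] at huniv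
    rw [setIntegral_compl (hle _ ht) hg, setIntegral_compl (hle _ ht) hf, ih (measure_lt_top _ _),
      huniv]
  | iUnion t hd ht ih =>
    rw [integral_iUnion (fun n => hle _ (ht n)) hd hg.integrableOn,
      integral_iUnion (fun n => hle _ (ht n)) hd hf.integrableOn]
    exact tsum_congr fun n => ih n (measure_lt_top _ _)

theorem condExp_prod_mul (h₁ : m₁ ≤ mY) (h₂ : m₂ ≤ mZ) {φ : Y → ℝ} {ψ : Z → ℝ}
    (hφ : Integrable φ ν₁) (hψ : Integrable ψ ν₂) :
    (fun z : Y × Z => ν₁[φ|m₁] z.1 * ν₂[ψ|m₂] z.2) =ᵐ[ν₁.prod ν₂]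
      (ν₁.prod ν₂)[fun z => φ z.1 * ψ z.2|m₁.prod m₂] := by
  refine ae_eq_condExp_prod_of_forall_rectangle h₁ h₂ (hφ.mul_prod hψ)
    (integrable_condExp.mul_prod integrable_condExp) ?_ fun U V hU hV => ?_
  · have e1 : StronglyMeasurable[m₁.prod m₂] fun z : Y × Z => ν₁[φ|m₁] z.1 :=
      stronglyMeasurable_condExp.comp_measurable (@measurable_fst Y Z m₁ m₂)
    have e2 : StronglyMeasurable[m₁.prod m₂] fun z : Y × Z => ν₂[ψ|m₂] z.2 :=
      stronglyMeasurable_condExp.comp_measurable (@measurable_snd Y Z m₁ m₂)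
    exact (e1.mul e2).aestronglyMeasurable
  · rw [setIntegral_prod_mul, setIntegral_prod_mul, setIntegral_condExp h₁ hφ hU,
      setIntegral_condExp h₂ hψ hV]

theorem condExp_condExp_prod (ha₁ : a₁ ≤ mY) (hb₁ : b₁ ≤ mY) (ha₂ : a₂ ≤ mZ) (hb₂ : b₂ ≤ mZ)
    (hca₁ : c₁ ≤ a₁) (hcb₁ : c₁ ≤ b₁) (hca₂ : c₂ ≤ a₂) (hcb₂ : c₂ ≤ b₂)
    (H₁ : ∀ U, MeasurableSet[b₁] U →
      ν₁[U.indicator (fun _ => (1 : ℝ))|a₁] =ᵐ[ν₁] ν₁[U.indicator (fun _ => (1 : ℝ))|c₁])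
    (H₂ : ∀ V, MeasurableSet[b₂] V →
      ν₂[V.indicator (fun _ => (1 : ℝ))|a₂] =ᵐ[ν₂] ν₂[V.indicator (fun _ => (1 : ℝ))|c₂])
    (f : Y × Z → ℝ) :
    (ν₁.prod ν₂)[(ν₁.prod ν₂)[f|a₁.prod a₂]|b₁.prod b₂] =ᵐ[ν₁.prod ν₂]
      (ν₁.prod ν₂)[f|c₁.prod c₂] := by
  set P := ν₁.prod ν₂ with hP
  have hca := prod_mono hca₁ hca₂
  have hcb := prod_mono hcb₁ hcb₂
  have ha : a₁.prod a₂ ≤ mY.prod mZ := prod_mono ha₁ ha₂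
  have hc : c₁.prod c₂ ≤ mY.prod mZ := hca.trans ha
  refine (ae_eq_condExp_prod_of_forall_rectangle hb₁ hb₂ integrable_condExp integrable_condExp
    (stronglyMeasurable_condExp.mono hcb).aestronglyMeasurable fun U V hU hV => ?_).symm
  have hU' := hb₁ _ hU
  have hV' := hb₂ _ hV
  set φ : Y × Z → ℝ := fun z =>
    U.indicator (fun _ => (1 : ℝ)) z.1 * V.indicator (fun _ => (1 : ℝ)) z.2 with hφ
  have φm : Measurable φ :=
    ((measurable_const.indicator hU').comp measurable_fst).mul
      ((measurable_const.indicator hV').comp measurable_snd)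
  have φb : ∀ z, ‖φ z‖ ≤ 1 := fun z => by
    by_cases h1 : z.1 ∈ U <;> by_cases h2 : z.2 ∈ V <;> simp [hφ, h1, h2]
  have φI : Integrable φ P := Integrable.of_bound φm.aestronglyMeasurable 1 (.of_forall φb)
  have set_eq : ∀ g : Y × Z → ℝ, ∫ z in U ×ˢ V, g z ∂P = ∫ z, g z * φ z ∂P := by
    intro g
    rw [← integral_indicator (hU'.prod hV')]
    congr 1
    ext z
    by_cases h1 : z.1 ∈ U <;> by_cases h2 : z.2 ∈ V <;> simp [hφ, h1, h2]
  have I1 : Integrable (U.indicator fun _ => (1 : ℝ)) ν₁ := (integrable_const 1).indicator hU'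
  have I2 : Integrable (V.indicator fun _ => (1 : ℝ)) ν₂ := (integrable_const 1).indicator hV'
  have φac : P[φ|a₁.prod a₂] =ᵐ[P] P[φ|c₁.prod c₂] := by
    refine (condExp_prod_mul ha₁ ha₂ I1 I2).symm.trans
      (.trans ?_ (condExp_prod_mul (hca₁.trans ha₁) (hca₂.trans ha₂) I1 I2))
    filter_upwards [Measure.quasiMeasurePreserving_fst.ae (μa := P) (H₁ U hU),
      Measure.quasiMeasurePreserving_snd.ae (μa := P) (H₂ V hV)] with z h1 h2
    rw [h1, h2]
  have φcb : ∀ᵐ z ∂P, ‖P[φ|c₁.prod c₂] z‖ ≤ 1 :=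
    ae_bdd_abs_condExp_of_ae_bdd_abs (R := 1) (.of_forall φb)
  have gI : ∀ g : Y × Z → ℝ, Integrable g P → Integrable (g * φ) P := fun g hg =>
    hg.mul_bdd φm.aestronglyMeasurable (.of_forall φb)
  set g := P[f|a₁.prod a₂] with hg
  have gint : Integrable g P := integrable_condExp
  have gc : P[g|c₁.prod c₂] =ᵐ[P] P[f|c₁.prod c₂] := condExp_condExp_of_le hca ha
  have wI : Integrable (g * P[φ|c₁.prod c₂]) P :=
    gint.mul_bdd (integrable_condExp.1) φcb
  rw [set_eq, set_eq]
  calc ∫ z, P[f|c₁.prod c₂] z * φ z ∂P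
      = ∫ z, (P[f|c₁.prod c₂] * P[φ|c₁.prod c₂]) z ∂P := by
        rw [← integral_condExp hc]
        exact integral_congr_ae (condExp_mul_of_stronglyMeasurable_left stronglyMeasurable_condExp
          (gI _ integrable_condExp) φI)
    _ = ∫ z, (g * P[φ|c₁.prod c₂]) z ∂P := by
        rw [← integral_condExp hc (f := g * P[φ|c₁.prod c₂])]
        refine integral_congr_ae ?_
        refine .trans ?_ (condExp_mul_of_stronglyMeasurable_right stronglyMeasurable_condExp
          wI gint).symm
        filter_upwards [gc] with z hz
        simp only [Pi.mul_apply, hz]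
    _ = ∫ z, (g * P[φ|a₁.prod a₂]) z ∂P := by
        refine integral_congr_ae ?_
        filter_upwards [φac] with z hz
        simp only [Pi.mul_apply, hz]
    _ = ∫ z, g z * φ z ∂P := by
        rw [← integral_condExp ha (f := fun z => g z * φ z)]
        exact integral_congr_ae (condExp_mul_of_stronglyMeasurable_left stronglyMeasurable_condExp
          (gI _ gint) φI).symm

end ProdCondExp

section CanonicalFiltration

variable {Ω : Type} [MeasurableSpace Ω]

theorem canonF_mono : Monotone (canonF Ω) := by
  intro i k hik
  have hm : Measurable fun (y : Fin (k + 1) → Ω) (l : Fin (i + 1)) =>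
      y (Fin.castLE (Nat.succ_le_succ hik) l) := by fun_prop
  rw [canonF, canonF, ← measurable_iff_comap_le]
  exact hm.comp (comap_measurable _)

theorem canonF_le (i : ℕ) : canonF Ω i ≤ MeasurableSpace.pi := by
  rw [canonF, ← measurable_iff_comap_le]
  fun_prop

theorem canonF2_mono {i j k l : ℕ} (hik : i ≤ k) (hjl : j ≤ l) :
    canonF2 Ω i j ≤ canonF2 Ω k l :=
  prod_mono (canonF_mono hik) (canonF_mono hjl)

theorem canonF2_le (i j : ℕ) : canonF2 Ω i j ≤ Prod.instMeasurableSpace :=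
  prod_mono (canonF_le i) (canonF_le j)

theorem condExp_indicator_canonF_min (ν : Measure (ℕ → Ω)) [IsProbabilityMeasure ν] (i k : ℕ)
    {U : Set (ℕ → Ω)} (hU : MeasurableSet[canonF Ω k] U) :
    ν[U.indicator (fun _ => (1 : ℝ))|canonF Ω i] =ᵐ[ν]
      ν[U.indicator (fun _ => (1 : ℝ))|canonF Ω (min i k)] := by
  rcases le_total i k with h | h
  · rw [min_eq_left h]
  · have I : Integrable (U.indicator fun _ => (1 : ℝ)) ν :=
      (integrable_const 1).indicator (canonF_le k _ hU)
    have hs : StronglyMeasurable[canonF Ω k] (U.indicator fun _ => (1 : ℝ)) :=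
      stronglyMeasurable_const.indicator hU
    rw [min_eq_right h, condExp_of_stronglyMeasurable (canonF_le i) (hs.mono (canonF_mono h)) I,
      condExp_of_stronglyMeasurable (canonF_le k) hs I]

theorem condExp_condExp_canonF2 (ν : Measure (ℕ → Ω)) [IsProbabilityMeasure ν] (i j k l : ℕ)
    (f : (ℕ → Ω) × (ℕ → Ω) → ℝ) :
    (ν.prod ν)[(ν.prod ν)[f|canonF2 Ω i j]|canonF2 Ω k l] =ᵐ[ν.prod ν]
      (ν.prod ν)[f|canonF2 Ω (min i k) (min j l)] :=
  condExp_condExp_prod (canonF_le i) (canonF_le k) (canonF_le j) (canonF_le l)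
    (canonF_mono (min_le_left i k)) (canonF_mono (min_le_right i k))
    (canonF_mono (min_le_left j l)) (canonF_mono (min_le_right j l))
    (fun _ hU => condExp_indicator_canonF_min ν i k hU)
    (fun _ hV => condExp_indicator_canonF_min ν j l hV) f

end CanonicalFiltration

section DifferenceOperator

variable {X : Type*} {mX : MeasurableSpace X} {P : Measure X} {𝓖 : ℕ → ℕ → MeasurableSpace X}

/-- The conditional expectation `E_{i,j}` for integer indices, zero if an index is negative. -/
def expOp (P : Measure X) (𝓖 : ℕ → ℕ → MeasurableSpace X) (i j : ℤ) (f : X → ℝ) : X → ℝ :=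
  if 0 ≤ i ∧ 0 ≤ j then P[f|𝓖 i.toNat j.toNat] else 0

/-- The two-parameter martingale difference operator of a two-parameter family of σ-algebras. -/
def diffOp (P : Measure X) (𝓖 : ℕ → ℕ → MeasurableSpace X) (i j : ℕ) (f : X → ℝ) : X → ℝ :=
  expOp P 𝓖 i j f + expOp P 𝓖 (i - 1) (j - 1) f - expOp P 𝓖 (i - 1) j f - expOp P 𝓖 i (j - 1) f

theorem expOp_swap (i j : ℤ) (f : X → ℝ) :
    expOp P (fun i j => 𝓖 j i) j i f = expOp P 𝓖 i j f := by
  simp only [expOp, and_comm]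

theorem diffOp_swap (i j : ℕ) (f : X → ℝ) :
    diffOp P (fun i j => 𝓖 j i) j i f = diffOp P 𝓖 i j f := by
  simp only [diffOp, expOp_swap]
  abel

theorem expOp_zero (i j : ℤ) : expOp P 𝓖 i j 0 = 0 := by
  simp [expOp]

theorem diffOp_zero (i j : ℕ) : diffOp P 𝓖 i j 0 = 0 := by
  simp [diffOp, expOp_zero]

theorem integrable_expOp (i j : ℤ) (f : X → ℝ) : Integrable (expOp P 𝓖 i j f) P := by
  unfold expOp
  split_ifs
  exacts [integrable_condExp, integrable_zero _ _ _]

theorem integrable_diffOp (i j : ℕ) (f : X → ℝ) : Integrable (diffOp P 𝓖 i j f) P :=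
  (((integrable_expOp _ _ f).add (integrable_expOp _ _ f)).sub (integrable_expOp _ _ f)).sub
    (integrable_expOp _ _ f)

theorem expOp_congr {f g : X → ℝ} (h : f =ᵐ[P] g) (i j : ℤ) :
    expOp P 𝓖 i j f =ᵐ[P] expOp P 𝓖 i j g := by
  unfold expOp
  split_ifs
  exacts [condExp_congr_ae h, ae_eq_rfl]

theorem diffOp_congr {f g : X → ℝ} (h : f =ᵐ[P] g) (i j : ℕ) :
    diffOp P 𝓖 i j f =ᵐ[P] diffOp P 𝓖 i j g :=
  (((expOp_congr h _ _).add (expOp_congr h _ _)).sub (expOp_congr h _ _)).sub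
    (expOp_congr h _ _)

theorem expOp_add {f g : X → ℝ} (hf : Integrable f P) (hg : Integrable g P) (i j : ℤ) :
    expOp P 𝓖 i j (f + g) =ᵐ[P] expOp P 𝓖 i j f + expOp P 𝓖 i j g := by
  unfold expOp
  split_ifs
  · exact condExp_add hf hg _
  · simp

theorem expOp_sub {f g : X → ℝ} (hf : Integrable f P) (hg : Integrable g P) (i j : ℤ) :
    expOp P 𝓖 i j (f - g) =ᵐ[P] expOp P 𝓖 i j f - expOp P 𝓖 i j g := by
  unfold expOp
  split_ifs
  · exact condExp_sub hf hg _
  · simp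

theorem diffOp_sub {f g : X → ℝ} (hf : Integrable f P) (hg : Integrable g P) (i j : ℕ) :
    diffOp P 𝓖 i j (f - g) =ᵐ[P] diffOp P 𝓖 i j f - diffOp P 𝓖 i j g := by
  filter_upwards [expOp_sub (𝓖 := 𝓖) hf hg i j, expOp_sub (𝓖 := 𝓖) hf hg (i - 1) (j - 1),
    expOp_sub (𝓖 := 𝓖) hf hg (i - 1) j, expOp_sub (𝓖 := 𝓖) hf hg i (j - 1)] with x h1 h2 h3 h4
  simp only [diffOp, Pi.add_apply, Pi.sub_apply] at *
  rw [h1, h2, h3, h4]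
  ring

theorem expOp_diffOp (i j : ℕ) (k l : ℤ) (f : X → ℝ) :
    expOp P 𝓖 k l (diffOp P 𝓖 i j f) =ᵐ[P]
      expOp P 𝓖 k l (expOp P 𝓖 i j f) + expOp P 𝓖 k l (expOp P 𝓖 (i - 1) (j - 1) f)
        - expOp P 𝓖 k l (expOp P 𝓖 (i - 1) j f) - expOp P 𝓖 k l (expOp P 𝓖 i (j - 1) f) := by
  have I := fun i j => integrable_expOp (P := P) (𝓖 := 𝓖) i j f
  exact (expOp_sub (((I _ _).add (I _ _)).sub (I _ _)) (I _ _) k l).trans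
    (((expOp_sub ((I _ _).add (I _ _)) (I _ _) k l).trans
      ((expOp_add (I _ _) (I _ _) k l).sub ae_eq_rfl)).sub ae_eq_rfl)

theorem stronglyMeasurable_expOp (i j : ℤ) (f : X → ℝ) :
    StronglyMeasurable[𝓖 i.toNat j.toNat] (expOp P 𝓖 i j f) := by
  unfold expOp
  split_ifs
  exacts [stronglyMeasurable_condExp, stronglyMeasurable_zero]

theorem integral_abs_expOp_le (i j : ℤ) (f : X → ℝ) :
    ∫ x, |expOp P 𝓖 i j f x| ∂P ≤ ∫ x, |f x| ∂P := by
  unfold expOp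
  split_ifs
  · exact integral_abs_condExp_le f
  · simpa using integral_nonneg fun x => abs_nonneg _

theorem integral_abs_diffOp_le (i j : ℕ) (f : X → ℝ) :
    ∫ x, |diffOp P 𝓖 i j f x| ∂P ≤ 4 * ∫ x, |f x| ∂P := by
  have I := fun i j => (integrable_expOp (P := P) (𝓖 := 𝓖) i j f).abs
  have B := fun i j => integral_abs_expOp_le (P := P) (𝓖 := 𝓖) i j f
  have I2 : Integrable (fun x => |expOp P 𝓖 i j f x| + |expOp P 𝓖 (i - 1) (j - 1) f x|) P :=
    (I _ _).add (I _ _)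
  have I3 : Integrable (fun x => |expOp P 𝓖 i j f x| + |expOp P 𝓖 (i - 1) (j - 1) f x|
      + |expOp P 𝓖 (i - 1) j f x|) P := I2.add (I _ _)
  have I4 : Integrable (fun x => |expOp P 𝓖 i j f x| + |expOp P 𝓖 (i - 1) (j - 1) f x|
      + |expOp P 𝓖 (i - 1) j f x| + |expOp P 𝓖 i (j - 1) f x|) P := I3.add (I _ _)
  refine (integral_mono (integrable_diffOp i j f).abs I4 fun x => ?_).trans ?_
  · simp only [diffOp, Pi.add_apply, Pi.sub_apply]
    exact (abs_sub _ _).trans (add_le_add_left ((abs_sub _ _).trans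
      (add_le_add_left (abs_add_le _ _) _)) _)
  · rw [integral_add I3 (I _ _), integral_add I2 (I _ _), integral_add (I _ _) (I _ _)]
    linarith [B i j, B (i - 1) (j - 1), B (i - 1) j, B i (j - 1)]

theorem expOp_sq_le {g V H : X → ℝ} (hg : Integrable g P)
    (hV : Integrable V P) (hH : Integrable H P) (hV0 : ∀ᵐ x ∂P, 0 ≤ V x)
    (hH0 : ∀ᵐ x ∂P, 0 ≤ H x) (h : ∀ᵐ x ∂P, g x ^ 2 ≤ V x * H x) (i j : ℤ) :
    ∀ᵐ x ∂P, (expOp P 𝓖 i j g x) ^ 2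
        ≤ P[V|𝓖 i.toNat j.toNat] x * P[H|𝓖 i.toNat j.toNat] x ∧
      0 ≤ P[V|𝓖 i.toNat j.toNat] x ∧ 0 ≤ P[H|𝓖 i.toNat j.toNat] x := by
  filter_upwards [condExp_sq_le_mul_condExp (m := 𝓖 i.toNat j.toNat) hg hV hH hV0 hH0 h,
    condExp_nonneg (m := 𝓖 i.toNat j.toNat) hV0, condExp_nonneg (m := 𝓖 i.toNat j.toNat) hH0]
    with x h1 h2 h3
  refine ⟨?_, h2, h3⟩
  unfold expOp
  split_ifs
  · exact h1
  · simpa using mul_nonneg h2 h3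

/-- The sum of the conditional expectations of `f` at the four indices entering `diffOp`, with
truncated predecessors. -/
def condExpSum (P : Measure X) (𝓖 : ℕ → ℕ → MeasurableSpace X) (i j : ℕ) (f : X → ℝ) : X → ℝ :=
  P[f|𝓖 i j] + P[f|𝓖 (i - 1) (j - 1)] + P[f|𝓖 (i - 1) j] + P[f|𝓖 i (j - 1)]

theorem integrable_condExpSum (i j : ℕ) (f : X → ℝ) : Integrable (condExpSum P 𝓖 i j f) P :=
  ((integrable_condExp.add integrable_condExp).add integrable_condExp).add integrable_condExp

theorem condExpSum_nonneg {f : X → ℝ} (hf : ∀ᵐ x ∂P, 0 ≤ f x) (i j : ℕ) :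
    ∀ᵐ x ∂P, 0 ≤ condExpSum P 𝓖 i j f x := by
  filter_upwards [condExp_nonneg (m := 𝓖 i j) hf, condExp_nonneg (m := 𝓖 (i - 1) (j - 1)) hf,
    condExp_nonneg (m := 𝓖 (i - 1) j) hf, condExp_nonneg (m := 𝓖 i (j - 1)) hf] with x h1 h2 h3 h4
  exact add_nonneg (add_nonneg (add_nonneg h1 h2) h3) h4

theorem sq_add_sub_sub_le {a b c d v₁ v₂ v₃ v₄ h₁ h₂ h₃ h₄ : ℝ}
    (ha : a ^ 2 ≤ v₁ * h₁ ∧ 0 ≤ v₁ ∧ 0 ≤ h₁) (hb : b ^ 2 ≤ v₂ * h₂ ∧ 0 ≤ v₂ ∧ 0 ≤ h₂)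
    (hc : c ^ 2 ≤ v₃ * h₃ ∧ 0 ≤ v₃ ∧ 0 ≤ h₃) (hd : d ^ 2 ≤ v₄ * h₄ ∧ 0 ≤ v₄ ∧ 0 ≤ h₄) :
    (a + b - c - d) ^ 2 ≤ (v₁ + v₂ + v₃ + v₄) * (h₁ + h₂ + h₃ + h₄) := by
  have two : ∀ {a b v w h k : ℝ}, a ^ 2 ≤ v * h ∧ 0 ≤ v ∧ 0 ≤ h → b ^ 2 ≤ w * k ∧ 0 ≤ w ∧ 0 ≤ k →
      (a + b) ^ 2 ≤ (v + w) * (h + k) ∧ 0 ≤ v + w ∧ 0 ≤ h + k := by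
    rintro a b v w h k ⟨h1, h2, h3⟩ ⟨h4, h5, h6⟩
    refine ⟨?_, by positivity, by positivity⟩
    have key : 2 * (a * b) ≤ v * k + w * h := by
      refine (abs_le_of_sq_le_sq' (a := 2 * (a * b)) ?_ (by positivity)).2
      have h7 : a ^ 2 * b ^ 2 ≤ (v * h) * (w * k) :=
        mul_le_mul h1 h4 (sq_nonneg _) (by positivity)
      nlinarith [sq_nonneg (v * k - w * h)]
    nlinarith
  have hc' : (-c) ^ 2 ≤ v₃ * h₃ ∧ 0 ≤ v₃ ∧ 0 ≤ h₃ := by rwa [neg_sq]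
  have hd' : (-d) ^ 2 ≤ v₄ * h₄ ∧ 0 ≤ v₄ ∧ 0 ≤ h₄ := by rwa [neg_sq]
  simpa only [sub_eq_add_neg] using (two (two (two ha hb) hc') hd').1

theorem diffOp_sq_le {g V H : X → ℝ} (hg : Integrable g P)
    (hV : Integrable V P) (hH : Integrable H P) (hV0 : ∀ᵐ x ∂P, 0 ≤ V x)
    (hH0 : ∀ᵐ x ∂P, 0 ≤ H x) (h : ∀ᵐ x ∂P, g x ^ 2 ≤ V x * H x) (i j : ℕ) :
    ∀ᵐ x ∂P, (diffOp P 𝓖 i j g x) ^ 2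
      ≤ condExpSum P 𝓖 i j V x * condExpSum P 𝓖 i j H x := by
  have K := fun i j => expOp_sq_le (𝓖 := 𝓖) hg hV hH hV0 hH0 h i j
  filter_upwards [K i j, K (i - 1) (j - 1), K (i - 1) j, K i (j - 1)] with x h1 h2 h3 h4
  have e : ∀ n : ℕ, ((n : ℤ) - 1).toNat = n - 1 := fun n => by omega
  simp only [Int.toNat_natCast, e] at h1 h2 h3 h4
  exact sq_add_sub_sub_le h1 h2 h3 h4

namespace IsCommutingFiltration

theorem stronglyMeasurable_diffOp (h : IsCommutingFiltration P 𝓖) (i j : ℕ) (f : X → ℝ) :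
    StronglyMeasurable[𝓖 i j] (diffOp P 𝓖 i j f) := by
  have S : ∀ k l : ℤ, k ≤ i → l ≤ j → StronglyMeasurable[𝓖 i j] (expOp P 𝓖 k l f) :=
    fun k l hk hl => (stronglyMeasurable_expOp k l f).mono (h.mono (by omega) (by omega))
  exact (((S _ _ le_rfl le_rfl).add (S _ _ (by omega) (by omega))).sub
    (S _ _ (by omega) (by omega))).sub (S _ _ (by omega) (by omega))

theorem expOp_expOp (h : IsCommutingFiltration P 𝓖) (i j k l : ℤ) (f : X → ℝ) :
    expOp P 𝓖 k l (expOp P 𝓖 i j f) =ᵐ[P] expOp P 𝓖 (min i k) (min j l) f := by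
  by_cases h1 : 0 ≤ i ∧ 0 ≤ j
  · by_cases h2 : 0 ≤ k ∧ 0 ≤ l
    · have h3 : 0 ≤ min i k ∧ 0 ≤ min j l := by omega
      have e1 : (min i k).toNat = min i.toNat k.toNat := by omega
      have e2 : (min j l).toNat = min j.toNat l.toNat := by omega
      simp only [expOp, h1, h2, h3, and_self, if_true, e1, e2]
      exact h.comm _ _ _ _ f
    · have h3 : ¬ (0 ≤ min i k ∧ 0 ≤ min j l) := by omega
      simp only [expOp, if_neg h2, if_neg h3]
      exact ae_eq_rfl
  · have h3 : ¬ (0 ≤ min i k ∧ 0 ≤ min j l) := by omega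
    have e : expOp P 𝓖 i j f = 0 := if_neg h1
    rw [e, expOp_zero, expOp, if_neg h3]

theorem diffOp_diffOp (h : IsCommutingFiltration P 𝓖) (i j : ℕ) (f : X → ℝ) :
    diffOp P 𝓖 i j (diffOp P 𝓖 i j f) =ᵐ[P] diffOp P 𝓖 i j f := by
  have D := fun k l => expOp_diffOp (P := P) (𝓖 := 𝓖) i j k l f
  have C : ∀ᵐ x ∂P, ∀ a b c d : ℤ, expOp P 𝓖 c d (expOp P 𝓖 a b f) x
      = expOp P 𝓖 (min a c) (min b d) f x := by
    simp only [ae_all_iff]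
    exact fun a b c d => h.expOp_expOp a b c d f
  filter_upwards [D i j, D (i - 1) (j - 1), D (i - 1) j, D i (j - 1), C] with x h1 h2 h3 h4 hC
  rw [diffOp]
  have e : ∀ n : ℕ, min (n : ℤ) (n - 1) = n - 1 := fun n => by omega
  have e' : ∀ n : ℕ, min ((n : ℤ) - 1) n = n - 1 := fun n => by omega
  simp only [Pi.add_apply, Pi.sub_apply, hC, e, e', min_self] at h1 h2 h3 h4 ⊢
  rw [h1, h2, h3, h4, diffOp]
  simp only [Pi.add_apply, Pi.sub_apply]
  ring

theorem integral_condExpSum [IsFiniteMeasure P] (h : IsCommutingFiltration P 𝓖) (i j : ℕ)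
    (f : X → ℝ) : ∫ x, condExpSum P 𝓖 i j f x ∂P = 4 * ∫ x, f x ∂P := by
  have I := fun k l => integrable_condExp (μ := P) (m := 𝓖 k l) (f := f)
  have e := fun k l => integral_condExp (μ := P) (h.le k l) (f := f)
  rw [condExpSum, integral_add' (((I _ _).add (I _ _)).add (I _ _)) (I _ _),
    integral_add' ((I _ _).add (I _ _)) (I _ _), integral_add' (I _ _) (I _ _), e, e, e, e]
  ring

end IsCommutingFiltration

end DifferenceOperator

section WeightedBounds

variable {X : Type*} {mX : MeasurableSpace X} {P : Measure X} {𝓖 : ℕ → ℕ → MeasurableSpace X}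
  [IsProbabilityMeasure P] {s : X → ℝ} {G H : ℕ → ℕ → X → ℝ}

namespace IsCommutingFiltration

theorem sum_integral_abs_diffOp_le (h : IsCommutingFiltration P 𝓖) (hs : MemLp s 2 P) (N : ℕ)
    (hG : ∀ i j, Integrable (G i j) P) (hH : ∀ i j, Integrable (H i j) P)
    (hH0 : ∀ i j, ∀ᵐ x ∂P, 0 ≤ H i j x)
    (hGH : ∀ i j, ∀ᵐ x ∂P, G i j x ^ 2 ≤ ((P[s|𝓖 i j] - P[s|𝓖 (i - 1) j]) x
        - (P[s|𝓖 i (j - 1)] - P[s|𝓖 (i - 1) (j - 1)]) x) ^ 2 * H i j x) :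
    ∑ i ∈ Finset.range N, ∑ j ∈ Finset.range N, ∫ x, |diffOp P 𝓖 i j (G i j) x| ∂P
      ≤ 2 * (∫ x, s x ^ 2 ∂P + ∑ i ∈ Finset.range N, ∑ j ∈ Finset.range N, ∫ x, H i j x ∂P) := by
  have pt : ∀ i j, ∫ x, |diffOp P 𝓖 i j (G i j) x| ∂P ≤
      2 * (∫ x, ((P[s|𝓖 i j] - P[s|𝓖 (i - 1) j]) x
        - (P[s|𝓖 i (j - 1)] - P[s|𝓖 (i - 1) (j - 1)]) x) ^ 2 ∂P + ∫ x, H i j x ∂P) := by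
    intro i j
    have I : Integrable (fun x => ((P[s|𝓖 i j] - P[s|𝓖 (i - 1) j]) x
        - (P[s|𝓖 i (j - 1)] - P[s|𝓖 (i - 1) (j - 1)]) x) ^ 2) P :=
      ((memLp_sub hs i j (i - 1) j).sub (memLp_sub hs i (j - 1) (i - 1) (j - 1))).integrable_sq
    have := integral_mono_ae (hG i j).abs ((I.add (hH i j)).const_mul (1 / 2)) (by
      filter_upwards [hGH i j, hH0 i j] with x h1 h2
      simp only [Pi.add_apply]
      refine abs_le_of_sq_le_sq (h1.trans ?_) (by positivity)
      nlinarith [sq_nonneg (((P[s|𝓖 i j] - P[s|𝓖 (i - 1) j]) x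
        - (P[s|𝓖 i (j - 1)] - P[s|𝓖 (i - 1) (j - 1)]) x) ^ 2 - H i j x)])
    rw [integral_const_mul, integral_add' I (hH i j)] at this
    refine (integral_abs_diffOp_le i j (G i j)).trans ?_
    linarith
  refine (Finset.sum_le_sum fun i _ => Finset.sum_le_sum fun j _ => pt i j).trans ?_
  simp only [← Finset.mul_sum, Finset.sum_add_distrib]
  have := h.sum_integral_sq_mixed_le hs N
  linarith

theorem integral_sqrt_sum_diffOp_le (h : IsCommutingFiltration P 𝓖) (hs : MemLp s 2 P) (N : ℕ)
    (hG : ∀ i j, Integrable (G i j) P) (hH : ∀ i j, Integrable (H i j) P)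
    (hH0 : ∀ i j, ∀ᵐ x ∂P, 0 ≤ H i j x)
    (hGH : ∀ i j, ∀ᵐ x ∂P, G i j x ^ 2 ≤ (P[s|𝓖 (i - 1) (j - 1)] x) ^ 2 * H i j x) :
    ∫ x, √(∑ p ∈ Finset.range N ×ˢ Finset.range N,
        P[fun y => diffOp P 𝓖 p.1 p.2 (G p.1 p.2) y ^ 2|𝓖 (p.1 - 1) (p.2 - 1)] x) ∂P
      ≤ 32 * ∫ x, s x ^ 2 ∂P
        + 2 * ∑ i ∈ Finset.range N, ∑ j ∈ Finset.range N, ∫ x, H i j x ∂P := by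
  obtain ⟨A, hA, hAs, hAi⟩ := h.exists_maximal hs N
  have L : ∀ i j, MemLp (P[s|𝓖 i j]) 2 P := fun i j => hs.condExp one_le_two
  have key := integral_sqrt_sum_condExp_sq_le (P := P) (Finset.range N ×ˢ Finset.range N)
    (𝓜 := fun p : ℕ × ℕ => 𝓖 (p.1 - 1) (p.2 - 1)) (fun p => h.le _ _)
    (g := fun p => diffOp P 𝓖 p.1 p.2 (G p.1 p.2))
    (V := fun p x => 4 * (P[s|𝓖 (p.1 - 1) (p.2 - 1)] x) ^ 2)
    (H := fun p => condExpSum P 𝓖 p.1 p.2 (H p.1 p.2)) (B := fun x => 4 * A x ^ 2)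
    (fun p => ((stronglyMeasurable_condExp.pow 2).const_mul 4).aestronglyMeasurable)
    (fun p => .of_forall fun x => by positivity)
    (fun p hp => by
      simp only [Finset.mem_product, Finset.mem_range] at hp
      filter_upwards [hAs (p.1 - 1) (by omega) (p.2 - 1) (by omega)] with x hx
      rw [← sq_abs]
      gcongr)
    (hA.integrable_sq.const_mul 4) (.of_forall fun x => by positivity)
    (fun p => integrable_condExpSum _ _ _) (fun p => condExpSum_nonneg (hH0 _ _) _ _)
    (fun p _ => by
      obtain ⟨i, j⟩ := p
      simp only
      have I := (L (i - 1) (j - 1)).integrable_sq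
      have e : ∀ {k l}, i - 1 ≤ k → j - 1 ≤ l →
          P[fun x => (P[s|𝓖 (i - 1) (j - 1)] x) ^ 2|𝓖 k l]
            = fun x => (P[s|𝓖 (i - 1) (j - 1)] x) ^ 2 := fun hk hl =>
        condExp_of_stronglyMeasurable (h.le _ _)
          ((stronglyMeasurable_condExp.mono (h.mono hk hl)).pow 2) I
      filter_upwards [diffOp_sq_le (𝓖 := 𝓖) (hG i j) I (hH i j)
        (.of_forall fun x => by positivity) (hH0 i j) (hGH i j) i j] with x hx
      refine hx.trans_eq ?_
      rw [condExpSum, e (by omega) (by omega), e (by omega) (by omega), e (by omega) (by omega),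
        e (by omega) (by omega)]
      simp only [Pi.add_apply]
      ring)
  refine key.trans ?_
  simp only [h.integral_condExpSum, integral_const_mul, ← Finset.mul_sum]
  rw [Finset.sum_product]
  linarith

theorem condExpSum_sq_sub_eq (h : IsCommutingFiltration P 𝓖) (hs : MemLp s 2 P) (i j : ℕ) :
    condExpSum P 𝓖 i j (fun x => (P[s|𝓖 i (j - 1)] - P[s|𝓖 (i - 1) (j - 1)]) x ^ 2) =ᵐ[P]
      fun x => 2 * (P[s|𝓖 i (j - 1)] - P[s|𝓖 (i - 1) (j - 1)]) x ^ 2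
        + 2 * P[fun x => (P[s|𝓖 i (j - 1)] - P[s|𝓖 (i - 1) (j - 1)]) x ^ 2|
            𝓖 (i - 1) (j - 1)] x := by
  have I := (memLp_sub (𝓖 := 𝓖) hs i (j - 1) (i - 1) (j - 1)).integrable_sq
  have S : StronglyMeasurable[𝓖 i (j - 1)] (P[s|𝓖 i (j - 1)] - P[s|𝓖 (i - 1) (j - 1)]) :=
    stronglyMeasurable_condExp.sub
      (stronglyMeasurable_condExp.mono (h.mono (Nat.sub_le i 1) le_rfl))
  have e := condExp_of_stronglyMeasurable (h.le i (j - 1)) (S.pow 2) I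
  have e' := condExp_of_stronglyMeasurable (h.le i j)
    ((S.mono (h.mono le_rfl (Nat.sub_le j 1))).pow 2) I
  have c := h.comm_of_le (Nat.sub_le i 1) (Nat.sub_le j 1)
    fun x => (P[s|𝓖 i (j - 1)] - P[s|𝓖 (i - 1) (j - 1)]) x ^ 2
  simp only [Pi.pow_def] at e e'
  rw [e] at c
  filter_upwards [c] with x hx
  rw [condExpSum, e, e']
  simp only [Pi.add_apply, hx]
  ring

theorem integral_sqrt_sum_diffOp_sub_le (h : IsCommutingFiltration P 𝓖) (hs : MemLp s 2 P)
    {N : ℕ} {𝓡 : ℕ → MeasurableSpace X} (hR : ∀ i j, 𝓖 i j ≤ 𝓡 j) (hRle : ∀ j, 𝓡 j ≤ mX)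
    {M : X → ℝ} (hM : MemLp M 2 P) (i : ℕ)
    (hMs : ∀ j ≤ N, ∀ᵐ x ∂P, |(P[s|𝓖 i j] - P[s|𝓖 (i - 1) j]) x| ≤ M x)
    (hG : ∀ i j, Integrable (G i j) P) (hH : ∀ i j, Integrable (H i j) P)
    (hH0 : ∀ i j, ∀ᵐ x ∂P, 0 ≤ H i j x)
    (hGH : ∀ i j, ∀ᵐ x ∂P, G i j x ^ 2
      ≤ (P[s|𝓖 i (j - 1)] - P[s|𝓖 (i - 1) (j - 1)]) x ^ 2 * H i j x) :
    ∫ x, √(∑ j ∈ Finset.range N,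
        P[fun y => diffOp P 𝓖 i j (G i j) y ^ 2|𝓡 (j - 1)] x) ∂P
      ≤ 2 * ∫ x, M x ^ 2 ∂P + 2 * ∑ j ∈ Finset.range N, ∫ x, H i j x ∂P := by
  set b : ℕ → X → ℝ := fun j => P[s|𝓖 i (j - 1)] - P[s|𝓖 (i - 1) (j - 1)] with hb
  have bL : ∀ j, MemLp (b j) 2 P := fun j => memLp_sub hs _ _ _ _
  have S : ∀ j, StronglyMeasurable[𝓖 i (j - 1)] (b j) := fun j =>
    stronglyMeasurable_condExp.sub
      (stronglyMeasurable_condExp.mono (h.mono (Nat.sub_le i 1) le_rfl))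
  have hbM : ∀ j ∈ Finset.range N, ∀ᵐ x ∂P, b j x ^ 2 ≤ M x ^ 2 := fun j hj => by
    rw [Finset.mem_range] at hj
    filter_upwards [hMs (j - 1) (by omega)] with x hx
    rw [← sq_abs]
    gcongr
  have key := integral_sqrt_sum_condExp_sq_le (P := P) (Finset.range N)
    (𝓜 := fun j => 𝓡 (j - 1)) (fun j => hRle _)
    (g := fun j => diffOp P 𝓖 i j (G i j))
    (V := fun j x => 2 * b j x ^ 2 + 2 * P[fun x => b j x ^ 2|𝓖 (i - 1) (j - 1)] x)
    (H := fun j => condExpSum P 𝓖 i j (H i j))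
    (B := fun x => 2 * M x ^ 2 + 2 * P[fun x => M x ^ 2|𝓖 (i - 1) N] x)
    (fun j => (((((S j).mono (hR _ _)).pow 2).const_mul 2).add
      ((stronglyMeasurable_condExp.mono (hR _ _)).const_mul 2)).aestronglyMeasurable)
    (fun j => by
      filter_upwards [condExp_nonneg (m := 𝓖 (i - 1) (j - 1)) (μ := P)
        (f := fun x => b j x ^ 2) (.of_forall fun x => sq_nonneg (b j x))] with x hx
      exact add_nonneg (mul_nonneg zero_le_two (sq_nonneg _)) (mul_nonneg zero_le_two hx))
    (fun j hj => by
      have hjN := (Finset.mem_range.1 hj).le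
      have c := h.comm_of_le (Nat.sub_le i 1) ((Nat.sub_le j 1).trans hjN) fun x => b j x ^ 2
      have e := condExp_of_stronglyMeasurable (h.le i (j - 1)) ((S j).pow 2) (bL j).integrable_sq
      simp only [Pi.pow_def] at e
      rw [e] at c
      filter_upwards [hbM j hj, c, condExp_mono (m := 𝓖 (i - 1) N) (bL j).integrable_sq
        hM.integrable_sq (hbM j hj)] with x h1 h2 h3
      rw [← h2]
      linarith)
    ((hM.integrable_sq.const_mul 2).add (integrable_condExp.const_mul 2))
    (by
      filter_upwards [condExp_nonneg (m := 𝓖 (i - 1) N) (μ := P)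
        (f := fun x => M x ^ 2) (.of_forall fun x => sq_nonneg (M x))] with x hx
      exact add_nonneg (mul_nonneg zero_le_two (sq_nonneg _)) (mul_nonneg zero_le_two hx))
    (fun p => integrable_condExpSum _ _ _) (fun p => condExpSum_nonneg (hH0 _ _) _ _)
    (fun j _ => by
      filter_upwards [diffOp_sq_le (𝓖 := 𝓖) (hG i j) (bL j).integrable_sq (hH i j)
        (.of_forall fun x => sq_nonneg _) (hH0 i j) (hGH i j) i j, h.condExpSum_sq_sub_eq hs i j]
        with x h1 h2
      rw [← h2]
      exact h1)
  refine key.trans_eq ?_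
  rw [integral_add (hM.integrable_sq.const_mul 2) (integrable_condExp.const_mul 2)]
  simp only [h.integral_condExpSum, integral_const_mul, ← Finset.mul_sum,
    integral_condExp (h.le _ _)]
  ring

theorem sum_integral_sqrt_sum_diffOp_sub_le (h : IsCommutingFiltration P 𝓖) (hs : MemLp s 2 P)
    (N : ℕ) {𝓡 : ℕ → MeasurableSpace X} (hR : ∀ i j, 𝓖 i j ≤ 𝓡 j) (hRle : ∀ j, 𝓡 j ≤ mX)
    (hG : ∀ i j, Integrable (G i j) P) (hH : ∀ i j, Integrable (H i j) P)
    (hH0 : ∀ i j, ∀ᵐ x ∂P, 0 ≤ H i j x)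
    (hGH : ∀ i j, ∀ᵐ x ∂P, G i j x ^ 2
      ≤ (P[s|𝓖 i (j - 1)] - P[s|𝓖 (i - 1) (j - 1)]) x ^ 2 * H i j x) :
    ∑ i ∈ Finset.range N, ∫ x, √(∑ j ∈ Finset.range N,
        P[fun y => diffOp P 𝓖 i j (G i j) y ^ 2|𝓡 (j - 1)] x) ∂P
      ≤ 8 * ∫ x, s x ^ 2 ∂P
        + 2 * ∑ i ∈ Finset.range N, ∑ j ∈ Finset.range N, ∫ x, H i j x ∂P := by
  obtain ⟨M, hM, hMs, hMi⟩ := h.exists_maximal_sub hs N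
  refine (Finset.sum_le_sum fun i hi => h.integral_sqrt_sum_diffOp_sub_le hs hR hRle (hM i) i
    (hMs i (Finset.mem_range.1 hi).le) hG hH hH0 hGH).trans ?_
  rw [Finset.sum_add_distrib, ← Finset.mul_sum, ← Finset.mul_sum]
  linarith

end IsCommutingFiltration

end WeightedBounds

section Decomposition

variable {X : Type*} {mX : MeasurableSpace X} {P : Measure X} {𝓖 : ℕ → ℕ → MeasurableSpace X}
  {m : MeasurableSpace X}

theorem le_condExp_of_le [IsFiniteMeasure P] (hm : m ≤ mX) {s : X → ℝ} (hs : Integrable s P)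
    {ε : ℝ} (h : ∀ x, ε ≤ s x) : ∀ᵐ x ∂P, ε ≤ P[s|m] x := by
  have := condExp_mono (m := m) (integrable_const ε) hs (.of_forall h)
  rwa [condExp_const hm] at this

theorem one_le_condExp_inv_sq_mul [IsProbabilityMeasure P] (hm : m ≤ mX) {s : X → ℝ}
    (hs : Integrable s P) {ε : ℝ} (hε : 0 < ε) (hsε : ∀ x, ε ≤ s x) :
    ∀ᵐ x ∂P, 1 ≤ P[fun y => (s y)⁻¹ ^ 2|m] x * (P[s|m] x) ^ 2 := by
  have pos : ∀ x, 0 < s x := fun x => hε.trans_le (hsε x)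
  have hL : MemLp (fun y => (s y)⁻¹) 2 P :=
    MemLp.of_bound hs.1.inv₀ ε⁻¹ (.of_forall fun x => by
      rw [Real.norm_of_nonneg (inv_nonneg.2 (pos x).le)]
      exact inv_anti₀ hε (hsε x))
  have cs := condExp_sq_le_mul_condExp (m := m) (P := P) (integrable_const (1 : ℝ))
    (hL.integrable one_le_two) hs (.of_forall fun x => inv_nonneg.2 (pos x).le)
    (.of_forall fun x => (pos x).le)
    (.of_forall fun x => by rw [inv_mul_cancel₀ (pos x).ne', one_pow])
  rw [condExp_const hm] at cs
  filter_upwards [cs, condExp_sq_le_condExp_sq hm hL] with x h1 h2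
  calc (1 : ℝ) ≤ (P[fun y => (s y)⁻¹|m] x * P[s|m] x) ^ 2 := one_le_pow₀ (by simpa using h1)
    _ = (P[fun y => (s y)⁻¹|m] x) ^ 2 * (P[s|m] x) ^ 2 := mul_pow _ _ _
    _ ≤ _ := mul_le_mul_of_nonneg_right h2 (sq_nonneg _)

theorem integral_sq_div_sq_condExp_le [IsProbabilityMeasure P] (hm : m ≤ mX) {s g : X → ℝ}
    (hs : Integrable s P) {ε : ℝ} (hε : 0 < ε) (hsε : ∀ x, ε ≤ s x) (hg : StronglyMeasurable[m] g)
    (hgs : Integrable (fun x => g x ^ 2 / s x ^ 2) P) :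
    Integrable (fun x => g x ^ 2 / (P[s|m] x) ^ 2) P ∧
      ∫ x, g x ^ 2 / (P[s|m] x) ^ 2 ∂P ≤ ∫ x, g x ^ 2 / s x ^ 2 ∂P := by
  have pos : ∀ x, 0 < s x := fun x => hε.trans_le (hsε x)
  have hg' := (hg.mono hm).aestronglyMeasurable (μ := P)
  have hr : Integrable (fun x => (s x)⁻¹ ^ 2) P :=
    Integrable.of_bound (hs.1.inv₀.pow 2) (ε⁻¹ ^ 2) (.of_forall fun x => by
      rw [Real.norm_of_nonneg (sq_nonneg _)]
      exact pow_le_pow_left₀ (inv_nonneg.2 (pos x).le) (inv_anti₀ hε (hsε x)) 2)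
  have hI : Integrable (fun x => g x ^ 2 * (s x)⁻¹ ^ 2) P := by
    simpa only [inv_pow, div_eq_mul_inv] using hgs
  have hle : ∀ᵐ x ∂P, g x ^ 2 / (P[s|m] x) ^ 2 ≤ P[fun x => g x ^ 2 * (s x)⁻¹ ^ 2|m] x := by
    filter_upwards [condExp_mul_of_stronglyMeasurable_left (hg.pow 2) hI hr,
      one_le_condExp_inv_sq_mul hm hs hε hsε, le_condExp_of_le hm hs hsε] with x h1 h2 h3
    have h4 : 0 < P[s|m] x := hε.trans_le h3
    refine le_trans ?_ h1.ge
    rw [div_le_iff₀ (by positivity), Pi.mul_apply, Pi.pow_apply, mul_assoc]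
    exact le_mul_of_one_le_right (sq_nonneg _) h2
  have hI' : Integrable (fun x => g x ^ 2 / (P[s|m] x) ^ 2) P := by
    refine (integrable_condExp (m := m) (f := fun x => g x ^ 2 * (s x)⁻¹ ^ 2)).mono
      ((hg'.pow 2).div₀ (integrable_condExp.1.pow 2)) ?_
    filter_upwards [hle] with x hx
    rw [Real.norm_of_nonneg (by positivity)]
    exact hx.trans (le_abs_self _)
  refine ⟨hI', (integral_mono_ae hI' integrable_condExp hle).trans_eq ?_⟩
  rw [integral_condExp hm]
  simp only [inv_pow, div_eq_mul_inv]

/-- `g` is an integrable martingale difference at the index `(i, j)`. -/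
structure IsMartingaleDifference (P : Measure X) (𝓖 : ℕ → ℕ → MeasurableSpace X) (i j : ℕ)
    (g : X → ℝ) : Prop where
  stronglyMeasurable : StronglyMeasurable[𝓖 i j] g
  integrable : Integrable g P
  ae_eq : g =ᵐ[P] diffOp P 𝓖 i j g

theorem IsMartingaleDifference.sub {i j : ℕ} {f g : X → ℝ} (hf : IsMartingaleDifference P 𝓖 i j f)
    (hg : IsMartingaleDifference P 𝓖 i j g) : IsMartingaleDifference P 𝓖 i j (f - g) where
  stronglyMeasurable := hf.stronglyMeasurable.sub hg.stronglyMeasurable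
  integrable := hf.integrable.sub hg.integrable
  ae_eq := (hf.ae_eq.sub hg.ae_eq).trans (diffOp_sub hf.integrable hg.integrable i j).symm

theorem IsMartingaleDifference.zero (i j : ℕ) : IsMartingaleDifference P 𝓖 i j 0 where
  stronglyMeasurable := stronglyMeasurable_zero
  integrable := integrable_zero _ _ _
  ae_eq := by rw [diffOp_zero]

theorem IsCommutingFiltration.isMartingaleDifference_diffOp (h : IsCommutingFiltration P 𝓖)
    (i j : ℕ) (g : X → ℝ) : IsMartingaleDifference P 𝓖 i j (diffOp P 𝓖 i j g) where
  stronglyMeasurable := h.stronglyMeasurable_diffOp i j g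
  integrable := integrable_diffOp i j g
  ae_eq := (h.diffOp_diffOp i j g).symm

theorem integrable_sqrt_sum_sq {ι : Type*} {s : Finset ι} {f : ι → X → ℝ}
    (hf : ∀ k ∈ s, Integrable (f k) P) : Integrable (fun x => √(∑ k ∈ s, f k x ^ 2)) P := by
  refine (integrable_finsetSum s fun k hk => (hf k hk).abs).mono ?_ (.of_forall fun x => ?_)
  · exact Real.continuous_sqrt.comp_aestronglyMeasurable
      (Finset.aestronglyMeasurable_fun_sum s fun k hk => (hf k hk).1.pow 2)
  · rw [Real.norm_of_nonneg (Real.sqrt_nonneg _)]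
    refine le_trans ?_ (le_abs_self _)
    refine Real.sqrt_le_iff.2 ⟨Finset.sum_nonneg fun k _ => abs_nonneg _, ?_⟩
    refine le_trans (Finset.sum_le_sum fun k _ => (sq_abs (f k x)).ge) ?_
    exact Finset.sum_sq_le_sq_sum_of_nonneg fun k _ => abs_nonneg _

variable [IsProbabilityMeasure P]

/-- `f = α + β + γ + δ` is a decomposition of a two-parameter martingale difference sequence
indexed by `[0, N) × [0, N)` into martingale difference sequences satisfying the Davis–Garsia
estimate with constant `C`. -/
structure IsDavisGarsiaDecomposition (P : Measure X) (𝓖 : ℕ → ℕ → MeasurableSpace X)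
    (𝓡 𝓛 : ℕ → MeasurableSpace X) (C : ℝ) (N : ℕ) (f α β γ δ : ℕ → ℕ → X → ℝ) : Prop where
  left : ∀ i j, IsMartingaleDifference P 𝓖 i j (α i j) ∧ IsMartingaleDifference P 𝓖 i j (β i j) ∧
    IsMartingaleDifference P 𝓖 i j (γ i j) ∧ IsMartingaleDifference P 𝓖 i j (δ i j)
  eq_zero : ∀ i j, ¬ (i < N ∧ j < N) → α i j = 0 ∧ β i j = 0 ∧ γ i j = 0 ∧ δ i j = 0
  sum_eq : ∀ i j, f i j = α i j + β i j + γ i j + δ i j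
  bound : ∑ i ∈ Finset.range N, ∑ j ∈ Finset.range N, ∫ x, |α i j x| ∂P
    + ∫ x, √(∑ p ∈ Finset.range N ×ˢ Finset.range N,
        P[fun y => β p.1 p.2 y ^ 2|𝓖 (p.1 - 1) (p.2 - 1)] x) ∂P
    + ∑ i ∈ Finset.range N, ∫ x, √(∑ j ∈ Finset.range N,
        P[fun y => γ i j y ^ 2|𝓡 (j - 1)] x) ∂P
    + ∑ j ∈ Finset.range N, ∫ x, √(∑ i ∈ Finset.range N,
        P[fun y => δ i j y ^ 2|𝓛 (i - 1)] x) ∂P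
    ≤ C * ∫ x, √(∑ p ∈ Finset.range N ×ˢ Finset.range N, f p.1 p.2 x ^ 2) ∂P

theorem IsCommutingFiltration.exists_decomposition_of_pos (h : IsCommutingFiltration P 𝓖)
    {𝓡 𝓛 : ℕ → MeasurableSpace X} (hR : ∀ i j, 𝓖 i j ≤ 𝓡 j) (hRle : ∀ j, 𝓡 j ≤ mX)
    (hL : ∀ i j, 𝓖 i j ≤ 𝓛 i) (hLle : ∀ i, 𝓛 i ≤ mX) {N : ℕ} {f : ℕ → ℕ → X → ℝ}
    (hf : ∀ i j, IsMartingaleDifference P 𝓖 i j (f i j))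
    (hf0 : ∀ i j, ¬ (i < N ∧ j < N) → f i j = 0)
    (hpos : 0 < ∫ x, √(∑ p ∈ Finset.range N ×ˢ Finset.range N, f p.1 p.2 x ^ 2) ∂P) :
    ∃ α β γ δ, IsDavisGarsiaDecomposition P 𝓖 𝓡 𝓛 108 N f α β γ δ := by
  set S : X → ℝ := fun x => √(∑ p ∈ Finset.range N ×ˢ Finset.range N, f p.1 p.2 x ^ 2) with hS
  set c : ℝ := ∫ x, S x ∂P with hc
  have SI : Integrable S P := integrable_sqrt_sum_sq fun p _ => (hf p.1 p.2).integrable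
  have S0 : ∀ x, 0 ≤ S x := fun x => Real.sqrt_nonneg _
  have S2 : ∀ x, S x ^ 2 = ∑ i ∈ Finset.range N, ∑ j ∈ Finset.range N, f i j x ^ 2 := fun x => by
    rw [hS, ← Finset.sum_product']
    exact Real.sq_sqrt (Finset.sum_nonneg fun p _ => sq_nonneg _)
  have fS : ∀ i j x, f i j x ^ 2 ≤ S x ^ 2 := fun i j x => by
    by_cases hij : i < N ∧ j < N
    · refine (Finset.single_le_sum (s := Finset.range N ×ˢ Finset.range N)
        (f := fun p : ℕ × ℕ => f p.1 p.2 x ^ 2) (fun p _ => sq_nonneg _) (a := (i, j))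
        (by simpa using hij)).trans_eq ?_
      exact (Real.sq_sqrt (Finset.sum_nonneg fun p _ => sq_nonneg _)).symm
    · simpa [hf0 i j hij] using sq_nonneg (S x)
  set s : X → ℝ := fun x => √(S x + c) with hs
  have s2 : ∀ x, s x ^ 2 = S x + c := fun x => Real.sq_sqrt (add_nonneg (S0 x) hpos.le)
  have hε : 0 < √c := Real.sqrt_pos.2 hpos
  have hsε : ∀ x, √c ≤ s x := fun x => Real.sqrt_le_sqrt (by linarith [S0 x])
  have spos : ∀ x, 0 < s x := fun x => hε.trans_le (hsε x)
  have sL : MemLp s 2 P := by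
    refine (memLp_two_iff_integrable_sq
      (Real.continuous_sqrt.comp_aestronglyMeasurable (SI.1.add_const c))).2 ?_
    exact (SI.add (integrable_const c)).congr (.of_forall fun x => (s2 x).symm)
  have sI : ∫ x, s x ^ 2 ∂P = 2 * c := by
    simp only [s2]
    rw [integral_add SI (integrable_const c)]
    simp [← hc, two_mul]
  have S2s : ∀ x, S x ^ 2 / s x ^ 2 ≤ S x := fun x => by
    rw [s2, div_le_iff₀ (by linarith [S0 x])]
    nlinarith [S0 x]
  have fsI : ∀ i j, Integrable (fun x => f i j x ^ 2 / s x ^ 2) P := fun i j => by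
    refine SI.mono (((hf i j).integrable.1.pow 2).div₀ (sL.1.pow 2)) (.of_forall fun x => ?_)
    rw [Real.norm_of_nonneg (by positivity), Real.norm_of_nonneg (S0 x)]
    exact (div_le_div_of_nonneg_right (fS i j x) (sq_nonneg _)).trans (S2s x)
  have K := fun i j => integral_sq_div_sq_condExp_le (h.le i j) (sL.integrable one_le_two) hε hsε
    (hf i j).stronglyMeasurable (fsI i j)
  set H : ℕ → ℕ → X → ℝ := fun i j x => f i j x ^ 2 / (P[s|𝓖 i j] x) ^ 2 with hH
  have HI : ∀ i j, Integrable (H i j) P := fun i j => (K i j).1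
  have H0 : ∀ i j, ∀ᵐ x ∂P, 0 ≤ H i j x := fun i j => .of_forall fun x => by positivity
  have Hsum : ∑ i ∈ Finset.range N, ∑ j ∈ Finset.range N, ∫ x, H i j x ∂P ≤ c := by
    calc ∑ i ∈ Finset.range N, ∑ j ∈ Finset.range N, ∫ x, H i j x ∂P
        ≤ ∑ i ∈ Finset.range N, ∑ j ∈ Finset.range N, ∫ x, f i j x ^ 2 / s x ^ 2 ∂P :=
          Finset.sum_le_sum fun i _ => Finset.sum_le_sum fun j _ => (K i j).2
      _ = ∫ x, S x ^ 2 / s x ^ 2 ∂P := by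
          simp only [S2, Finset.sum_div]
          rw [integral_finsetSum _ fun i _ => integrable_finsetSum _ fun j _ => fsI i j]
          exact Finset.sum_congr rfl fun i _ => (integral_finsetSum _ fun j _ => fsI i j).symm
      _ ≤ c := by
          refine integral_mono_of_nonneg (.of_forall fun x => by positivity) SI
            (.of_forall S2s)
  set G : (ℕ → ℕ → X → ℝ) → ℕ → ℕ → X → ℝ := fun w i j x =>
    w i j x * (f i j x / P[s|𝓖 i j] x) with hG
  have GI : ∀ w : ℕ → ℕ → X → ℝ, (∀ i j, MemLp (w i j) 2 P) →
      ∀ i j, Integrable (G w i j) P := fun w hw i j => by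
    refine (hw i j).integrable_mul ((memLp_two_iff_integrable_sq
      ((hf i j).integrable.1.div₀ integrable_condExp.1)).2 ?_)
    simpa only [Pi.div_apply, div_pow] using HI i j
  have GH : ∀ w i j, ∀ᵐ x ∂P, G w i j x ^ 2 ≤ w i j x ^ 2 * H i j x := fun w i j =>
    .of_forall fun x => by simp only [hG, hH, mul_pow, div_pow]; exact le_rfl
  have G0 : ∀ w i j, ¬ (i < N ∧ j < N) → diffOp P 𝓖 i j (G w i j) = 0 := fun w i j hij => by
    have : G w i j = 0 := by
      ext x
      simp [hG, hf0 i j hij]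
    rw [this, diffOp_zero]
  set a : ℕ → ℕ → X → ℝ := fun i j => P[s|𝓖 (i - 1) (j - 1)] with ha
  set b : ℕ → ℕ → X → ℝ := fun i j => P[s|𝓖 i (j - 1)] - P[s|𝓖 (i - 1) (j - 1)] with hb
  set d : ℕ → ℕ → X → ℝ := fun i j => P[s|𝓖 (i - 1) j] - P[s|𝓖 (i - 1) (j - 1)] with hd
  set e : ℕ → ℕ → X → ℝ := fun i j x => (P[s|𝓖 i j] - P[s|𝓖 (i - 1) j]) x
        - (P[s|𝓖 i (j - 1)] - P[s|𝓖 (i - 1) (j - 1)]) x with he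
  have aL : ∀ i j, MemLp (a i j) 2 P := fun i j => sL.condExp one_le_two
  have bL : ∀ i j, MemLp (b i j) 2 P := fun i j => IsCommutingFiltration.memLp_sub sL _ _ _ _
  have dL : ∀ i j, MemLp (d i j) 2 P := fun i j => IsCommutingFiltration.memLp_sub sL _ _ _ _
  have eL : ∀ i j, MemLp (e i j) 2 P := fun i j =>
    (IsCommutingFiltration.memLp_sub sL i j (i - 1) j).sub (bL i j)
  have split : ∀ i j, G e i j =ᵐ[P] f i j - G a i j - G b i j - G d i j := fun i j => by
    filter_upwards [le_condExp_of_le (h.le i j) (sL.integrable one_le_two) hsε] with x hx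
    have hne : P[s|𝓖 i j] x ≠ 0 := (hε.trans_le hx).ne'
    simp only [hG, ha, hb, hd, he, Pi.sub_apply]
    field_simp
    ring
  have Dα : ∀ i j, f i j - diffOp P 𝓖 i j (G a i j) - diffOp P 𝓖 i j (G b i j)
      - diffOp P 𝓖 i j (G d i j) =ᵐ[P] diffOp P 𝓖 i j (G e i j) := fun i j => by
    have I := (hf i j).integrable
    have Ia := GI a aL i j
    have Ib := GI b bL i j
    have Id := GI d dL i j
    filter_upwards [(hf i j).ae_eq, diffOp_congr (𝓖 := 𝓖) (split i j) i j,
      diffOp_sub (𝓖 := 𝓖) ((I.sub Ia).sub Ib) Id i j, diffOp_sub (𝓖 := 𝓖) (I.sub Ia) Ib i j,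
      diffOp_sub (𝓖 := 𝓖) I Ia i j] with x h1 h2 h3 h4 h5
    simp only [Pi.sub_apply] at *
    rw [h2, h3, h4, h5, ← h1]
  have MD := fun w i j => h.isMartingaleDifference_diffOp i j (G w i j)
  refine ⟨fun i j => f i j - diffOp P 𝓖 i j (G a i j) - diffOp P 𝓖 i j (G b i j)
      - diffOp P 𝓖 i j (G d i j), fun i j => diffOp P 𝓖 i j (G a i j),
    fun i j => diffOp P 𝓖 i j (G b i j), fun i j => diffOp P 𝓖 i j (G d i j), ?_, ?_, ?_, ?_⟩
  · exact fun i j => ⟨(((hf i j).sub (MD a i j)).sub (MD b i j)).sub (MD d i j), MD a i j,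
      MD b i j, MD d i j⟩
  · intro i j hij
    simp [hf0 i j hij, G0 _ i j hij]
  · intro i j
    abel
  · have B1 := h.sum_integral_abs_diffOp_le sL N (GI e eL) HI H0 (GH e)
    have B2 := h.integral_sqrt_sum_diffOp_le sL N (GI a aL) HI H0 (GH a)
    have B3 := h.sum_integral_sqrt_sum_diffOp_sub_le sL N hR hRle (GI b bL) HI H0 (GH b)
    have B4 := h.swap.sum_integral_sqrt_sum_diffOp_sub_le sL N (fun i j => hL j i) hLle
      (G := fun j i => G d i j) (H := fun j i => H i j)
      (fun j i => GI d dL i j) (fun j i => HI i j) (fun j i => H0 i j) (fun j i => GH d i j)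
    simp only [diffOp_swap] at B4
    rw [Finset.sum_comm (f := fun j i => ∫ x, H i j x ∂P)] at B4
    have B1' : ∑ i ∈ Finset.range N, ∑ j ∈ Finset.range N,
        ∫ x, |(f i j - diffOp P 𝓖 i j (G a i j) - diffOp P 𝓖 i j (G b i j)
          - diffOp P 𝓖 i j (G d i j)) x| ∂P
        = ∑ i ∈ Finset.range N, ∑ j ∈ Finset.range N, ∫ x, |diffOp P 𝓖 i j (G e i j) x| ∂P := by
      refine Finset.sum_congr rfl fun i _ => Finset.sum_congr rfl fun j _ => integral_congr_ae ?_
      filter_upwards [Dα i j] with x hx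
      rw [hx]
    rw [B1']
    linarith

/-- The two-parameter Davis–Garsia decomposition for an arbitrary commuting filtration. -/
theorem IsCommutingFiltration.exists_decomposition (h : IsCommutingFiltration P 𝓖)
    {𝓡 𝓛 : ℕ → MeasurableSpace X} (hR : ∀ i j, 𝓖 i j ≤ 𝓡 j) (hRle : ∀ j, 𝓡 j ≤ mX)
    (hL : ∀ i j, 𝓖 i j ≤ 𝓛 i) (hLle : ∀ i, 𝓛 i ≤ mX) {N : ℕ} {f : ℕ → ℕ → X → ℝ}
    (hf : ∀ i j, IsMartingaleDifference P 𝓖 i j (f i j))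
    (hf0 : ∀ i j, ¬ (i < N ∧ j < N) → f i j = 0) :
    ∃ α β γ δ, IsDavisGarsiaDecomposition P 𝓖 𝓡 𝓛 108 N f α β γ δ := by
  rcases (integral_nonneg fun x => Real.sqrt_nonneg _ : 0 ≤ ∫ x,
    √(∑ p ∈ Finset.range N ×ˢ Finset.range N, f p.1 p.2 x ^ 2) ∂P).eq_or_lt with h0 | hpos
  swap
  · exact h.exists_decomposition_of_pos hR hRle hL hLle hf hf0 hpos
  have hz := (integral_eq_zero_iff_of_nonneg (fun x => Real.sqrt_nonneg _)
    (integrable_sqrt_sum_sq fun p _ => (hf p.1 p.2).integrable)).1 h0.symm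
  have fz : ∀ i ∈ Finset.range N, ∀ j ∈ Finset.range N, ∫ x, |f i j x| ∂P = 0 := by
    intro i hi j hj
    refine integral_eq_zero_of_ae ?_
    filter_upwards [hz] with x hx
    have hx' := (Real.sqrt_eq_zero (Finset.sum_nonneg fun p _ => sq_nonneg _)).1 hx
    have := (Finset.sum_eq_zero_iff_of_nonneg fun p _ => sq_nonneg _).1 hx' (i, j)
      (Finset.mem_product.2 ⟨hi, hj⟩)
    simpa using this
  refine ⟨f, 0, 0, 0, fun i j => ⟨hf i j, .zero i j, .zero i j, .zero i j⟩,
    fun i j hij => ⟨hf0 i j hij, rfl, rfl, rfl⟩, fun i j => by simp, ?_⟩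
  rw [← h0, Finset.sum_congr rfl fun i hi => Finset.sum_congr rfl (fz i hi)]
  have zc : ∀ m : MeasurableSpace X, P[fun _ => (0 : ℝ)|m] = 0 := fun m => condExp_zero
  simp [zc]

end Decomposition

theorem isCommutingFiltration_canonF2 {Ω : Type} [MeasurableSpace Ω] (ν : Measure (ℕ → Ω))
    [IsProbabilityMeasure ν] : IsCommutingFiltration (ν.prod ν) (canonF2 Ω) where
  le := canonF2_le
  mono := canonF2_mono
  comm := condExp_condExp_canonF2 ν

theorem exists_forall_eq_zero_of_finite_support {M : Type*} [Zero M] {f : ℕ × ℕ → M}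
    (hf : (Function.support f).Finite) : ∃ N, ∀ i j, ¬ (i < N ∧ j < N) → f (i, j) = 0 := by
  obtain ⟨⟨a, b⟩, hab⟩ := hf.bddAbove
  refine ⟨max a b + 1, fun i j hij => ?_⟩
  by_contra hne
  obtain ⟨h₁, h₂⟩ := Prod.mk_le_mk.1 (hab (show (i, j) ∈ Function.support f from hne))
  omega

theorem tsum_eq_sum_range_product {g : ℕ × ℕ → ℝ} {N : ℕ}
    (hg : ∀ i j, ¬ (i < N ∧ j < N) → g (i, j) = 0) :
    ∑' p, g p = ∑ p ∈ Finset.range N ×ˢ Finset.range N, g p :=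
  tsum_eq_sum fun p hp => hg p.1 p.2 (by simpa using hp)

theorem tsum_eq_sum_range {g : ℕ → ℝ} {N : ℕ} (hg : ∀ i, N ≤ i → g i = 0) :
    ∑' i, g i = ∑ i ∈ Finset.range N, g i :=
  tsum_eq_sum fun i hi => hg i (by simpa using hi)

theorem condExp_sq_apply_of_eq_zero {X : Type*} {m mX : MeasurableSpace X} {P : Measure X}
    {g : X → ℝ} (hg : g = 0) (x : X) : P[fun y => g y ^ 2|m] x = 0 := by
  have : (fun y => g y ^ 2) = 0 := by
    ext y
    simp [hg]
  rw [this, condExp_zero, Pi.zero_apply]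

/-- two-parameter Davis–Garsia decomposition for martingale difference
sequences: the decomposition can be chosen so that each summand is again a martingale
difference sequence. -/
theorem statement3 :
    ∃ c : ℝ, 0 < c ∧
      ∀ (Ω : Type) [MeasurableSpace Ω] (μ : Measure Ω), IsProbabilityMeasure μ →
        ∀ (ν : Measure (ℕ → Ω)), IsProbabilityMeasure ν →
          (∀ n : ℕ, ν.map (fun x (k : Fin n) => x k) = Measure.pi fun _ : Fin n => μ) →
          ∀ f : ℕ × ℕ → (ℕ → Ω) × (ℕ → Ω) → ℝ,
            (∀ i j : ℕ, Measurable[canonF2 Ω i j] (f (i, j))) →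
            (∀ p : ℕ × ℕ, Integrable (f p) (ν.prod ν)) →
            (∀ i j : ℕ, f (i, j) =ᵐ[ν.prod ν] mdiff2 (ν.prod ν) i j (f (i, j))) →
            (Function.support f).Finite →
            ∃ α β γ δ : ℕ × ℕ → (ℕ → Ω) × (ℕ → Ω) → ℝ,
              (∀ i j : ℕ,
                Measurable[canonF2 Ω i j] (α (i, j)) ∧ Measurable[canonF2 Ω i j] (β (i, j)) ∧
                Measurable[canonF2 Ω i j] (γ (i, j)) ∧ Measurable[canonF2 Ω i j] (δ (i, j))) ∧
              (∀ p : ℕ × ℕ, Integrable (α p) (ν.prod ν) ∧ Integrable (β p) (ν.prod ν) ∧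
                Integrable (γ p) (ν.prod ν) ∧ Integrable (δ p) (ν.prod ν)) ∧
              (∀ i j : ℕ,
                (α (i, j) =ᵐ[ν.prod ν] mdiff2 (ν.prod ν) i j (α (i, j))) ∧
                (β (i, j) =ᵐ[ν.prod ν] mdiff2 (ν.prod ν) i j (β (i, j))) ∧
                (γ (i, j) =ᵐ[ν.prod ν] mdiff2 (ν.prod ν) i j (γ (i, j))) ∧
                (δ (i, j) =ᵐ[ν.prod ν] mdiff2 (ν.prod ν) i j (δ (i, j)))) ∧
              (∀ p : ℕ × ℕ, f p = α p + β p + γ p + δ p) ∧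
              ∫ z, Real.sqrt (∑' p : ℕ × ℕ, (f p z) ^ 2) ∂(ν.prod ν) ≥
                c * ((∑' p : ℕ × ℕ, ∫ z, |α p z| ∂(ν.prod ν))
                  + (∫ z, Real.sqrt (∑' p : ℕ × ℕ,
                      ((ν.prod ν)[fun w => (β p w) ^ 2|canonF2 Ω (p.1 - 1) (p.2 - 1)]) z)
                      ∂(ν.prod ν))
                  + (∑' i : ℕ, ∫ z, Real.sqrt (∑' j : ℕ,
                      ((ν.prod ν)[fun w => (γ (i, j) w) ^ 2|canonF2InfR Ω (j - 1)]) z)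
                      ∂(ν.prod ν))
                  + (∑' j : ℕ, ∫ z, Real.sqrt (∑' i : ℕ,
                      ((ν.prod ν)[fun w => (δ (i, j) w) ^ 2|canonF2InfL Ω (i - 1)]) z)
                      ∂(ν.prod ν))) := by
  refine ⟨1 / 108, by norm_num, fun Ω _ μ hμ ν hν hμν f hfm hfi hfd hfs => ?_⟩
  obtain ⟨N, hN⟩ := exists_forall_eq_zero_of_finite_support hfs
  obtain ⟨α, β, γ, δ, D⟩ := (isCommutingFiltration_canonF2 ν).exists_decomposition
    (𝓡 := canonF2InfR Ω) (𝓛 := canonF2InfL Ω) (f := fun i j => f (i, j))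
    (fun i j => le_iSup (fun i => canonF2 Ω i j) i) (fun j => iSup_le fun i => canonF2_le i j)
    (fun i j => le_iSup (fun j => canonF2 Ω i j) j) (fun i => iSup_le fun j => canonF2_le i j)
    (fun i j => ⟨(hfm i j).stronglyMeasurable, hfi (i, j), hfd i j⟩) hN
  have zR : ∀ {i j}, N ≤ j → ¬ (i < N ∧ j < N) := fun hj h => hj.not_gt h.2
  have zL : ∀ {i j}, N ≤ i → ¬ (i < N ∧ j < N) := fun hi h => hi.not_gt h.1
  refine ⟨fun p => α p.1 p.2, fun p => β p.1 p.2, fun p => γ p.1 p.2, fun p => δ p.1 p.2,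
    fun i j => ?_, fun p => ?_, fun i j => ?_, fun p => D.sum_eq p.1 p.2, ?_⟩
  · obtain ⟨a, b, c, d⟩ := D.left i j
    exact ⟨a.stronglyMeasurable.measurable, b.stronglyMeasurable.measurable,
      c.stronglyMeasurable.measurable, d.stronglyMeasurable.measurable⟩
  · obtain ⟨a, b, c, d⟩ := D.left p.1 p.2
    exact ⟨a.integrable, b.integrable, c.integrable, d.integrable⟩
  · obtain ⟨a, b, c, d⟩ := D.left i j
    exact ⟨a.ae_eq, b.ae_eq, c.ae_eq, d.ae_eq⟩
  have eα : ∑' p : ℕ × ℕ, ∫ z, |α p.1 p.2 z| ∂(ν.prod ν)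
      = ∑ i ∈ Finset.range N, ∑ j ∈ Finset.range N, ∫ z, |α i j z| ∂(ν.prod ν) := by
    rw [tsum_eq_sum_range_product fun i j hij => by simp [(D.eq_zero i j hij).1],
      Finset.sum_product]
  have ef := fun z => tsum_eq_sum_range_product (N := N) (g := fun p => f p z ^ 2)
    fun i j hij => by simp [hN i j hij]
  have eβ := fun z => tsum_eq_sum_range_product (g := fun p =>
      ((ν.prod ν)[fun w => β p.1 p.2 w ^ 2|canonF2 Ω (p.1 - 1) (p.2 - 1)]) z)
    fun i j hij => condExp_sq_apply_of_eq_zero (D.eq_zero i j hij).2.1 z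
  have eγ := fun i z => tsum_eq_sum_range (g := fun j =>
      ((ν.prod ν)[fun w => γ i j w ^ 2|canonF2InfR Ω (j - 1)]) z)
    fun j hj => condExp_sq_apply_of_eq_zero (D.eq_zero i j (zR hj)).2.2.1 z
  have eδ := fun j z => tsum_eq_sum_range (g := fun i =>
      ((ν.prod ν)[fun w => δ i j w ^ 2|canonF2InfL Ω (i - 1)]) z)
    fun i hi => condExp_sq_apply_of_eq_zero (D.eq_zero i j (zL hi)).2.2.2 z
  simp only [eα, ef, eβ, eγ, eδ]
  rw [tsum_eq_sum_range (N := N), tsum_eq_sum_range (N := N)]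
  · have := D.bound
    linarith
  · intro j hj
    simp [condExp_sq_apply_of_eq_zero (D.eq_zero _ j (zR hj)).2.2.2]
  · intro i hi
    simp [condExp_sq_apply_of_eq_zero (D.eq_zero i _ (zL hi)).2.2.1]

end
end
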